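/- arXiv:1404.6157 — 11 statements merged into one kernel-verified Lean document; each statement's English description precedes it below -/
import Mathlib

section
/- Let n ≥ 1. Let Δ ⊂ ℝ^{2n−1} be a compact set such that Z^{−t}(Δ) ⊆ interior(Δ) for every t > 0, where Z^t(z,x,y) = (e^t z, e^{t/2} x, e^{t/2} y) is the flow of the radial contact vector field. Let K, H : ℝ^{2n−1} → ℝ be continuous functions that are nonnegative, not identically zero, and whose supports are compact subsets of interior(Δ). Then there exists a map (t,p) ↦ Φ_t(p), C^∞ on [0,1] × ℝ^{2n−1}, such that: Φ_0 is the identity; each Φ_t is a diffeomorphism of ℝ^{2n−1} equal to the identity outside a compact subset of interior(Δ); each Φ_t is a contactomorphism of λ_st with some positive conformal factor c_t; and the time-one map Φ := Φ_1 with factor c := c_1 satisfies (c·K)∘Φ^{−1} ≥ H everywhere on ℝ^{2n−1}, i.e. c(p)·K(p) ≥ H(Φ(p)) for every p. -/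
/-- Points of `ℝ^{2n−1} = ℝ × ℝ^{n−1} × ℝ^{n−1}`, written `p = (z, x, y)`. -/
abbrev ContactSpace (m : ℕ) : Type := ℝ × (Fin m → ℝ) × (Fin m → ℝ)

/-- The standard contact form `λ_st = dz + Σ (x_i dy_i − y_i dx_i)` evaluated at the
point `p` on the tangent vector `v`. -/
noncomputable def lamSt (m : ℕ) (p v : ContactSpace m) : ℝ :=
  v.1 + ∑ i, (p.2.1 i * v.2.2 i - p.2.2 i * v.2.1 i)

/-- The time-`t` flow `Z^t(z,x,y) = (e^t z, e^{t/2} x, e^{t/2} y)` of the radial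
contact vector field `Z`. -/
noncomputable def radialFlow (m : ℕ) (t : ℝ) (p : ContactSpace m) : ContactSpace m :=
  (Real.exp t * p.1, fun i => Real.exp (t / 2) * p.2.1 i,
    fun i => Real.exp (t / 2) * p.2.2 i)

open Set Filter Topology
open scoped ContDiff unitInterval NNReal

/-- Pointwise application of a continuous family of operators to a continuous family of vectors. -/
noncomputable def ContinuousMap.pointwiseApply (α E F : Type) [TopologicalSpace α] [CompactSpace α]
    [NormedAddCommGroup E] [NormedSpace ℝ E] [NormedAddCommGroup F] [NormedSpace ℝ F] :
    C(α, E →L[ℝ] F) →L[ℝ] C(α, E) →L[ℝ] C(α, F) :=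
  LinearMap.mkContinuous₂
    (LinearMap.mk₂ ℝ
      (fun (A : C(α, E →L[ℝ] F)) (η : C(α, E)) => (⟨fun a => A a (η a), by fun_prop⟩ : C(α, F)))
      (fun _ _ _ => by ext; simp) (fun _ _ _ => by ext; simp)
      (fun _ _ _ => by ext; simp) (fun _ _ _ => by ext; simp)) 1
    (fun A η => by
      rw [one_mul]
      refine (ContinuousMap.norm_le _ (by positivity)).2 fun a => ?_
      exact ((A a).le_opNorm _).trans
        (mul_le_mul (A.norm_coe_le_norm a) (η.norm_coe_le_norm a) (norm_nonneg _)
          (norm_nonneg A)))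

section Superposition

variable {α E F : Type} [TopologicalSpace α] [CompactSpace α]
  [NormedAddCommGroup E] [NormedSpace ℝ E] [NormedAddCommGroup F] [NormedSpace ℝ F]

theorem norm_sub_sub_fderiv_le {X : E → F} (hX : Differentiable ℝ X)
    (hu : UniformContinuous (fderiv ℝ X)) {ε : ℝ} (hε : 0 < ε) :
    ∃ δ > 0, ∀ a b : E, ‖b - a‖ < δ → ‖X b - X a - fderiv ℝ X a (b - a)‖ ≤ ε * ‖b - a‖ := by
  obtain ⟨δ, hδ, h⟩ := Metric.uniformContinuous_iff.1 hu ε hε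
  refine ⟨δ, hδ, fun a b hab => ?_⟩
  refine (convex_ball a δ).norm_image_sub_le_of_norm_fderiv_le' (𝕜 := ℝ)
    (fun x _ => hX x) (fun x hx => ?_) (Metric.mem_ball_self hδ)
    (by rwa [Metric.mem_ball, dist_eq_norm])
  rw [← dist_eq_norm]
  exact (h hx).le

/-- The superposition operator `γ ↦ X ∘ γ` on continuous functions. -/
def ContinuousMap.superpose (X : E → F) (hX : Continuous X) (γ : C(α, E)) : C(α, F) :=
  (⟨X, hX⟩ : C(E, F)).comp γ

theorem ContinuousMap.hasFDerivAt_superpose {X : E → F} (hX : ContDiff ℝ ∞ X)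
    (hc : HasCompactSupport X) (γ : C(α, E)) :
    HasFDerivAt (ContinuousMap.superpose (α := α) X hX.continuous)
      (ContinuousMap.pointwiseApply α E F
        (ContinuousMap.superpose (fderiv ℝ X) (hX.continuous_fderiv (by simp)) γ)) γ := by
  refine HasFDerivAt.of_isLittleO ?_
  rw [Asymptotics.isLittleO_iff]
  intro ε hε
  have hu : UniformContinuous (fderiv ℝ X) :=
    (hc.fderiv ℝ).uniformContinuous_of_continuous (hX.continuous_fderiv (by simp))
  obtain ⟨δ, hδ, h⟩ := norm_sub_sub_fderiv_le (hX.differentiable (by simp)) hu hε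
  filter_upwards [Metric.ball_mem_nhds γ hδ] with η hη
  rw [Metric.mem_ball, dist_eq_norm] at hη
  refine (ContinuousMap.norm_le _ (by positivity)).2 fun a => ?_
  have ha : ‖η a - γ a‖ ≤ ‖η - γ‖ := (η - γ).norm_coe_le_norm a
  exact (h (γ a) (η a) (ha.trans_lt hη)).trans (mul_le_mul_of_nonneg_left ha hε.le)

theorem ContinuousMap.contDiff_nat_superpose (n : ℕ) {X : E → F} (hX : ContDiff ℝ ∞ X)
    (hc : HasCompactSupport X) :
    ContDiff ℝ n (ContinuousMap.superpose (α := α) X hX.continuous) := by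
  induction n generalizing F with
  | zero =>
    exact contDiff_zero.2 (continuous_iff_continuousAt.2 fun γ =>
      (hasFDerivAt_superpose hX hc γ).continuousAt)
  | succ n ih =>
    rw [Nat.cast_succ, contDiff_succ_iff_hasFDerivAt]
    have hX' : ContDiff ℝ ∞ (fderiv ℝ X) := hX.fderiv_right (by simp)
    exact ⟨fun γ => ContinuousMap.pointwiseApply α E F
        (ContinuousMap.superpose (fderiv ℝ X) hX'.continuous γ),
      ContDiff.comp (g := ContinuousMap.pointwiseApply α E F) (ContinuousLinearMap.contDiff _)
        (ih hX' (hc.fderiv ℝ)),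
      fun γ => hasFDerivAt_superpose hX hc γ⟩

theorem ContinuousMap.contDiff_superpose {X : E → F} (hX : ContDiff ℝ ∞ X)
    (hc : HasCompactSupport X) :
    ContDiff ℝ ∞ (ContinuousMap.superpose (α := α) X hX.continuous) :=
  contDiff_infty.2 fun n => contDiff_nat_superpose n hX hc

end Superposition

theorem exists_forall_hasDerivAt_of_lipschitzWith {E : Type} [NormedAddCommGroup E]
    [NormedSpace ℝ E] [CompleteSpace E] {X : E → E} {K L : ℝ≥0} (hK : LipschitzWith K X)
    (hL : ∀ x, ‖X x‖ ≤ L) (x : E) :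
    ∃ γ : ℝ → E, γ 0 = x ∧ ∀ t, HasDerivAt γ (X (γ t)) t := by
  have key : ∀ N : ℕ, ∃ α : ℝ → E, α 0 = x ∧
      ∀ t ∈ Ioo (-(N : ℝ)) N, HasDerivAt α (X (α t)) t := by
    intro N
    have hP : IsPicardLindelof (fun _ => X) (tmin := -(N : ℝ)) (tmax := N)
        ⟨0, by simp⟩ x (L * N) 0 L K :=
      { lipschitzOnWith := fun _ _ => hK.lipschitzOnWith
        continuousOn := fun _ _ => continuousOn_const
        norm_le := fun _ _ y _ => hL y
        mul_max_le := by simp }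
    obtain ⟨α, h0, hα⟩ := hP.exists_eq_forall_mem_Icc_hasDerivWithinAt₀
    exact ⟨α, h0, fun t ht => (hα t (Ioo_subset_Icc_self ht)).hasDerivAt
      (Icc_mem_nhds ht.1 ht.2)⟩
  choose α h0 hα using key
  have agree : ∀ (M N : ℕ) (t : ℝ), |t| < M → |t| < N → α M t = α N t := by
    intro M N t hM hN
    have hlt : |t| < min (M : ℝ) N := lt_min hM hN
    refine ODE_solution_unique_of_mem_Ioo (v := fun _ => X) (s := fun _ => univ) (t₀ := 0)
      (a := -min (M : ℝ) N) (b := min (M : ℝ) N)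
      (fun _ _ => hK.lipschitzOnWith) ?_ (fun u hu => ⟨hα M u ?_, mem_univ _⟩)
      (fun u hu => ⟨hα N u ?_, mem_univ _⟩) ((h0 M).trans (h0 N).symm) (abs_lt.1 hlt)
    · have := (abs_nonneg t).trans_lt hlt
      exact ⟨by linarith, this⟩
    · exact abs_lt.1 ((abs_lt.2 hu).trans_le (min_le_left _ _))
    · exact abs_lt.1 ((abs_lt.2 hu).trans_le (min_le_right _ _))
  have hceil : ∀ t : ℝ, |t| < ((⌈|t|⌉₊ + 1 : ℕ) : ℝ) := fun t => by
    push_cast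
    linarith [Nat.le_ceil |t|]
  refine ⟨fun t => α (⌈|t|⌉₊ + 1) t, h0 _, fun t => ?_⟩
  refine (hα _ t (abs_lt.1 (hceil t))).congr_of_eventuallyEq ?_
  filter_upwards [(continuous_abs.tendsto t).eventually_lt_const (hceil t)] with u hu
  exact agree _ _ u (hceil u) hu

/-- The Volterra operator `γ ↦ (s ↦ ∫₀ˢ γ)` on `C([0,1], E)`. -/
noncomputable def volterra (E : Type) [NormedAddCommGroup E] [NormedSpace ℝ E] [CompleteSpace E] :
    C(I, E) →L[ℝ] C(I, E) :=
  LinearMap.mkContinuous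
    { toFun := fun γ => ⟨fun s => ∫ r in (0 : ℝ)..s, γ (projIcc 0 1 zero_le_one r), by
        refine (intervalIntegral.continuous_primitive (fun a b => ?_) 0).comp continuous_subtype_val
        exact Continuous.intervalIntegrable (γ.continuous.comp continuous_projIcc) a b⟩
      map_add' := fun γ η => by
        ext s
        exact intervalIntegral.integral_add
          (Continuous.intervalIntegrable (γ.continuous.comp continuous_projIcc) _ _)
          (Continuous.intervalIntegrable (η.continuous.comp continuous_projIcc) _ _)
      map_smul' := fun c γ => by
        ext s
        exact intervalIntegral.integral_smul c _ } 1
    (fun γ => by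
      rw [one_mul]
      refine (ContinuousMap.norm_le _ (norm_nonneg γ)).2 fun s => ?_
      refine (intervalIntegral.norm_integral_le_of_norm_le_const
        (fun r _ => γ.norm_coe_le_norm _)).trans ?_
      rw [sub_zero, abs_of_nonneg s.2.1]
      exact mul_le_of_le_one_right (norm_nonneg _) s.2.2)

section Volterra

variable {E : Type} [NormedAddCommGroup E] [NormedSpace ℝ E] [CompleteSpace E]

theorem volterra_apply (γ : C(I, E)) (s : I) :
    volterra E γ s = ∫ r in (0 : ℝ)..s, γ (projIcc 0 1 zero_le_one r) := rfl

theorem norm_volterra_apply_le (γ : C(I, E)) : ‖volterra E γ‖ ≤ ‖γ‖ := by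
  simpa using (volterra E).le_of_opNorm_le (LinearMap.mkContinuous_norm_le _ zero_le_one _) γ

end Volterra

/-- The embedding of `E` into `C(α, E)` as constant functions. -/
noncomputable def ContinuousMap.constCLM (α E : Type) [TopologicalSpace α] [CompactSpace α]
    [NormedAddCommGroup E] [NormedSpace ℝ E] : E →L[ℝ] C(α, E) :=
  LinearMap.mkContinuous
    { toFun := ContinuousMap.const α
      map_add' := fun _ _ => rfl
      map_smul' := fun _ _ => rfl } 1
    (fun x => by
      rw [one_mul]
      exact (ContinuousMap.norm_le _ (norm_nonneg x)).2 fun _ => le_rfl)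

/-- The residual of the rescaled integral equation `γ(s) = x + t ∫₀ˢ X(γ(r)) dr`. -/
noncomputable def picardResidual {E : Type} [NormedAddCommGroup E] [NormedSpace ℝ E]
    [CompleteSpace E] (X : E → E) (hX : Continuous X) (u : (ℝ × E) × C(I, E)) : C(I, E) :=
  u.2 - ContinuousMap.constCLM I E u.1.2 -
    u.1.1 • volterra E (ContinuousMap.superpose X hX u.2)

section Residual

variable {E : Type} [NormedAddCommGroup E] [NormedSpace ℝ E] [CompleteSpace E] {X : E → E}
  {K : ℝ≥0}

theorem contDiff_picardResidual (hX : ContDiff ℝ ∞ X) (hc : HasCompactSupport X) :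
    ContDiff ℝ ∞ (picardResidual X hX.continuous) := by
  have h1 : ContDiff ℝ ∞ (fun u : (ℝ × E) × C(I, E) =>
      ContinuousMap.superpose X hX.continuous u.2) :=
    (ContinuousMap.contDiff_superpose hX hc).comp contDiff_snd
  have h2 : ContDiff ℝ ∞ (fun u : (ℝ × E) × C(I, E) =>
      volterra E (ContinuousMap.superpose X hX.continuous u.2)) :=
    (volterra E).contDiff.comp h1
  have h3 : ContDiff ℝ ∞ (fun u : (ℝ × E) × C(I, E) => ContinuousMap.constCLM I E u.1.2) :=
    (ContinuousMap.constCLM I E).contDiff.comp (contDiff_snd.comp contDiff_fst)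
  exact (contDiff_snd.sub h3).sub ((contDiff_fst.comp contDiff_fst).smul h2)

theorem isInvertible_fderiv_picardResidual (hX : ContDiff ℝ ∞ X) (hc : HasCompactSupport X)
    (hK : LipschitzWith K X) (u : (ℝ × E) × C(I, E)) (hu : |u.1.1| * K < 1) :
    (fderiv ℝ (picardResidual X hX.continuous) u ∘L
      ContinuousLinearMap.inr ℝ (ℝ × E) C(I, E)).IsInvertible := by
  set A := ContinuousMap.pointwiseApply I E E
    (ContinuousMap.superpose (fderiv ℝ X) (hX.continuous_fderiv (by simp)) u.2)
  have h1 : HasFDerivAt (fun η => picardResidual X hX.continuous (u.1, η))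
      (ContinuousLinearMap.id ℝ C(I, E) - u.1.1 • (volterra E ∘L A)) u.2 := by
    have hs := (volterra E).hasFDerivAt.comp u.2 (ContinuousMap.hasFDerivAt_superpose hX hc u.2)
    exact ((hasFDerivAt_id u.2).sub_const (ContinuousMap.constCLM I E u.1.2)).sub
      (hs.const_smul u.1.1)
  have h2 : HasFDerivAt (fun η => picardResidual X hX.continuous (u.1, η))
      (fderiv ℝ (picardResidual X hX.continuous) u ∘L
        ContinuousLinearMap.inr ℝ (ℝ × E) C(I, E)) u.2 :=
    HasFDerivAt.comp (g := picardResidual X hX.continuous) (f := fun η => (u.1, η)) u.2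
      (((contDiff_picardResidual hX hc).differentiable (by simp)) u).hasFDerivAt
      (hasFDerivAt_prodMk_right u.1 u.2)
  rw [h2.unique h1]
  have hA : ‖u.1.1 • (volterra E ∘L A)‖ ≤ |u.1.1| * K := by
    refine ContinuousLinearMap.opNorm_le_bound _ (by positivity) fun η => ?_
    rw [smul_apply, norm_smul, Real.norm_eq_abs, mul_assoc]
    refine mul_le_mul_of_nonneg_left ((norm_volterra_apply_le _).trans ?_) (abs_nonneg _)
    refine (ContinuousMap.norm_le _ (by positivity)).2 fun s => ?_
    refine (ContinuousLinearMap.le_of_opNorm_le _ (norm_fderiv_le_of_lipschitz ℝ hK) _).trans ?_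
    exact mul_le_mul_of_nonneg_left (η.norm_coe_le_norm s) K.2
  have hunit : IsUnit (1 - u.1.1 • (volterra E ∘L A)) :=
    isUnit_one_sub_of_norm_lt_one (x := u.1.1 • (volterra E ∘L A)) (hA.trans_lt hu)
  obtain ⟨U, hU⟩ := hunit
  exact ⟨ContinuousLinearEquiv.ofUnit U, hU⟩

theorem eq_of_picardResidual_eq_zero (hK : LipschitzWith K X) {p : ℝ × E} (hp : |p.1| * K < 1)
    {γ η : C(I, E)} (hγ : picardResidual X hK.continuous (p, γ) = 0)
    (hη : picardResidual X hK.continuous (p, η) = 0) : γ = η := by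
  have h1 : γ - η = p.1 • volterra E (ContinuousMap.superpose X hK.continuous γ -
      ContinuousMap.superpose X hK.continuous η) := by
    rw [map_sub, smul_sub]
    simp only [picardResidual] at hγ hη
    rw [sub_eq_zero] at hγ hη
    rw [← hγ, ← hη]
    abel
  have h2 : ‖γ - η‖ ≤ |p.1| * K * ‖γ - η‖ := by
    conv_lhs => rw [h1]
    rw [norm_smul, Real.norm_eq_abs, mul_assoc]
    refine mul_le_mul_of_nonneg_left ((norm_volterra_apply_le _).trans ?_) (abs_nonneg _)
    refine (ContinuousMap.norm_le _ (by positivity)).2 fun s => ?_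
    refine (hK.norm_sub_le (γ s) (η s)).trans ?_
    exact mul_le_mul_of_nonneg_left ((γ - η).norm_coe_le_norm s) K.2
  rw [← sub_eq_zero, ← norm_le_zero_iff]
  nlinarith [norm_nonneg (γ - η)]

theorem picardResidual_eq_zero_of_hasDerivAt (hX : Continuous X) {γ : ℝ → E}
    (hγ : ∀ t, HasDerivAt γ (X (γ t)) t) (hγc : Continuous γ) (t : ℝ) :
    picardResidual X hX ((t, γ 0), ⟨fun s : I => γ (t * s), by fun_prop⟩) = 0 := by
  ext s
  have hd : ∀ r : ℝ, HasDerivAt (fun r => γ (t * r)) (t • X (γ (t * r))) r := fun r =>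
    (hγ (t * r)).scomp r (by simpa using (hasDerivAt_id r).const_mul t)
  have hint := intervalIntegral.integral_eq_sub_of_hasDerivAt (a := 0) (b := s)
    (fun r _ => hd r) (Continuous.intervalIntegrable (by fun_prop) _ _)
  rw [intervalIntegral.integral_smul, mul_zero] at hint
  have hv : volterra E (ContinuousMap.superpose X hX ⟨fun s : I => γ (t * s), by fun_prop⟩) s =
      ∫ r in (0 : ℝ)..s, X (γ (t * r)) := by
    rw [volterra_apply]
    refine intervalIntegral.integral_congr fun r hr => ?_
    rw [uIcc_of_le s.2.1] at hr
    simp only [ContinuousMap.superpose, ContinuousMap.comp_apply, ContinuousMap.coe_mk]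
    rw [projIcc_of_mem zero_le_one ⟨hr.1, hr.2.trans s.2.2⟩]
  change γ (t * s) - γ 0 - t • _ = 0
  rw [hv, hint, sub_self]

end Residual

/-- `φ` is the global flow of the vector field `X`. -/
structure IsGlobalFlow {E : Type} [NormedAddCommGroup E] [NormedSpace ℝ E] (X : E → E)
    (φ : ℝ × E → E) : Prop where
  zero : ∀ p, φ (0, p) = p
  hasDerivAt : ∀ t p, HasDerivAt (fun s => φ (s, p)) (X (φ (t, p))) t

namespace IsGlobalFlow

variable {E : Type} [NormedAddCommGroup E] [NormedSpace ℝ E] {X : E → E} {φ : ℝ × E → E} {K : ℝ≥0}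

theorem eq_of_hasDerivAt (h : IsGlobalFlow X φ) (hK : LipschitzWith K X) {γ : ℝ → E}
    (hγ : ∀ t, HasDerivAt γ (X (γ t)) t) (t : ℝ) : φ (t, γ 0) = γ t :=
  congrFun (ODE_solution_unique_univ (v := fun _ => X) (s := fun _ => univ) (t₀ := 0)
    (fun _ => hK.lipschitzOnWith) (fun t => ⟨h.hasDerivAt t (γ 0), mem_univ _⟩)
    (fun t => ⟨hγ t, mem_univ _⟩) (h.zero _)) t

theorem eq_of_hasDerivAt_Icc (h : IsGlobalFlow X φ) (hK : LipschitzWith K X) {γ : ℝ → E} {T : ℝ}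
    (hγ : ∀ t ∈ Icc 0 T, HasDerivAt γ (X (γ t)) t) {t : ℝ} (ht : t ∈ Icc 0 T) :
    φ (t, γ 0) = γ t :=
  ODE_solution_unique (v := fun _ => X) (fun _ => hK)
    (fun s _ => (h.hasDerivAt s (γ 0)).continuousAt.continuousWithinAt)
    (fun s _ => (h.hasDerivAt s (γ 0)).hasDerivWithinAt)
    (fun s hs => (hγ s hs).continuousAt.continuousWithinAt)
    (fun s hs => (hγ s (Ico_subset_Icc_self hs)).hasDerivWithinAt) (h.zero _) ht

theorem add (h : IsGlobalFlow X φ) (hK : LipschitzWith K X) (s t : ℝ) (p : E) :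
    φ (s + t, p) = φ (s, φ (t, p)) := by
  have := h.eq_of_hasDerivAt hK (γ := fun s => φ (s + t, p))
    (fun s => (h.hasDerivAt (s + t) p).comp_add_const s t) s
  simpa using this.symm

theorem neg_apply (h : IsGlobalFlow X φ) (hK : LipschitzWith K X) (t : ℝ) (p : E) :
    φ (-t, φ (t, p)) = p := by
  rw [← h.add hK, neg_add_cancel, h.zero]

theorem eq_self (h : IsGlobalFlow X φ) (hK : LipschitzWith K X) {p : E} (hp : X p = 0) (t : ℝ) :
    φ (t, p) = p :=
  h.eq_of_hasDerivAt hK (γ := fun _ => p) (fun t => by rw [hp]; exact hasDerivAt_const t p) t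

theorem hasDerivAt_fderiv (h : IsGlobalFlow X φ) (hX : ContDiff ℝ ∞ X) (hφ : ContDiff ℝ ∞ φ)
    (t : ℝ) (p v : E) :
    HasDerivAt (fun s => fderiv ℝ (fun q => φ (s, q)) p v)
      (fderiv ℝ X (φ (t, p)) (fderiv ℝ (fun q => φ (t, q)) p v)) t := by
  have hd : Differentiable ℝ φ := hφ.differentiable (by simp)
  have hslice : ∀ s, fderiv ℝ (fun q => φ (s, q)) p v = fderiv ℝ φ (s, p) (0, v) := fun s => by
    have := (hd (s, p)).hasFDerivAt.comp p (hasFDerivAt_prodMk_right s p)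
    exact congrArg (· v) this.fderiv
  have htime : ∀ u, fderiv ℝ φ u (1, 0) = X (φ u) := fun u => by
    have h1 := (hd u).hasFDerivAt.comp_hasDerivAt u.1
      ((hasDerivAt_id u.1).prodMk (hasDerivAt_const u.1 u.2))
    exact h1.unique (h.hasDerivAt u.1 u.2)
  have hd2 : Differentiable ℝ (fderiv ℝ φ) :=
    (hφ.fderiv_right (m := ∞) (by simp)).differentiable (by simp)
  have hsymm : IsSymmSndFDerivAt ℝ φ (t, p) := by
    refine hφ.contDiffAt.isSymmSndFDerivAt ?_
    rw [minSmoothness_of_isRCLikeNormedField]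
    exact WithTop.coe_le_coe.2 (le_top : (2 : ℕ∞) ≤ ⊤)
  have heval : ∀ w : ℝ × E, HasFDerivAt (fun u => fderiv ℝ φ u w)
      ((ContinuousLinearMap.apply ℝ E w) ∘L fderiv ℝ (fderiv ℝ φ) (t, p)) (t, p) := fun w =>
    HasFDerivAt.comp (g := ContinuousLinearMap.apply ℝ E w) (f := fderiv ℝ φ) (t, p)
      (ContinuousLinearMap.hasFDerivAt _) (hd2 (t, p)).hasFDerivAt
  have h1 : HasDerivAt (fun s => fderiv ℝ φ (s, p) (0, v))
      (fderiv ℝ (fderiv ℝ φ) (t, p) (1, 0) (0, v)) t :=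
    HasFDerivAt.comp_hasDerivAt (f := fun s => (s, p)) t (heval (0, v))
      ((hasDerivAt_id t).prodMk (hasDerivAt_const t p))
  have h2 : fderiv ℝ (fderiv ℝ φ) (t, p) (0, v) (1, 0) =
      fderiv ℝ X (φ (t, p)) (fderiv ℝ φ (t, p) (0, v)) := by
    have ha : HasFDerivAt (fun u => fderiv ℝ φ u (1, 0))
        ((fderiv ℝ X (φ (t, p))) ∘L fderiv ℝ φ (t, p)) (t, p) := by
      simp only [htime]
      exact ((hX.differentiable (by simp)) _).hasFDerivAt.comp (t, p) (hd (t, p)).hasFDerivAt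
    exact congrArg (· (0, v)) ((heval (1, 0)).unique ha)
  simp only [hslice]
  rw [← h2, ← hsymm.eq]
  exact h1

variable [CompleteSpace E]

theorem contDiffAt_of_small (h : IsGlobalFlow X φ) (hX : ContDiff ℝ ∞ X)
    (hc : HasCompactSupport X) (hK : LipschitzWith K X) {u : ℝ × E} (hu : |u.1| * K < 1) :
    ContDiffAt ℝ ∞ φ u := by
  have hcont : ∀ p, Continuous fun s => φ (s, p) := fun p =>
    continuous_iff_continuousAt.2 fun t => (h.hasDerivAt t p).continuousAt
  let c : ℝ × E → C(I, E) := fun v =>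
    ⟨fun s => φ (v.1 * s, v.2), (hcont v.2).comp (by fun_prop)⟩
  have hzero : ∀ v, picardResidual X hX.continuous (v, c v) = 0 := fun v => by
    have := picardResidual_eq_zero_of_hasDerivAt hX.continuous
      (fun t => h.hasDerivAt t v.2) (hcont v.2) v.1
    simpa only [h.zero] using this
  have hG : ContDiffAt ℝ ∞ (picardResidual X hX.continuous) (u, c u) :=
    (contDiff_picardResidual hX hc).contDiffAt
  have hinv := isInvertible_fderiv_picardResidual hX hc hK (u, c u) hu
  have hψ := hG.contDiffAt_implicitFunction (by simp) hinv
  have hev := hG.eventually_apply_implicitFunction (by simp) hinv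
  have hsmall : ∀ᶠ v : ℝ × E in 𝓝 u, |v.1| * K < 1 := by
    have : Continuous fun v : ℝ × E => |v.1| * (K : ℝ) := by fun_prop
    exact (this.tendsto u).eventually_lt_const hu
  have heq : (fun v => (hG.implicitFunction (by simp) hinv v) 1) =ᶠ[𝓝 u] φ := by
    filter_upwards [hev, hsmall] with v hv hv'
    rw [hzero] at hv
    rw [eq_of_picardResidual_eq_zero hK hv' hv (hzero v)]
    simp [c]
  refine ContDiffAt.congr_of_eventuallyEq ?_ heq.symm
  exact (ContinuousMap.evalCLM ℝ (1 : I)).contDiff.contDiffAt.comp u hψ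

theorem contDiff (h : IsGlobalFlow X φ) (hX : ContDiff ℝ ∞ X) (hc : HasCompactSupport X)
    (hK : LipschitzWith K X) : ContDiff ℝ ∞ φ := by
  have key : ∀ (N : ℕ) (u : ℝ × E), |u.1| * K < N + 1 → ContDiffAt ℝ ∞ φ u := by
    intro N
    induction N with
    | zero => exact fun u hu => h.contDiffAt_of_small hX hc hK (by simpa using hu)
    | succ N ih =>
      intro u hu
      push_cast at hu
      have hN : (0 : ℝ) < N + 2 := by positivity
      have hfac : φ = fun v : ℝ × E =>
          φ (1 / (N + 2) * v.1, φ ((N + 1) / (N + 2) * v.1, v.2)) := by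
        funext v
        rw [← h.add hK]
        refine congrArg φ (Prod.ext ?_ rfl)
        field_simp
        ring
      rw [hfac]
      have hin : ContDiffAt ℝ ∞ (fun v : ℝ × E => φ ((N + 1) / (N + 2) * v.1, v.2)) u := by
        refine (ih (((N : ℝ) + 1) / (N + 2) * u.1, u.2) ?_).comp u (by fun_prop)
        rw [abs_mul, abs_of_nonneg (by positivity), mul_assoc, div_mul_eq_mul_div, div_lt_iff₀ hN]
        nlinarith
      refine (h.contDiffAt_of_small hX hc hK
        (u := (1 / ((N : ℝ) + 2) * u.1, φ (((N : ℝ) + 1) / (N + 2) * u.1, u.2))) ?_).comp u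
        (ContDiffAt.prodMk (by fun_prop) hin)
      rw [abs_mul, abs_of_nonneg (by positivity), mul_assoc, div_mul_eq_mul_div, div_lt_iff₀ hN]
      linarith
  refine contDiff_iff_contDiffAt.2 fun u => ?_
  obtain ⟨N, hN⟩ := exists_nat_gt (|u.1| * K)
  exact key N u (hN.trans (lt_add_one _))

end IsGlobalFlow

theorem exists_isGlobalFlow {E : Type} [NormedAddCommGroup E] [NormedSpace ℝ E] [CompleteSpace E]
    {X : E → E} {K : ℝ≥0} (hX : Continuous X) (hc : HasCompactSupport X)
    (hK : LipschitzWith K X) : ∃ φ : ℝ × E → E, IsGlobalFlow X φ := by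
  obtain ⟨L, hL⟩ := hc.exists_bound_of_continuous hX
  have hL' : ∀ x, ‖X x‖ ≤ (Real.toNNReal L : ℝ≥0) := fun x => (hL x).trans (Real.le_coe_toNNReal L)
  choose γ h0 hγ using exists_forall_hasDerivAt_of_lipschitzWith hK hL'
  exact ⟨fun u => γ u.2 u.1, h0, fun t p => hγ p t⟩

section ContactFields

variable {m : ℕ} {h : ContactSpace m → ℝ}

/-- The bilinear form `ω(u, v) = Σ (u_{x_i} v_{y_i} − u_{y_i} v_{x_i})`. -/
def heisenbergForm (m : ℕ) (u v : ContactSpace m) : ℝ :=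
  ∑ i, (u.2.1 i * v.2.2 i - u.2.2 i * v.2.1 i)

theorem lamSt_eq (p v : ContactSpace m) : lamSt m p v = v.1 + heisenbergForm m p v := rfl

theorem heisenbergForm_swap (u v : ContactSpace m) :
    heisenbergForm m u v = -heisenbergForm m v u := by
  simp only [heisenbergForm, ← Finset.sum_neg_distrib]
  exact Finset.sum_congr rfl fun i _ => by ring

/-- The unit vector in the `z`-direction, i.e. the Reeb vector. -/
def reebVector (m : ℕ) : ContactSpace m := (1, 0, 0)

/-- The `x`-components of the contact vector field of `h`. -/
noncomputable def contactFieldX (h : ContactSpace m → ℝ) (p : ContactSpace m) (i : Fin m) : ℝ :=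
  (fderiv ℝ h p (reebVector m) * p.2.1 i - fderiv ℝ h p (0, 0, Pi.single i 1)) / 2

/-- The `y`-components of the contact vector field of `h`. -/
noncomputable def contactFieldY (h : ContactSpace m → ℝ) (p : ContactSpace m) (i : Fin m) : ℝ :=
  (fderiv ℝ h p (reebVector m) * p.2.2 i + fderiv ℝ h p (0, Pi.single i 1, 0)) / 2

/-- The contact vector field with contact Hamiltonian `h`. -/
noncomputable def contactField (h : ContactSpace m → ℝ) (p : ContactSpace m) : ContactSpace m :=
  (h p - ∑ i, (p.2.1 i * contactFieldY h p i - p.2.2 i * contactFieldX h p i),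
    contactFieldX h p, contactFieldY h p)

theorem lamSt_contactField (h : ContactSpace m → ℝ) (p : ContactSpace m) :
    lamSt m p (contactField h p) = h p := by
  simp [lamSt, contactField]

theorem fderiv_apply_eq_sum (h : ContactSpace m → ℝ) (p w : ContactSpace m) :
    fderiv ℝ h p w = w.1 * fderiv ℝ h p (reebVector m) +
      ∑ i, (w.2.1 i * fderiv ℝ h p (0, Pi.single i 1, 0) +
        w.2.2 i * fderiv ℝ h p (0, 0, Pi.single i 1)) := by
  have hw : w = w.1 • reebVector m + ∑ i, (w.2.1 i • ((0, Pi.single i 1, 0) : ContactSpace m) +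
      w.2.2 i • ((0, 0, Pi.single i 1) : ContactSpace m)) := by
    refine Prod.ext ?_ (Prod.ext ?_ ?_)
    · simp [reebVector, Prod.fst_sum]
    · ext j
      simp [reebVector, Prod.fst_sum, Prod.snd_sum, Finset.sum_apply, Pi.single_apply]
    · ext j
      simp [reebVector, Prod.snd_sum, Finset.sum_apply, Pi.single_apply]
  conv_lhs => rw [hw]
  simp only [map_add, map_sum, map_smul, smul_eq_mul]

theorem two_mul_heisenbergForm_contactField (h : ContactSpace m → ℝ) (p w : ContactSpace m) :
    2 * heisenbergForm m (contactField h p) w =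
      fderiv ℝ h p (reebVector m) * lamSt m p w - fderiv ℝ h p w := by
  rw [fderiv_apply_eq_sum h p w, lamSt, heisenbergForm, mul_add, Finset.mul_sum, Finset.mul_sum,
    mul_comm w.1, add_sub_add_left_eq_sub, ← Finset.sum_sub_distrib]
  refine Finset.sum_congr rfl fun i _ => ?_
  simp only [contactField, contactFieldX, contactFieldY]
  ring

theorem contactField_congr {h₁ h₂ : ContactSpace m → ℝ} {p : ContactSpace m}
    (he : h₁ =ᶠ[𝓝 p] h₂) : contactField h₁ p = contactField h₂ p := by
  have hX : contactFieldX h₁ p = contactFieldX h₂ p := by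
    ext i; simp only [contactFieldX, he.fderiv_eq]
  have hY : contactFieldY h₁ p = contactFieldY h₂ p := by
    ext i; simp only [contactFieldY, he.fderiv_eq]
  simp only [contactField, hX, hY, he.eq_of_nhds]

theorem contactField_eq_zero {p : ContactSpace m} (hp : p ∉ tsupport h) :
    contactField h p = 0 := by
  rw [contactField_congr (notMem_tsupport_iff_eventuallyEq.1 hp)]
  have : fderiv ℝ (0 : ContactSpace m → ℝ) p = 0 := fderiv_const_apply 0
  refine Prod.ext ?_ (Prod.ext ?_ ?_)
  · simp [contactField, contactFieldX, contactFieldY, this]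
  · ext i; simp [contactField, contactFieldX, this]
  · ext i; simp [contactField, contactFieldY, this]

theorem hasCompactSupport_contactField (hc : HasCompactSupport h) :
    HasCompactSupport (contactField h) :=
  HasCompactSupport.intro hc fun _ => contactField_eq_zero

theorem contDiff_contactField (hh : ContDiff ℝ ∞ h) : ContDiff ℝ ∞ (contactField h) := by
  have hd : ∀ v, ContDiff ℝ ∞ fun p => fderiv ℝ h p v := fun v =>
    (hh.fderiv_right (by simp)).clm_apply contDiff_const
  have hx : ∀ i, ContDiff ℝ ∞ fun p : ContactSpace m => p.2.1 i := fun i => by fun_prop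
  have hy : ∀ i, ContDiff ℝ ∞ fun p : ContactSpace m => p.2.2 i := fun i => by fun_prop
  have hX : ∀ i, ContDiff ℝ ∞ fun p => contactFieldX h p i := fun i =>
    (((hd _).mul (hx i)).sub (hd _)).div_const 2
  have hY : ∀ i, ContDiff ℝ ∞ fun p => contactFieldY h p i := fun i =>
    (((hd _).mul (hy i)).add (hd _)).div_const 2
  refine ContDiff.prodMk (hh.sub (ContDiff.sum fun i _ => ?_))
    (ContDiff.prodMk (contDiff_pi.2 hX) (contDiff_pi.2 hY))
  exact ((hx i).mul (hY i)).sub ((hy i).mul (hX i))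

theorem hasDerivAt_lamSt {γ w : ℝ → ContactSpace m} {γ' w' : ContactSpace m} {t : ℝ}
    (hγ : HasDerivAt γ γ' t) (hw : HasDerivAt w w' t) :
    HasDerivAt (fun s => lamSt m (γ s) (w s))
      (lamSt m (γ t) w' + heisenbergForm m γ' (w t)) t := by
  have hL : ∀ (L : ContactSpace m →L[ℝ] ℝ) {f : ℝ → ContactSpace m} {f' : ContactSpace m},
      HasDerivAt f f' t → HasDerivAt (fun s => L (f s)) (L f') t :=
    fun L _ _ hf => L.hasFDerivAt.comp_hasDerivAt t hf
  let z : ContactSpace m →L[ℝ] ℝ := ContinuousLinearMap.fst ℝ _ _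
  let x : Fin m → ContactSpace m →L[ℝ] ℝ := fun i =>
    ContinuousLinearMap.proj i ∘L ContinuousLinearMap.fst ℝ _ _ ∘L ContinuousLinearMap.snd ℝ _ _
  let y : Fin m → ContactSpace m →L[ℝ] ℝ := fun i =>
    ContinuousLinearMap.proj i ∘L ContinuousLinearMap.snd ℝ _ _ ∘L ContinuousLinearMap.snd ℝ _ _
  have hs := (hL z hw).fun_add (HasDerivAt.fun_sum (u := Finset.univ) fun i _ =>
    ((hL (x i) hγ).fun_mul (hL (y i) hw)).fun_sub ((hL (y i) hγ).fun_mul (hL (x i) hw)))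
  refine hs.congr_deriv ?_
  rw [lamSt_eq, add_assoc, heisenbergForm, heisenbergForm, ← Finset.sum_add_distrib]
  refine congrArg (w'.1 + ·) (Finset.sum_congr rfl fun i _ => ?_)
  change γ'.2.1 i * (w t).2.2 i + (γ t).2.1 i * w'.2.2 i -
    (γ'.2.2 i * (w t).2.1 i + (γ t).2.2 i * w'.2.1 i) = _
  ring

theorem lamSt_fderiv_contactField (hh : ContDiff ℝ ∞ h) (p w : ContactSpace m) :
    lamSt m p (fderiv ℝ (contactField h) p w) + heisenbergForm m w (contactField h p) =
      fderiv ℝ h p w := by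
  have hl : HasDerivAt (fun s : ℝ => p + s • w) w 0 := by
    simpa using ((hasDerivAt_id (0 : ℝ)).smul_const w).const_add p
  have hl0 : p + (0 : ℝ) • w = p := by simp
  have hX : HasFDerivAt (contactField h) (fderiv ℝ (contactField h) p) (p + (0 : ℝ) • w) := by
    rw [hl0]
    exact ((contDiff_contactField hh).differentiable (by simp) p).hasFDerivAt
  have hH : HasFDerivAt h (fderiv ℝ h p) (p + (0 : ℝ) • w) := by
    rw [hl0]
    exact (hh.differentiable (by simp) p).hasFDerivAt
  have := hasDerivAt_lamSt hl (hX.comp_hasDerivAt (0 : ℝ) hl)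
  simp only [Function.comp_def, lamSt_contactField, hl0] at this
  exact this.unique (hH.comp_hasDerivAt (0 : ℝ) hl)

/-- The conformal factor of the time-`t` map of the contact flow `φ` of `h`. -/
noncomputable def conformalFactor (h : ContactSpace m → ℝ) (φ : ℝ × ContactSpace m → ContactSpace m)
    (t : ℝ) (p : ContactSpace m) : ℝ :=
  Real.exp (∫ s in (0 : ℝ)..t, fderiv ℝ h (φ (s, p)) (reebVector m))

theorem conformalFactor_pos (φ : ℝ × ContactSpace m → ContactSpace m) (t : ℝ)
    (p : ContactSpace m) : 0 < conformalFactor h φ t p := Real.exp_pos _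

theorem eq_exp_integral_mul {a g : ℝ → ℝ} (ha : Continuous a)
    (hg : ∀ t, HasDerivAt g (a t * g t) t) (t : ℝ) :
    g t = Real.exp (∫ s in (0 : ℝ)..t, a s) * g 0 := by
  have hA : ∀ t, HasDerivAt (fun t => ∫ s in (0 : ℝ)..t, a s) (a t) t := fun t =>
    ha.integral_hasStrictDerivAt 0 t |>.hasDerivAt
  have hc : ∀ t, HasDerivAt (fun t => Real.exp (-∫ s in (0 : ℝ)..t, a s) * g t) 0 t := fun t =>
    ((hA t).neg.exp.mul (hg t)).congr_deriv (by ring)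
  have := is_const_of_deriv_eq_zero (fun t => (hc t).differentiableAt) (fun t => (hc t).deriv) t 0
  simp only [intervalIntegral.integral_same, neg_zero, Real.exp_zero, one_mul] at this
  rw [← this, ← mul_assoc, ← Real.exp_add, add_neg_cancel, Real.exp_zero, one_mul]

/-- The properties of the flow of a compactly supported contact Hamiltonian `h`. -/
structure IsContactFlow (h : ContactSpace m → ℝ) (φ : ℝ × ContactSpace m → ContactSpace m) :
    Prop where
  contDiff : ContDiff ℝ ∞ φ
  zero : ∀ p, φ (0, p) = p
  neg_apply : ∀ t p, φ (-t, φ (t, p)) = p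
  eq_self : ∀ t, ∀ p ∉ tsupport h, φ (t, p) = p
  eq_of_hasDerivAt : ∀ {γ : ℝ → ContactSpace m} {T : ℝ},
    (∀ t ∈ Icc 0 T, HasDerivAt γ (contactField h (γ t)) t) → ∀ {t}, t ∈ Icc 0 T →
      φ (t, γ 0) = γ t
  lamSt_fderiv : ∀ t p v, lamSt m (φ (t, p)) (fderiv ℝ (fun q => φ (t, q)) p v) =
    conformalFactor h φ t p * lamSt m p v

theorem exists_isContactFlow (hh : ContDiff ℝ ∞ h) (hc : HasCompactSupport h) :
    ∃ φ, IsContactFlow h φ := by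
  have hX := contDiff_contactField hh
  have hXc := hasCompactSupport_contactField hc
  obtain ⟨K, hK⟩ := hX.lipschitzWith_of_hasCompactSupport hXc (by simp)
  obtain ⟨φ, hφ⟩ := exists_isGlobalFlow hX.continuous hXc hK
  have hsm := hφ.contDiff hX hXc hK
  refine ⟨φ, hsm, hφ.zero, hφ.neg_apply hK,
    fun t p hp => hφ.eq_self hK (contactField_eq_zero hp) t,
    fun hγ _ ht => hφ.eq_of_hasDerivAt_Icc hK hγ ht, fun t p v => ?_⟩
  have hcont : Continuous fun s => fderiv ℝ h (φ (s, p)) (reebVector m) :=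
    (((hh.continuous_fderiv (by simp)).comp (hsm.continuous.comp (by fun_prop))).clm_apply
      continuous_const)
  have key := eq_exp_integral_mul hcont
    (g := fun s => lamSt m (φ (s, p)) (fderiv ℝ (fun q => φ (s, q)) p v)) (fun s => ?_) t
  · rw [key]
    simp only [hφ.zero]
    rw [fderiv_fun_id]
    rfl
  · refine (hasDerivAt_lamSt (hφ.hasDerivAt s p) (hφ.hasDerivAt_fderiv hX hsm s p v)).congr_deriv ?_
    set w := fderiv ℝ (fun q => φ (s, q)) p v
    have h1 := lamSt_fderiv_contactField hh (φ (s, p)) w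
    have h2 := two_mul_heisenbergForm_contactField h (φ (s, p)) w
    rw [heisenbergForm_swap w] at h1
    linarith

theorem IsContactFlow.apply_neg {φ : ℝ × ContactSpace m → ContactSpace m}
    (hφ : IsContactFlow h φ) (t : ℝ) (p : ContactSpace m) : φ (t, φ (-t, p)) = p := by
  simpa using hφ.neg_apply (-t) p

theorem IsContactFlow.exists_conformalFactor_ge {φ : ℝ × ContactSpace m → ContactSpace m}
    (hh : ContDiff ℝ ∞ h) (hc : HasCompactSupport h) (t : ℝ) :
    ∃ δ > 0, ∀ p, δ ≤ conformalFactor h φ t p := by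
  obtain ⟨M, hM⟩ := (hc.fderiv_apply ℝ (reebVector m)).exists_bound_of_continuous
    ((hh.continuous_fderiv (by simp)).clm_apply continuous_const)
  refine ⟨Real.exp (-(M * |t|)), Real.exp_pos _, fun p => Real.exp_le_exp.2 ?_⟩
  have := intervalIntegral.norm_integral_le_of_norm_le_const (a := 0) (b := t)
    (fun s _ => hM (φ (s, p)))
  rw [sub_zero] at this
  exact (abs_le.1 this).1

end ContactFields

section RadialFlow

variable {m : ℕ}

theorem radialFlow_zero (p : ContactSpace m) : radialFlow m 0 p = p := by
  simp [radialFlow]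

theorem radialFlow_radialFlow (s t : ℝ) (p : ContactSpace m) :
    radialFlow m s (radialFlow m t p) = radialFlow m (s + t) p := by
  simp only [radialFlow, add_div, Real.exp_add, mul_assoc]

theorem radialFlow_apply_zero (t : ℝ) : radialFlow m t 0 = 0 := by
  simp only [radialFlow, Prod.fst_zero, Prod.snd_zero, Pi.zero_apply, mul_zero]
  rfl

theorem continuous_radialFlow : Continuous fun u : ℝ × ContactSpace m => radialFlow m u.1 u.2 := by
  unfold radialFlow
  fun_prop

theorem norm_radialFlow_neg_le {s : ℝ} (hs : 0 ≤ s) (p : ContactSpace m) :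
    ‖radialFlow m (-s) p‖ ≤ Real.exp (-s / 2) * ‖p‖ := by
  have hp1 : ‖p.2.1‖ ≤ ‖p‖ := (norm_fst_le p.2).trans (norm_snd_le p)
  have hp2 : ‖p.2.2‖ ≤ ‖p‖ := (norm_snd_le p.2).trans (norm_snd_le p)
  refine norm_prod_le_iff.2 ⟨?_, norm_prod_le_iff.2 ⟨?_, ?_⟩⟩
  · simp only [radialFlow, norm_mul, Real.norm_eq_abs, Real.abs_exp]
    refine mul_le_mul (Real.exp_le_exp.2 (by linarith)) (norm_fst_le p) (abs_nonneg _)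
      (Real.exp_pos _).le
  · refine (pi_norm_le_iff_of_nonneg (by positivity)).2 fun i => ?_
    simp only [radialFlow, norm_mul, Real.norm_eq_abs, Real.abs_exp]
    exact mul_le_mul_of_nonneg_left ((norm_le_pi_norm p.2.1 i).trans hp1) (Real.exp_pos _).le
  · refine (pi_norm_le_iff_of_nonneg (by positivity)).2 fun i => ?_
    simp only [radialFlow, norm_mul, Real.norm_eq_abs, Real.abs_exp]
    exact mul_le_mul_of_nonneg_left ((norm_le_pi_norm p.2.2 i).trans hp2) (Real.exp_pos _).le

theorem tendsto_radialFlow_neg (p : ContactSpace m) :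
    Tendsto (fun s => radialFlow m (-s) p) atTop (𝓝 0) := by
  refine squeeze_zero_norm' (a := fun s => Real.exp (-s / 2) * ‖p‖)
    ((eventually_ge_atTop 0).mono fun s hs => norm_radialFlow_neg_le hs p) ?_
  have : Tendsto (fun s : ℝ => -s / 2) atTop atBot :=
    tendsto_neg_atTop_atBot.atBot_div_const two_pos
  simpa using (Real.tendsto_exp_atBot.comp this).mul_const ‖p‖

theorem hasDerivAt_radialFlow (a t : ℝ) (p : ContactSpace m) :
    HasDerivAt (fun s => radialFlow m (s + a) p)
      (contactField (fun q : ContactSpace m => q.1) (radialFlow m (t + a) p)) t := by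
  have hfd : ∀ q : ContactSpace m, fderiv ℝ (fun q : ContactSpace m => q.1) q =
      ContinuousLinearMap.fst ℝ ℝ ((Fin m → ℝ) × (Fin m → ℝ)) :=
    fun _ => (ContinuousLinearMap.fst ℝ ℝ ((Fin m → ℝ) × (Fin m → ℝ))).fderiv
  have h1 : HasDerivAt (fun s => Real.exp (s + a)) (Real.exp (t + a)) t := by
    simpa using ((hasDerivAt_id t).add_const a).exp
  have h2 : HasDerivAt (fun s => Real.exp ((s + a) / 2)) (Real.exp ((t + a) / 2) / 2) t := by
    simpa [div_eq_mul_inv] using (((hasDerivAt_id t).add_const a).div_const 2).exp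
  have hd : HasDerivAt (fun s => radialFlow m (s + a) p)
      (Real.exp (t + a) * p.1, fun i => Real.exp ((t + a) / 2) / 2 * p.2.1 i,
        fun i => Real.exp ((t + a) / 2) / 2 * p.2.2 i) t :=
    (h1.mul_const p.1).prodMk ((hasDerivAt_pi.2 fun i => h2.mul_const (p.2.1 i)).prodMk
      (hasDerivAt_pi.2 fun i => h2.mul_const (p.2.2 i)))
  refine hd.congr_deriv ?_
  refine Prod.ext ?_ (Prod.ext ?_ ?_)
  · simp only [contactField, contactFieldX, contactFieldY, hfd]
    simp only [reebVector, radialFlow, ContinuousLinearMap.coe_fst', one_mul, sub_zero, add_zero]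
    rw [eq_comm, sub_eq_self]
    exact Finset.sum_eq_zero fun i _ => by ring
  · ext i
    simp only [contactField, contactFieldX, hfd]
    simp [reebVector, radialFlow]
    ring
  · ext i
    simp only [contactField, contactFieldY, hfd]
    simp [reebVector, radialFlow]
    ring

variable {h : ContactSpace m → ℝ} {φ : ℝ × ContactSpace m → ContactSpace m}
  {C : Set (ContactSpace m)}

theorem IsContactFlow.apply_radialFlow (hφ : IsContactFlow h φ)
    (hC : ∀ p ∈ C, h =ᶠ[𝓝 p] fun q => q.1) (hinv : ∀ t, 0 ≤ t → ∀ p ∈ C, radialFlow m (-t) p ∈ C)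
    {r : ContactSpace m} (hr : r ∈ C) {s u : ℝ} (hu : u ∈ Icc 0 s) :
    φ (u, radialFlow m (-s) r) = radialFlow m (u - s) r := by
  have := hφ.eq_of_hasDerivAt (γ := fun u => radialFlow m (u + -s) r) (T := s) (fun t ht => ?_) hu
  · simpa only [zero_add, sub_eq_add_neg] using this
  · have hmem : radialFlow m (t + -s) r ∈ C := by
      have := hinv (s - t) (by linarith [ht.2]) r hr
      rwa [neg_sub, sub_eq_add_neg] at this
    exact contactField_congr (hC _ hmem) ▸ hasDerivAt_radialFlow (-s) t r

theorem IsContactFlow.apply_neg_eq_radialFlow (hφ : IsContactFlow h φ)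
    (hC : ∀ p ∈ C, h =ᶠ[𝓝 p] fun q => q.1) (hinv : ∀ t, 0 ≤ t → ∀ p ∈ C, radialFlow m (-t) p ∈ C)
    {r : ContactSpace m} (hr : r ∈ C) {s : ℝ} (hs : 0 ≤ s) :
    φ (-s, r) = radialFlow m (-s) r := by
  have := hφ.apply_radialFlow hC hinv hr (right_mem_Icc.2 hs)
  rw [sub_self, radialFlow_zero] at this
  rw [← hφ.neg_apply s (radialFlow m (-s) r), this]

theorem IsContactFlow.conformalFactor_radialFlow (hφ : IsContactFlow h φ)
    (hC : ∀ p ∈ C, h =ᶠ[𝓝 p] fun q => q.1) (hinv : ∀ t, 0 ≤ t → ∀ p ∈ C, radialFlow m (-t) p ∈ C)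
    {r : ContactSpace m} (hr : r ∈ C) {s : ℝ} (hs : 0 ≤ s) :
    conformalFactor h φ s (radialFlow m (-s) r) = Real.exp s := by
  have : ∫ u in (0 : ℝ)..s, fderiv ℝ h (φ (u, radialFlow m (-s) r)) (reebVector m) =
      ∫ _ in (0 : ℝ)..s, (1 : ℝ) := by
    refine intervalIntegral.integral_congr fun u hu => ?_
    rw [uIcc_of_le hs] at hu
    have hmem : radialFlow m (u - s) r ∈ C := by
      have := hinv (s - u) (by linarith [hu.2]) r hr
      rwa [neg_sub] at this
    change fderiv ℝ h (φ (u, radialFlow m (-s) r)) (reebVector m) = 1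
    rw [hφ.apply_radialFlow hC hinv hr hu, (hC _ hmem).fderiv_eq]
    exact congrArg (· (reebVector m))
      (ContinuousLinearMap.fst ℝ ℝ ((Fin m → ℝ) × (Fin m → ℝ))).fderiv
  rw [conformalFactor, this]
  simp

end RadialFlow

section Translation

variable {m : ℕ}

/-- The contact Hamiltonian generating the Heisenberg translations in the direction `q`. -/
noncomputable def translationHamiltonian (q p : ContactSpace m) : ℝ :=
  q.1 + 2 * heisenbergForm m p q

theorem contDiff_translationHamiltonian (q : ContactSpace m) :
    ContDiff ℝ ∞ (translationHamiltonian q) := by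
  unfold translationHamiltonian heisenbergForm
  fun_prop

theorem contactField_translationHamiltonian (q : ContactSpace m) (t : ℝ) :
    contactField (translationHamiltonian q) (t • q) = q := by
  have hfd : ∀ p v, fderiv ℝ (translationHamiltonian q) p v = 2 * heisenbergForm m v q := by
    intro p v
    have hl : HasDerivAt (fun s : ℝ => p + s • v) v 0 := by
      simpa using ((hasDerivAt_id (0 : ℝ)).smul_const v).const_add p
    have h1 : HasFDerivAt (translationHamiltonian q) (fderiv ℝ (translationHamiltonian q) p)
        (p + (0 : ℝ) • v) := by
      rw [zero_smul, add_zero]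
      exact ((contDiff_translationHamiltonian q).differentiable (by simp) p).hasFDerivAt
    have h2 := hasDerivAt_lamSt hl (hasDerivAt_const (0 : ℝ) q)
    have h3 : HasDerivAt (fun s : ℝ => q.1 + 2 * heisenbergForm m (p + s • v) q)
        (2 * heisenbergForm m v q) 0 := by
      refine ((((h2.sub_const q.1).const_mul 2).const_add q.1).congr_deriv
        ?_).congr_of_eventuallyEq (Eventually.of_forall fun s => ?_)
      · simp [lamSt]
      · simp [lamSt_eq]
    have h4 : HasDerivAt (translationHamiltonian q ∘ fun s : ℝ => p + s • v)
        (fderiv ℝ (translationHamiltonian q) p v) 0 := h1.comp_hasDerivAt (0 : ℝ) hl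
    exact h4.unique h3
  have hsq : heisenbergForm m (t • q) q = 0 :=
    Finset.sum_eq_zero fun i _ => by
      simp only [Prod.smul_fst, Prod.smul_snd, Pi.smul_apply, smul_eq_mul]
      ring
  have hX : contactFieldX (translationHamiltonian q) (t • q) = q.2.1 := by
    ext i
    simp [contactFieldX, hfd, heisenbergForm, reebVector, Pi.single_apply]
  have hY : contactFieldY (translationHamiltonian q) (t • q) = q.2.2 := by
    ext i
    simp [contactFieldY, hfd, heisenbergForm, reebVector, Pi.single_apply]
  refine Prod.ext ?_ (Prod.ext hX hY)
  simp only [contactField, hX, hY, translationHamiltonian, hsq]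
  change q.1 + 2 * 0 - heisenbergForm m (t • q) q = q.1
  rw [hsq]
  ring

end Translation

section Domain

variable {m : ℕ} {Δ : Set (ContactSpace m)}

theorem zero_mem_interior_of_starShaped (hΔc : IsCompact Δ)
    (hΔstar : ∀ t : ℝ, 0 < t → radialFlow m (-t) '' Δ ⊆ interior Δ) (hne : Δ.Nonempty) :
    (0 : ContactSpace m) ∈ interior Δ := by
  obtain ⟨p, hp⟩ := hne
  have h0 : (0 : ContactSpace m) ∈ Δ :=
    hΔc.isClosed.mem_of_tendsto (tendsto_radialFlow_neg p)
      ((eventually_gt_atTop 0).mono fun t ht => interior_subset (hΔstar t ht ⟨p, hp, rfl⟩))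
  have := hΔstar 1 one_pos ⟨0, h0, rfl⟩
  rwa [radialFlow_apply_zero] at this

theorem exists_radialFlow_mem_of_isCompact {S U : Set (ContactSpace m)} (hS : IsCompact S)
    (hU : IsOpen U) (hSU : S ⊆ U) : ∃ t > 0, ∀ p ∈ S, radialFlow m t p ∈ U := by
  have hev : ∀ᶠ t : ℝ in 𝓝 0, ∀ p ∈ S, radialFlow m t p ∈ U := by
    refine hS.eventually_forall_of_forall_eventually fun p hp => ?_
    refine continuous_radialFlow.continuousAt.eventually_mem (hU.mem_nhds ?_)
    simpa only [radialFlow_zero] using hSU hp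
  obtain ⟨ε, hε, h⟩ := Metric.eventually_nhds_iff.1 hev
  exact ⟨ε / 2, half_pos hε, h (by
    rw [Real.dist_eq, sub_zero, abs_of_pos (half_pos hε)]
    exact half_lt_self hε)⟩

theorem exists_contDiff_cutoff {C : Set (ContactSpace m)} (hΔc : IsCompact Δ) (hC : IsClosed C)
    (hCΔ : C ⊆ interior Δ) :
    ∃ χ : ContactSpace m → ℝ, ContDiff ℝ ∞ χ ∧ HasCompactSupport χ ∧ tsupport χ ⊆ interior Δ ∧
      ∀ p ∈ C, ∀ᶠ q in 𝓝 p, χ q = 1 := by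
  obtain ⟨f, h0, h1, -⟩ := exists_contMDiffMap_zero_one_nhds_of_isClosed (n := (⊤ : ℕ∞))
    (modelWithCornersSelf ℝ (ContactSpace m)) isOpen_interior.isClosed_compl hC
    (disjoint_compl_left_iff_subset.2 hCΔ)
  have hsupp : tsupport f ⊆ interior Δ := fun p hp => by
    by_contra hpΔ
    exact notMem_tsupport_iff_eventuallyEq.2 (h0.filter_mono (nhds_le_nhdsSet hpΔ)) hp
  exact ⟨f, f.contMDiff.contDiff,
    hΔc.of_isClosed_subset (isClosed_tsupport _) (hsupp.trans interior_subset), hsupp,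
    fun p hp => h1.filter_mono (nhds_le_nhdsSet hp)⟩

theorem lamSt_fderiv_comp {f g : ContactSpace m → ContactSpace m} {p : ContactSpace m} {a b : ℝ}
    (hf : Differentiable ℝ f) (hg : Differentiable ℝ g)
    (hfa : ∀ v, lamSt m (f (g p)) (fderiv ℝ f (g p) v) = a * lamSt m (g p) v)
    (hgb : ∀ v, lamSt m (g p) (fderiv ℝ g p v) = b * lamSt m p v) (v : ContactSpace m) :
    lamSt m (f (g p)) (fderiv ℝ (fun q => f (g q)) p v) = a * b * lamSt m p v := by
  have : fderiv ℝ (fun q => f (g q)) p = fderiv ℝ f (g p) ∘L fderiv ℝ g p :=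
    ((hf (g p)).hasFDerivAt.comp p (hg p).hasFDerivAt).fderiv
  rw [this, ContinuousLinearMap.comp_apply, hfa, hgb, mul_assoc]

end Domain

section Disorder

variable {m : ℕ} {Δ : Set (ContactSpace m)}

theorem exists_invariant_core (hΔc : IsCompact Δ)
    (hΔstar : ∀ t : ℝ, 0 < t → radialFlow m (-t) '' Δ ⊆ interior Δ) {S : Set (ContactSpace m)}
    (hS : IsCompact S) (hSΔ : S ⊆ interior Δ) (hne : S.Nonempty) :
    ∃ C : Set (ContactSpace m), IsCompact C ∧ C ⊆ interior Δ ∧ S ⊆ C ∧ C ∈ 𝓝 0 ∧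
      ∀ t, 0 ≤ t → ∀ p ∈ C, radialFlow m (-t) p ∈ C := by
  obtain ⟨τ, hτ, hSτ⟩ := exists_radialFlow_mem_of_isCompact hS isOpen_interior hSΔ
  have hback : ∀ p, radialFlow m τ p ∈ Δ → p ∈ radialFlow m (-τ) '' Δ := fun p hp =>
    ⟨_, hp, by rw [radialFlow_radialFlow, neg_add_cancel, radialFlow_zero]⟩
  have hcont : ∀ t, Continuous (radialFlow m t) := fun t =>
    continuous_radialFlow.comp (Continuous.prodMk_right t)
  refine ⟨radialFlow m (-τ) '' Δ, hΔc.image (hcont _), hΔstar τ hτ,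
    fun p hp => hback p (interior_subset (hSτ p hp)), ?_, ?_⟩
  · have h0 := zero_mem_interior_of_starShaped hΔc hΔstar (hne.mono (hSΔ.trans interior_subset))
    filter_upwards [(hcont τ).continuousAt.eventually_mem
      (isOpen_interior.mem_nhds ((radialFlow_apply_zero τ).symm ▸ h0))] with p hp
    exact hback p (interior_subset hp)
  · rintro t ht _ ⟨p, hp, rfl⟩
    rw [radialFlow_radialFlow, add_comm, ← radialFlow_radialFlow]
    refine mem_image_of_mem _ ?_
    obtain rfl | ht := ht.eq_or_lt
    · rwa [neg_zero, radialFlow_zero]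
    · exact interior_subset (hΔstar t ht (mem_image_of_mem _ hp))

theorem IsContactFlow.exists_forall_le_mul {h k : ContactSpace m → ℝ}
    {φ ψ : ℝ × ContactSpace m → ContactSpace m} (hφ : IsContactFlow h φ) (hψ : IsContactFlow k ψ)
    (hh : ContDiff ℝ ∞ h) (hk : ContDiff ℝ ∞ k) (hhc : HasCompactSupport h)
    (hkc : HasCompactSupport k) {C : Set (ContactSpace m)} (hC : IsCompact C)
    (hhC : ∀ p ∈ C, h =ᶠ[𝓝 p] fun q => q.1)
    (hinv : ∀ t, 0 ≤ t → ∀ p ∈ C, radialFlow m (-t) p ∈ C) {K H : ContactSpace m → ℝ}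
    (hK : Continuous K) (hH : Continuous H) (hK0 : ∀ p, 0 ≤ K p) (hHc : HasCompactSupport H)
    (hHC : tsupport H ⊆ C) {τ : ℝ} (hpos : 0 < K (φ (τ, ψ (1, 0)))) :
    ∃ s, ∀ p, H (φ (s, ψ (-1, φ (-τ, p)))) ≤
      conformalFactor h φ s (ψ (-1, φ (-τ, p))) *
        (conformalFactor k ψ (-1) (φ (-τ, p)) * conformalFactor h φ (-τ) p) * K p := by
  obtain ⟨M, hM⟩ := hHc.exists_bound_of_continuous hH
  obtain ⟨R, hR⟩ := hC.isBounded.exists_norm_le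
  obtain ⟨a, ha, hak⟩ := exists_conformalFactor_ge (φ := ψ) hk hkc (-1)
  obtain ⟨b, hb, hbh⟩ := exists_conformalFactor_ge (φ := φ) hh hhc (-τ)
  set κ := K (φ (τ, ψ (1, 0))) with hκ
  have hcont : Continuous fun w => K (φ (τ, ψ (1, w))) :=
    hK.comp (hφ.contDiff.continuous.comp (continuous_const.prodMk
      (hψ.contDiff.continuous.comp (Continuous.prodMk_right 1))))
  obtain ⟨ρ, hρ, hnear⟩ := Metric.eventually_nhds_iff.1
    (hcont.continuousAt.eventually_mem (Ioi_mem_nhds (half_lt_self hpos)))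
  have hsmall : ∀ᶠ s : ℝ in atTop, Real.exp (-s / 2) * R < ρ := by
    have : Tendsto (fun s : ℝ => -s / 2) atTop atBot :=
      tendsto_neg_atTop_atBot.atBot_div_const two_pos
    have := (Real.tendsto_exp_atBot.comp this).mul_const R
    rw [zero_mul] at this
    exact this.eventually_lt_const hρ
  have hlarge : ∀ᶠ s : ℝ in atTop, M ≤ Real.exp s * (a * b * (κ / 2)) :=
    (Real.tendsto_exp_atTop.atTop_mul_const (by positivity)).eventually_ge_atTop M
  obtain ⟨s, hs0, hsρ, hsM⟩ := ((eventually_ge_atTop 0).and (hsmall.and hlarge)).exists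
  refine ⟨s, fun p => ?_⟩
  set r := φ (s, ψ (-1, φ (-τ, p))) with hr
  by_cases hHr : H r = 0
  · rw [hHr]
    exact mul_nonneg (mul_nonneg (conformalFactor_pos _ _ _).le
      (mul_nonneg (conformalFactor_pos _ _ _).le (conformalFactor_pos _ _ _).le)) (hK0 p)
  have hrC : r ∈ C := hHC (subset_tsupport H hHr)
  have hw : ψ (-1, φ (-τ, p)) = radialFlow m (-s) r := by
    rw [← hφ.apply_neg_eq_radialFlow hhC hinv hrC hs0, hr, hφ.neg_apply]
  have hp : φ (τ, ψ (1, radialFlow m (-s) r)) = p := by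
    rw [← hw, hψ.apply_neg, hφ.apply_neg]
  have hKp : κ / 2 < K p := by
    have : dist (radialFlow m (-s) r) 0 < ρ := by
      rw [dist_zero_right]
      refine (norm_radialFlow_neg_le hs0 r).trans_lt (lt_of_le_of_lt ?_ hsρ)
      exact mul_le_mul_of_nonneg_left (hR r hrC) (Real.exp_pos _).le
    simpa only [mem_Ioi, hp] using hnear this
  rw [hw, hφ.conformalFactor_radialFlow hhC hinv hrC hs0]
  calc H r ≤ M := (le_abs_self _).trans (hM r)
    _ ≤ Real.exp s * (a * b * (κ / 2)) := hsM
    _ = Real.exp s * (a * b) * (κ / 2) := by ring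
    _ ≤ _ := by
      refine mul_le_mul ?_ hKp.le (by positivity) ?_
      · exact mul_le_mul_of_nonneg_left (mul_le_mul (hak _) (hbh _) hb.le (ha.le.trans (hak _)))
          (Real.exp_pos _).le
      · exact mul_nonneg (Real.exp_pos _).le (mul_nonneg (conformalFactor_pos _ _ _).le
          (conformalFactor_pos _ _ _).le)

theorem exists_isContactFlow_pair {S : Set (ContactSpace m)} {q : ContactSpace m}
    (hΔc : IsCompact Δ) (hΔstar : ∀ t : ℝ, 0 < t → radialFlow m (-t) '' Δ ⊆ interior Δ)
    (hS : IsCompact S) (hSΔ : S ⊆ interior Δ) (hq : q ∈ S) :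
    ∃ (C Ω : Set (ContactSpace m)) (h k : ContactSpace m → ℝ)
      (φ ψ : ℝ × ContactSpace m → ContactSpace m) (τ : ℝ),
      IsCompact C ∧ S ⊆ C ∧ (∀ t, 0 ≤ t → ∀ p ∈ C, radialFlow m (-t) p ∈ C) ∧
      IsCompact Ω ∧ Ω ⊆ interior Δ ∧ ContDiff ℝ ∞ h ∧ ContDiff ℝ ∞ k ∧
      tsupport h ⊆ Ω ∧ tsupport k ⊆ Ω ∧ (∀ p ∈ C, h =ᶠ[𝓝 p] fun q => q.1) ∧
      IsContactFlow h φ ∧ IsContactFlow k ψ ∧ φ (τ, ψ (1, 0)) = q := by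
  obtain ⟨C, hC, hCΔ, hSC, hC0, hinv⟩ := exists_invariant_core hΔc hΔstar hS hSΔ ⟨q, hq⟩
  obtain ⟨χ, hχ, hχc, hχΔ, hχ1⟩ := exists_contDiff_cutoff hΔc hC.isClosed hCΔ
  obtain ⟨ε, hε, hball⟩ := Metric.mem_nhds_iff.1 hC0
  obtain ⟨τ, hτ0, hτ⟩ := ((eventually_ge_atTop 0).and
    ((tendsto_radialFlow_neg q).eventually_mem (Metric.ball_mem_nhds 0 hε))).exists
  set q' := radialFlow m (-τ) q with hq'
  have hmul : ∀ (l : ContactSpace m → ℝ), ∀ p ∈ C, (fun p => χ p * l p) =ᶠ[𝓝 p] l :=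
    fun l p hp => (hχ1 p hp).mono fun y hy => by simp only [hy, one_mul]
  obtain ⟨φ, hφ⟩ := exists_isContactFlow (hχ.mul contDiff_fst) hχc.mul_right
  obtain ⟨ψ, hψ⟩ := exists_isContactFlow (hχ.mul (contDiff_translationHamiltonian q'))
    hχc.mul_right
  have hψ1 : ψ (1, 0) = q' := by
    have := hψ.eq_of_hasDerivAt (γ := fun t : ℝ => t • q') (T := 1) (fun t ht => ?_)
      (right_mem_Icc.2 zero_le_one)
    · simpa only [zero_smul, one_smul] using this
    · have hmem : t • q' ∈ C := hball <| (convex_ball (0 : ContactSpace m) ε).smul_mem_of_zero_mem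
        (Metric.mem_ball_self hε) hτ ht
      refine ((hasDerivAt_id t).smul_const q').congr_deriv ?_
      exact (one_smul ℝ q').trans ((contactField_congr (hmul _ _ hmem)).trans
        (contactField_translationHamiltonian q' t)).symm
  refine ⟨C, tsupport χ, _, _, φ, ψ, τ, hC, hSC, hinv, hχc, hχΔ, hχ.mul contDiff_fst,
    hχ.mul (contDiff_translationHamiltonian q'), tsupport_mul_subset_left,
    tsupport_mul_subset_left, hmul _, hφ, hψ, ?_⟩
  rw [hψ1, hq', ← hφ.apply_neg_eq_radialFlow (hmul _) hinv (hSC hq) hτ0, hφ.apply_neg]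

end Disorder

/-- Proposition 4.10 (prop:disorder): for a compact star-shaped domain
`Δ ⊂ ℝ^{2n−1}` and nonnegative, not identically zero contact Hamiltonians `K, H`
compactly supported in the interior of `Δ`, there is a smooth compactly supported
contact isotopy `Φ_t` of `(ℝ^{2n−1}, λ_st)`, supported in the interior of `Δ`, whose
time-one map `Φ = Φ_1` with conformal factor `c = c_1` satisfies
`(c·K)∘Φ^{−1} ≥ H`, i.e. `c(p)·K(p) ≥ H(Φ(p))` for all `p`. -/
theorem disorder_conjugation (n : ℕ) (hn : 1 ≤ n)
    (Δ : Set (ContactSpace (n - 1)))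
    (hΔc : IsCompact Δ)
    (hΔstar : ∀ t : ℝ, 0 < t → radialFlow (n - 1) (-t) '' Δ ⊆ interior Δ)
    (K H : ContactSpace (n - 1) → ℝ)
    (hKc : Continuous K) (hHc : Continuous H)
    (hK0 : ∀ p, 0 ≤ K p) (hH0 : ∀ p, 0 ≤ H p)
    (hKne : ∃ p, K p ≠ 0) (hHne : ∃ p, H p ≠ 0)
    (hKsupp : IsCompact (tsupport K) ∧ tsupport K ⊆ interior Δ)
    (hHsupp : IsCompact (tsupport H) ∧ tsupport H ⊆ interior Δ) :
    ∃ (Φ : ℝ × ContactSpace (n - 1) → ContactSpace (n - 1))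
      (c : ℝ → ContactSpace (n - 1) → ℝ),
      ContDiffOn ℝ (⊤ : ℕ∞) Φ (Set.Icc (0 : ℝ) 1 ×ˢ (Set.univ : Set (ContactSpace (n - 1)))) ∧
      (∀ p, Φ (0, p) = p) ∧
      (∀ t ∈ Set.Icc (0 : ℝ) 1,
        Function.Bijective (fun p => Φ (t, p)) ∧
        (∃ Ψ : ContactSpace (n - 1) → ContactSpace (n - 1), ContDiff ℝ (⊤ : ℕ∞) Ψ ∧
          Function.LeftInverse Ψ (fun p => Φ (t, p)) ∧
          Function.RightInverse Ψ (fun p => Φ (t, p))) ∧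
        (∃ Ct : Set (ContactSpace (n - 1)), IsCompact Ct ∧ Ct ⊆ interior Δ ∧
          ∀ p ∉ Ct, Φ (t, p) = p) ∧
        (∀ p, 0 < c t p ∧ ∀ v,
          lamSt (n - 1) (Φ (t, p)) (fderiv ℝ (fun q => Φ (t, q)) p v)
            = c t p * lamSt (n - 1) p v)) ∧
      (∀ p, H (Φ (1, p)) ≤ c 1 p * K p) := by
  obtain ⟨q, hq⟩ := hKne
  obtain ⟨C, Ω, h, k, φ, ψ, τ, hC, hSC, hinv, hΩ, hΩΔ, hh, hk, hhΩ, hkΩ, hhC, hφ, hψ, hpos⟩ :=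
    exists_isContactFlow_pair (q := q) hΔc hΔstar (hHsupp.1.union isCompact_singleton)
      (union_subset hHsupp.2 (singleton_subset_iff.2 (hKsupp.2 (subset_tsupport K hq))))
      (mem_union_right _ rfl)
  obtain ⟨s, hs⟩ := hφ.exists_forall_le_mul hψ hh hk
    (hΩ.of_isClosed_subset (isClosed_tsupport h) hhΩ)
    (hΩ.of_isClosed_subset (isClosed_tsupport k) hkΩ) hC hhC hinv hKc hHc hK0 hHsupp.1
    (subset_union_left.trans hSC) (τ := τ) (hpos.symm ▸ (hK0 q).lt_of_ne' hq)
  have hφt : ∀ t, ContDiff ℝ ∞ fun p => φ (t, p) := fun t =>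
    hφ.contDiff.comp (contDiff_const.prodMk contDiff_id)
  have hψt : ∀ t, ContDiff ℝ ∞ fun p => ψ (t, p) := fun t =>
    hψ.contDiff.comp (contDiff_const.prodMk contDiff_id)
  have hinner : ContDiff ℝ ∞ fun u : ℝ × ContactSpace (n - 1) => φ (-(u.1 * τ), u.2) :=
    hφ.contDiff.comp (by fun_prop)
  have hmiddle : ContDiff ℝ ∞ fun u : ℝ × ContactSpace (n - 1) =>
      ψ (-u.1, φ (-(u.1 * τ), u.2)) :=
    hψ.contDiff.comp (contDiff_fst.neg.prodMk hinner)
  refine ⟨fun u => φ (u.1 * s, ψ (-u.1, φ (-(u.1 * τ), u.2))),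
    fun t p => conformalFactor h φ (t * s) (ψ (-t, φ (-(t * τ), p))) *
      (conformalFactor k ψ (-t) (φ (-(t * τ), p)) * conformalFactor h φ (-(t * τ)) p),
    (hφ.contDiff.comp ((contDiff_fst.mul contDiff_const).prodMk hmiddle)).contDiffOn,
    fun p => by simp [hφ.zero, hψ.zero], fun t _ => ?_, fun p => by simpa using hs p⟩
  have hleft : Function.LeftInverse (fun p => φ (t * τ, ψ (t, φ (-(t * s), p))))
      (fun p => φ (t * s, ψ (-t, φ (-(t * τ), p)))) := fun p => by
    simp only [hφ.neg_apply, hψ.apply_neg, hφ.apply_neg]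
  have hright : Function.RightInverse (fun p => φ (t * τ, ψ (t, φ (-(t * s), p))))
      (fun p => φ (t * s, ψ (-t, φ (-(t * τ), p)))) := fun p => by
    simp only [hφ.neg_apply, hψ.neg_apply, hφ.apply_neg]
  refine ⟨⟨hleft.injective, hright.surjective⟩,
    ⟨_, (hφt _).comp ((hψt _).comp (hφt _)), hleft, hright⟩, ⟨Ω, hΩ, hΩΔ, fun p hp => ?_⟩,
    fun p => ⟨mul_pos (conformalFactor_pos _ _ _)
      (mul_pos (conformalFactor_pos _ _ _) (conformalFactor_pos _ _ _)), ?_⟩⟩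
  · have hph := fun hmem => hp (hhΩ hmem)
    have hpk := fun hmem => hp (hkΩ hmem)
    simp only [hφ.eq_self _ p hph, hψ.eq_self _ p hpk]
  · have hd : ∀ {f : ContactSpace (n - 1) → ContactSpace (n - 1)}, ContDiff ℝ ∞ f →
        Differentiable ℝ f := fun hf => hf.differentiable (by simp)
    exact lamSt_fderiv_comp (f := fun q => φ (t * s, q))
      (g := fun q => ψ (-t, φ (-(t * τ), q))) (hd (hφt _)) (hd ((hψt _).comp (hφt _)))
      (hφ.lamSt_fderiv _ _)
      (lamSt_fderiv_comp (f := fun q => ψ (-t, q)) (g := fun q => φ (-(t * τ), q)) (hd (hψt _))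
        (hd (hφt _)) (hψ.lamSt_fderiv _ _) (hφ.lamSt_fderiv _ _))
end

section
/- Let K, K̃ : [−1,1] → ℝ be continuous functions. Assume there exists z₀ ∈ (−1,1) with K(z₀) < 0, and there exists ε ∈ (0,1) such that K̃(z) > 0 for every z with 1−ε ≤ |z| ≤ 1. Then there exists a C^∞ diffeomorphism Φ : [−1,1] → [−1,1] with Φ(−1) = −1, Φ(1) = 1 and Φ′(z) > 0 for all z, such that Φ′(z)·K(z) < K̃(Φ(z)) for every z ∈ [−1,1]. -/
/-- The function `z ↦ arctan (N * (z - z₀))`, affinely normalized to fix `-1` and `1`. -/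
noncomputable def normalizedArctan (N z₀ z : ℝ) : ℝ :=
  (2 * Real.arctan (N * (z - z₀)) + Real.arctan (N * (1 + z₀)) - Real.arctan (N * (1 - z₀))) /
    (Real.arctan (N * (1 + z₀)) + Real.arctan (N * (1 - z₀)))

namespace normalizedArctan

variable {N z₀ : ℝ}

theorem contDiff : ContDiff ℝ (⊤ : ℕ∞) (normalizedArctan N z₀) := by
  have h : ContDiff ℝ (⊤ : ℕ∞) fun z : ℝ => Real.arctan (N * (z - z₀)) :=
    Real.contDiff_arctan.comp (contDiff_const.mul (contDiff_id.sub contDiff_const))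
  exact (((contDiff_const.mul h).add contDiff_const).sub contDiff_const).div_const _

theorem hasDerivAt (z : ℝ) :
    HasDerivAt (normalizedArctan N z₀)
      (2 * (1 / (1 + (N * (z - z₀)) ^ 2) * N) /
        (Real.arctan (N * (1 + z₀)) + Real.arctan (N * (1 - z₀)))) z := by
  have h : HasDerivAt (fun y : ℝ => N * (y - z₀)) N z := by
    simpa using ((hasDerivAt_id z).sub_const z₀).const_mul N
  exact ((((h.arctan.const_mul 2).add_const _).sub_const _).div_const _)

theorem map_one (h : Real.arctan (N * (1 + z₀)) + Real.arctan (N * (1 - z₀)) ≠ 0) :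
    normalizedArctan N z₀ 1 = 1 := by
  rw [normalizedArctan, div_eq_one_iff_eq h]
  ring

theorem map_neg_one (h : Real.arctan (N * (1 + z₀)) + Real.arctan (N * (1 - z₀)) ≠ 0) :
    normalizedArctan N z₀ (-1) = -1 := by
  have h' : Real.arctan (N * (-1 - z₀)) = -Real.arctan (N * (1 + z₀)) := by
    rw [← Real.arctan_neg]
    ring_nf
  rw [normalizedArctan, h', div_eq_iff h]
  ring

theorem deriv_pos (hN : 0 < N)
    (h : 0 < Real.arctan (N * (1 + z₀)) + Real.arctan (N * (1 - z₀))) (z : ℝ) :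
    0 < deriv (normalizedArctan N z₀) z := by
  rw [(hasDerivAt z).deriv]
  positivity

theorem bijOn (hN : 0 < N)
    (h : 0 < Real.arctan (N * (1 + z₀)) + Real.arctan (N * (1 - z₀))) :
    Set.BijOn (normalizedArctan N z₀) (Set.Icc (-1) 1) (Set.Icc (-1) 1) := by
  have hmono : StrictMono (normalizedArctan N z₀) := strictMono_of_deriv_pos (deriv_pos hN h)
  have h1 := map_one h.ne'
  have h2 := map_neg_one h.ne'
  refine ⟨fun z hz => ⟨?_, ?_⟩, hmono.injective.injOn, ?_⟩
  · simpa only [h2] using hmono.monotone hz.1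
  · simpa only [h1] using hmono.monotone hz.2
  · have := intermediate_value_Icc (by norm_num : (-1 : ℝ) ≤ 1)
      (contDiff (N := N) (z₀ := z₀)).continuous.continuousOn
    rwa [h1, h2] at this

theorem deriv_le (hN : 0 < N)
    (h : 1 ≤ Real.arctan (N * (1 + z₀)) + Real.arctan (N * (1 - z₀))) {r z : ℝ} (hr : 0 < r)
    (hz : r ≤ |z - z₀|) : deriv (normalizedArctan N z₀) z ≤ 2 / (N * r ^ 2) := by
  have hsq : r ^ 2 ≤ (z - z₀) ^ 2 := by
    rw [← sq_abs (z - z₀)]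
    gcongr
  rw [(hasDerivAt z).deriv]
  calc 2 * (1 / (1 + (N * (z - z₀)) ^ 2) * N) / _
      ≤ 2 * (1 / (1 + (N * (z - z₀)) ^ 2) * N) := div_le_self (by positivity) h
    _ = 2 * N / (1 + (N * (z - z₀)) ^ 2) := by ring
    _ ≤ 2 * N / (N ^ 2 * r ^ 2) := by
        gcongr
        nlinarith [mul_le_mul_of_nonneg_left hsq (sq_nonneg N)]
    _ = 2 / (N * r ^ 2) := by field_simp

theorem le_deriv (hN : 0 < N)
    (h : 0 < Real.arctan (N * (1 + z₀)) + Real.arctan (N * (1 - z₀))) {C z : ℝ}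
    (hz : |N * (z - z₀)| ≤ C) :
    N / (2 * (1 + C ^ 2)) ≤ deriv (normalizedArctan N z₀) z := by
  have hsq : (N * (z - z₀)) ^ 2 ≤ C ^ 2 := by
    rw [← sq_abs (N * (z - z₀))]
    gcongr
  have h4 : Real.arctan (N * (1 + z₀)) + Real.arctan (N * (1 - z₀)) ≤ 4 := by
    linarith [Real.arctan_lt_pi_div_two (N * (1 + z₀)),
      Real.arctan_lt_pi_div_two (N * (1 - z₀)), Real.pi_le_four]
  rw [(hasDerivAt z).deriv]
  calc N / (2 * (1 + C ^ 2)) = 2 * (1 / (1 + C ^ 2) * N) / 4 := by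
        field_simp
        norm_num
    _ ≤ _ := by gcongr

theorem one_sub_le_abs {C δ z : ℝ}
    (h : 1 ≤ Real.arctan (N * (1 + z₀)) + Real.arctan (N * (1 - z₀)))
    (hC : Real.pi / 2 - δ / 2 ≤ Real.arctan C) (hδ : 0 ≤ δ) (hz : C ≤ |N * (z - z₀)|) :
    1 - δ ≤ |normalizedArctan N z₀ z| := by
  have h0 : 0 < Real.arctan (N * (1 + z₀)) + Real.arctan (N * (1 - z₀)) := by linarith
  have hA := Real.arctan_lt_pi_div_two (N * (1 + z₀))
  have hB := Real.arctan_lt_pi_div_two (N * (1 - z₀))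
  rcases le_abs.1 hz with hz | hz
  · refine le_trans ?_ (le_abs_self _)
    have := Real.arctan_mono hz
    rw [normalizedArctan, le_div_iff₀ h0]
    nlinarith
  · refine le_trans ?_ (neg_le_abs _)
    have := Real.arctan_mono hz
    rw [Real.arctan_neg] at this
    rw [normalizedArctan, ← neg_div, le_div_iff₀ h0]
    nlinarith

end normalizedArctan


/-- The analytic core of Lemma 4.5 (lm:3-domin): if `K : [−1,1] → ℝ` is continuous and
somewhere negative, and `K̃ : [−1,1] → ℝ` is continuous and positive near the endpoints,
then there is an orientation preserving `C^∞` diffeomorphism `Φ` of `[−1,1]` with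
`Φ′(z)·K(z) < K̃(Φ(z))` for all `z ∈ [−1,1]`, i.e. the push-forward `Φ_*K` is
smaller than `K̃` everywhere. -/
theorem dimension_three_domination (K Kt : ℝ → ℝ)
    (hK : ContinuousOn K (Set.Icc (-1 : ℝ) 1))
    (hKt : ContinuousOn Kt (Set.Icc (-1 : ℝ) 1))
    (hneg : ∃ z₀ ∈ Set.Ioo (-1 : ℝ) 1, K z₀ < 0)
    (hpos : ∃ ε ∈ Set.Ioo (0 : ℝ) 1, ∀ z : ℝ, 1 - ε ≤ |z| → |z| ≤ 1 → 0 < Kt z) :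
    ∃ Φ : ℝ → ℝ, ContDiff ℝ (⊤ : ℕ∞) Φ ∧ Φ (-1) = -1 ∧ Φ 1 = 1 ∧
      Set.BijOn Φ (Set.Icc (-1 : ℝ) 1) (Set.Icc (-1 : ℝ) 1) ∧
      (∀ z ∈ Set.Icc (-1 : ℝ) 1, 0 < deriv Φ z) ∧
      (∀ z ∈ Set.Icc (-1 : ℝ) 1, deriv Φ z * K z < Kt (Φ z)) := by
  obtain ⟨z₀, hz₀, hKz₀⟩ := hneg
  obtain ⟨ε, hε, hpos⟩ := hpos
  obtain ⟨P, hP⟩ := isCompact_Icc.exists_bound_of_continuousOn hK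
  obtain ⟨M, hM⟩ := isCompact_Icc.exists_bound_of_continuousOn hKt
  obtain ⟨m, hm, hmKt⟩ : ∃ m > 0, ∀ z : ℝ, 1 - ε ≤ |z| → |z| ≤ 1 → m ≤ Kt z := by
    let S : Set ℝ := Set.Icc (-1) 1 ∩ {z | 1 - ε ≤ |z|}
    have hS : IsCompact S :=
      isCompact_Icc.inter_right (isClosed_le continuous_const continuous_abs)
    have hne : S.Nonempty := ⟨1, by norm_num, by simpa using hε.1.le⟩
    obtain ⟨x, hx, hmin⟩ := hS.exists_isMinOn hne (hKt.mono Set.inter_subset_left)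
    exact ⟨Kt x, hpos x hx.2 (abs_le.2 hx.1), fun z h1 h2 => hmin ⟨abs_le.1 h2, h1⟩⟩
  obtain ⟨c, hc, r, hr, hKr⟩ :
      ∃ c > 0, ∃ r > 0, ∀ z ∈ Set.Icc (-1 : ℝ) 1, |z - z₀| < r → K z ≤ -c := by
    obtain ⟨r, hr, h⟩ := Metric.continuousOn_iff.1 hK z₀ ⟨hz₀.1.le, hz₀.2.le⟩
      (-K z₀ / 2) (by linarith)
    refine ⟨-K z₀ / 2, by linarith, r, hr, fun z hz hzr => ?_⟩
    have := (abs_lt.1 (h z hz hzr)).2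
    linarith
  obtain ⟨C, hC⟩ : ∃ C, Real.pi / 2 - ε / 2 ≤ Real.arctan C := by
    have h := (Real.tendsto_arctan_atTop.mono_right nhdsWithin_le_nhds).eventually
      (eventually_ge_nhds (show Real.pi / 2 - ε / 2 < Real.pi / 2 by linarith [hε.1]))
    exact h.exists
  have hl : 0 < 1 + z₀ := by linarith [hz₀.1]
  have hu : 0 < 1 - z₀ := by linarith [hz₀.2]
  obtain ⟨N, hN, hNr, hNl, hNu, hNM, hNP⟩ : ∃ N : ℝ, 0 < N ∧ C ≤ N * r ∧
      C ≤ N * (1 + z₀) ∧ C ≤ N * (1 - z₀) ∧ M < N / (2 * (1 + C ^ 2)) * c ∧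
      2 / (N * r ^ 2) * P < m := by
    have h : ∀ a > 0, ∀ᶠ N : ℝ in Filter.atTop, C ≤ N * a := fun a ha =>
      (Filter.tendsto_id.atTop_mul_const ha).eventually_ge_atTop C
    have hM' : ∀ᶠ N : ℝ in Filter.atTop, M < N / (2 * (1 + C ^ 2)) * c :=
      ((Filter.tendsto_id.atTop_div_const (by positivity)).atTop_mul_const
        hc).eventually_gt_atTop M
    have hP' : ∀ᶠ N : ℝ in Filter.atTop, 2 / (N * r ^ 2) * P < m := by
      have := ((Filter.tendsto_id.atTop_mul_const (pow_pos hr 2)).const_div_atTop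
        (2 : ℝ)).mul_const P
      rw [zero_mul] at this
      exact this.eventually_lt_const hm
    exact ((Filter.eventually_gt_atTop 0).and ((h r hr).and ((h _ hl).and
      ((h _ hu).and (hM'.and hP'))))).exists
  have hsum : 1 ≤ Real.arctan (N * (1 + z₀)) + Real.arctan (N * (1 - z₀)) := by
    linarith [Real.arctan_mono hNl, Real.arctan_mono hNu, Real.pi_gt_three, hε.2]
  have hsum0 := zero_lt_one.trans_le hsum
  have hbij := normalizedArctan.bijOn hN hsum0
  refine ⟨normalizedArctan N z₀, normalizedArctan.contDiff, normalizedArctan.map_neg_one hsum0.ne',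
    normalizedArctan.map_one hsum0.ne', hbij,
    fun z _ => normalizedArctan.deriv_pos hN hsum0 z, fun z hz => ?_⟩
  have hd := normalizedArctan.deriv_pos hN hsum0 z
  have hΦ := hbij.mapsTo hz
  have hfar : C ≤ |N * (z - z₀)| → m ≤ Kt (normalizedArctan N z₀ z) := fun h =>
    hmKt _ (normalizedArctan.one_sub_le_abs hsum hC hε.1.le h) (abs_le.2 hΦ)
  rcases lt_or_ge |z - z₀| r with hzr | hzr
  · have hKz := hKr z hz hzr
    rcases le_total C |N * (z - z₀)| with hCz | hCz
    · exact (mul_neg_of_pos_of_neg hd (by linarith)).trans (hm.trans_le (hfar hCz))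
    · have h1 := normalizedArctan.le_deriv hN hsum0 hCz
      have h2 := (abs_le.1 (hM _ hΦ)).1
      nlinarith [mul_le_mul_of_nonneg_right h1 hc.le, mul_le_mul_of_nonneg_left hKz hd.le]
  · have hCz : C ≤ |N * (z - z₀)| := by
      rw [abs_mul, abs_of_pos hN]
      exact hNr.trans (by gcongr)
    have hPz : |K z| ≤ P := hP z hz
    calc deriv (normalizedArctan N z₀) z * K z
        ≤ deriv (normalizedArctan N z₀) z * P := by
          gcongr
          exact (le_abs_self _).trans hPz
      _ ≤ 2 / (N * r ^ 2) * P :=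
          mul_le_mul_of_nonneg_right (normalizedArctan.deriv_le hN hsum hr hzr)
            ((abs_nonneg _).trans hPz)
      _ < m := hNP
      _ ≤ _ := hfar hCz
end

section
/- Let k : [0,∞) → ℝ satisfy the special inequality a·k(u/a) < k(u) for every real a > 1 and every u ≥ 0. For δ ∈ (0,1) define k̃_δ : [0,∞) → ℝ by k̃_δ(u) = k(δu)/δ + (δ−1)/δ. Then for every a > 1 and every u ≥ 0 one has a·k̃_δ(u/a) − k̃_δ(u) < (a−1)·(δ−1)/δ < 0. Moreover, if k is continuous and k(1) > 0, then there exists δ₀ ∈ (0,1) such that for every δ ∈ (δ₀,1) the function k̃_δ is special, i.e. k̃_δ(1) > 0 and a·k̃_δ(u/a) < k̃_δ(u) for all a > 1 and u ≥ 0. -/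
/-- The key computation of Lemma 3.6 (lem:Scale): if `k` satisfies the special
inequality `a·k(u/a) < k(u)` for all `a > 1`, `u ≥ 0`, then the rescaled function
`k̃_δ(u) = k(δu)/δ + (δ−1)/δ` satisfies
`a·k̃_δ(u/a) − k̃_δ(u) < (a−1)(δ−1)/δ < 0` for every `δ ∈ (0,1)`, `a > 1`, `u ≥ 0`;
and if moreover `k` is continuous with `k 1 > 0`, then `k̃_δ` is special for all
`δ < 1` sufficiently close to `1`. -/
theorem rescaled_function_special (k : ℝ → ℝ)
    (hspec : ∀ a : ℝ, 1 < a → ∀ u : ℝ, 0 ≤ u → a * k (u / a) < k u) :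
    (∀ δ ∈ Set.Ioo (0 : ℝ) 1, ∀ a : ℝ, 1 < a → ∀ u : ℝ, 0 ≤ u →
      a * (k (δ * (u / a)) / δ + (δ - 1) / δ) - (k (δ * u) / δ + (δ - 1) / δ)
          < (a - 1) * (δ - 1) / δ ∧ (a - 1) * (δ - 1) / δ < 0) ∧
    (ContinuousOn k (Set.Ici 0) → 0 < k 1 →
      ∃ δ₀ ∈ Set.Ioo (0 : ℝ) 1, ∀ δ ∈ Set.Ioo δ₀ 1,
        0 < k (δ * 1) / δ + (δ - 1) / δ ∧
        ∀ a : ℝ, 1 < a → ∀ u : ℝ, 0 ≤ u →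
          a * (k (δ * (u / a)) / δ + (δ - 1) / δ) < k (δ * u) / δ + (δ - 1) / δ) := by
  have key : ∀ δ ∈ Set.Ioo (0 : ℝ) 1, ∀ a : ℝ, 1 < a → ∀ u : ℝ, 0 ≤ u →
      a * (k (δ * (u / a)) / δ + (δ - 1) / δ) - (k (δ * u) / δ + (δ - 1) / δ)
          < (a - 1) * (δ - 1) / δ ∧ (a - 1) * (δ - 1) / δ < 0 := by
    rintro δ ⟨hδ0, hδ1⟩ a ha u hu
    refine ⟨?_, div_neg_of_neg_of_pos
      (mul_neg_of_pos_of_neg (sub_pos.2 ha) (sub_neg.2 hδ1)) hδ0⟩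
    have h := hspec a ha (δ * u) (by positivity)
    rw [mul_div_assoc] at h
    have hneg : (a * k (δ * (u / a)) - k (δ * u)) / δ < 0 :=
      div_neg_of_neg_of_pos (sub_neg.2 h) hδ0
    have heq : a * (k (δ * (u / a)) / δ + (δ - 1) / δ) - (k (δ * u) / δ + (δ - 1) / δ)
        = (a * k (δ * (u / a)) - k (δ * u)) / δ + (a - 1) * (δ - 1) / δ := by ring
    linarith
  refine ⟨key, fun hk hk1 => ?_⟩
  have hcont : ContinuousAt (fun δ => k δ + (δ - 1)) 1 :=
    (hk.continuousAt (Ici_mem_nhds one_pos)).add (by fun_prop)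
  have hev : ∀ᶠ δ in nhds (1 : ℝ), 0 < k δ + (δ - 1) :=
    hcont.eventually (lt_mem_nhds (by simpa using hk1))
  obtain ⟨ε, hε, hball⟩ := Metric.eventually_nhds_iff.1 hev
  refine ⟨max (1 / 2) (1 - ε), ⟨by positivity, max_lt (by norm_num) (by linarith)⟩, ?_⟩
  rintro δ ⟨hδ, hδ1⟩
  obtain ⟨hhalf, hδε⟩ := max_lt_iff.1 hδ
  have hδ0 : 0 < δ := by linarith
  refine ⟨?_, fun a ha u hu => ?_⟩
  · rw [mul_one, ← add_div]
    refine div_pos (hball ?_) hδ0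
    rw [Real.dist_eq, abs_lt]
    constructor <;> linarith
  · obtain ⟨h1, h2⟩ := key δ ⟨hδ0, hδ1⟩ a ha u hu
    linarith
end

section
/- Let K : [0,1] × [−1,1] → ℝ be a special contact Hamiltonian with witnesses z_D ∈ (−1,1), δ₀ ∈ (0,1), ε > 0 and special function k. For δ ∈ (0,1) define K̃_δ : [0,1] × [−1,1] → ℝ by K̃_δ(u,z) = K(δu, δz)/δ + (δ−1)/δ. Then there exists δ₁ ∈ (0,1) such that for every δ ∈ (δ₁, 1), the function K̃_δ is again a special contact Hamiltonian, with witnesses z̃_D = z_D/δ and special function k̃_δ(u) = k(δu)/δ + (δ−1)/δ. -/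
/-- A special function: `k 1 > 0` and `a·k(u/a) < k(u)` for all `a > 1`, `u ≥ 0`. -/
def IsSpecialFn (k : ℝ → ℝ) : Prop :=
  0 < k 1 ∧ ∀ a : ℝ, 1 < a → ∀ u : ℝ, 0 ≤ u → a * k (u / a) < k u

/-- A special contact Hamiltonian `K : [0,1] × [−1,1] → ℝ` with witnesses
`z_D ∈ (−1,1)`, `δ₀ ∈ (0,1)`, `ε > 0` (with `[z_D−ε, z_D+ε] ⊂ (−1,1)`) and a special
function `k`, as in Definition 2.5 of the paper. -/
def IsSpecialHam (K : ℝ → ℝ → ℝ) (zD δ₀ ε : ℝ) (k : ℝ → ℝ) : Prop :=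
  ContinuousOn (fun p : ℝ × ℝ => K p.1 p.2) (Set.Icc (0 : ℝ) 1 ×ˢ Set.Icc (-1 : ℝ) 1) ∧
  zD ∈ Set.Ioo (-1 : ℝ) 1 ∧ δ₀ ∈ Set.Ioo (0 : ℝ) 1 ∧ 0 < ε ∧
  -1 < zD - ε ∧ zD + ε < 1 ∧ IsSpecialFn k ∧
  -- (i) positivity on the boundary u = 1 or |z| = 1
  (∀ u ∈ Set.Icc (0 : ℝ) 1, ∀ z ∈ Set.Icc (-1 : ℝ) 1, (u = 1 ∨ |z| = 1) → 0 < K u z) ∧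
  -- (ii) symmetry near the top and bottom
  (∀ δ ∈ Set.Icc δ₀ 1, ∀ u ∈ Set.Icc (0 : ℝ) 1, K u (-δ) = K u δ) ∧
  -- (iii) maximality near the top and bottom
  (∀ δ ∈ Set.Icc δ₀ 1, ∀ u ∈ Set.Icc (0 : ℝ) 1, ∀ z : ℝ, |z| ≤ δ → K u z ≤ K u δ) ∧
  -- (iv) non-increasing in z on [−1, z_D + ε]
  (∀ u ∈ Set.Icc (0 : ℝ) 1, ∀ z₁ z₂ : ℝ, -1 ≤ z₁ → z₁ ≤ z₂ → z₂ ≤ zD + ε →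
    K u z₂ ≤ K u z₁) ∧
  -- (v) bounded below by k, with equality near z_D
  (∀ u ∈ Set.Icc (0 : ℝ) 1, ∀ z ∈ Set.Icc (-1 : ℝ) 1,
    k u ≤ K u z ∧ (|z - zD| ≤ ε → K u z = k u))

open Filter Topology in
/-- A continuous function on the rectangle that is positive on its top edge stays above `1 - δ`
on the nearby horizontal lines of height `δ`. -/
lemma eventually_one_sub_lt_of_pos {K : ℝ → ℝ → ℝ}
    (hc : ContinuousOn (fun p : ℝ × ℝ => K p.1 p.2) (Set.Icc (0 : ℝ) 1 ×ˢ Set.Icc (-1 : ℝ) 1))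
    (hpos : ∀ u ∈ Set.Icc (0 : ℝ) 1, 0 < K u 1) :
    ∀ᶠ δ in 𝓝[<] (1 : ℝ), ∀ u ∈ Set.Icc (0 : ℝ) 1, 1 - δ < K u δ := by
  have hc' : Continuous fun p : ℝ × ℝ =>
      K (Set.projIcc (0 : ℝ) 1 zero_le_one p.2) (Set.projIcc (-1 : ℝ) 1 (by norm_num) p.1) :=
    hc.comp_continuous
      (f := fun p : ℝ × ℝ => ((Set.projIcc (0 : ℝ) 1 zero_le_one p.2 : ℝ),
        (Set.projIcc (-1 : ℝ) 1 (by norm_num) p.1 : ℝ)))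
      (by fun_prop) fun p => ⟨Subtype.coe_prop _, Subtype.coe_prop _⟩
  have key : ∀ᶠ δ in 𝓝 (1 : ℝ), ∀ u ∈ Set.Icc (0 : ℝ) 1,
      1 - δ < K (Set.projIcc (0 : ℝ) 1 zero_le_one u)
        (Set.projIcc (-1 : ℝ) 1 (by norm_num) δ) := by
    refine isCompact_Icc.eventually_forall_of_forall_eventually fun u hu => ?_
    refine (continuous_const.sub continuous_fst).continuousAt.eventually_lt hc'.continuousAt ?_
    simpa [Set.projIcc_of_mem zero_le_one hu] using hpos u hu
  filter_upwards [nhdsWithin_le_nhds key, Ioo_mem_nhdsLT (show (-1 : ℝ) < 1 by norm_num)]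
    with δ h hδ u hu
  have := h u hu
  rwa [Set.projIcc_of_mem _ hu, Set.projIcc_of_mem _ (Set.Ioo_subset_Icc_self hδ)] at this

open Filter Topology in
/-- A function that is continuous on `[0,1]` and positive at `1` exceeds `1 - δ` at `δ`
near `1`. -/
lemma eventually_one_sub_lt_self {k : ℝ → ℝ} (hc : ContinuousOn k (Set.Icc (0 : ℝ) 1))
    (hpos : 0 < k 1) : ∀ᶠ δ in 𝓝[<] (1 : ℝ), 1 - δ < k δ := by
  have hk : Tendsto k (𝓝[<] 1) (𝓝 (k 1)) :=
    ((hc 1 (by simp)).mono_of_mem_nhdsWithin (Icc_mem_nhdsLT (by norm_num)))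
  have hs : Tendsto (fun δ : ℝ => 1 - δ) (𝓝[<] 1) (𝓝 (1 - 1)) :=
    ((continuous_const.sub continuous_id).tendsto 1).mono_left nhdsWithin_le_nhds
  exact hs.eventually_lt hk (by simpa using hpos)

lemma IsSpecialFn.rescale {k : ℝ → ℝ} (hk : IsSpecialFn k) {δ : ℝ} (hδ : 0 < δ) (hδ' : δ < 1)
    (h : 1 - δ < k δ) : IsSpecialFn fun u => k (δ * u) / δ + (δ - 1) / δ := by
  refine ⟨?_, fun a ha u hu => ?_⟩
  · simp only [mul_one, ← add_div]
    exact div_pos (by linarith) hδ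
  · have h1 := hk.2 a ha (δ * u) (by positivity)
    simp only [← add_div, ← mul_div_assoc]
    gcongr
    nlinarith

namespace IsSpecialHam

variable {K : ℝ → ℝ → ℝ} {zD δ₀ ε : ℝ} {k : ℝ → ℝ}

lemma continuousOn_specialFn (hK : IsSpecialHam K zD δ₀ ε k) :
    ContinuousOn k (Set.Icc (0 : ℝ) 1) := by
  obtain ⟨hc, hz, -, hε, -, -, -, -, -, -, -, hv⟩ := hK
  have hz' := Set.Ioo_subset_Icc_self hz
  refine (hc.comp (f := fun u : ℝ => (u, zD)) (by fun_prop) fun u hu => ⟨hu, hz'⟩).congr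
    fun u hu => ?_
  exact ((hv u hu zD hz').2 (by simpa using hε.le)).symm

lemma rescale (hK : IsSpecialHam K zD δ₀ ε k) {δ : ℝ} (hδ₀ : δ₀ < δ) (hδ : δ < 1)
    (hlow : -δ < zD - ε) (hupp : zD + ε < δ) (hk : 1 - δ < k δ)
    (hpos : ∀ u ∈ Set.Icc (0 : ℝ) 1, 1 - δ < K u δ) :
    IsSpecialHam (fun u z => K (δ * u) (δ * z) / δ + (δ - 1) / δ)
      (zD / δ) (δ₀ / δ) (ε / δ) (fun u => k (δ * u) / δ + (δ - 1) / δ) := by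
  obtain ⟨hc, -, ⟨h0, -⟩, hε, -, -, hsp, -, hii, hiii, hiv, hv⟩ := hK
  have hδp : 0 < δ := h0.trans hδ₀
  have hu' : ∀ u ∈ Set.Icc (0 : ℝ) 1, δ * u ∈ Set.Icc (0 : ℝ) 1 := fun u hu =>
    ⟨mul_nonneg hδp.le hu.1, mul_le_one₀ hδ.le hu.1 hu.2⟩
  have hz' : ∀ z ∈ Set.Icc (-1 : ℝ) 1, δ * z ∈ Set.Icc (-1 : ℝ) 1 := fun z hz =>
    ⟨by nlinarith [hz.1], by nlinarith [hz.2]⟩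
  have hd' : ∀ d ∈ Set.Icc (δ₀ / δ) 1, δ * d ∈ Set.Icc δ₀ 1 := fun d hd =>
    ⟨(div_le_iff₀' hδp).1 hd.1, by nlinarith [hd.2]⟩
  refine ⟨?_, ⟨?_, ?_⟩, ⟨by positivity, (div_lt_one hδp).2 hδ₀⟩, by positivity, ?_, ?_,
    hsp.rescale hδp hδ hk, fun u hu z hz huz => ?_, fun d hd u hu => ?_,
    fun d hd u hu z hz => ?_, fun u hu z₁ z₂ h1 h12 h2 => ?_, fun u hu z hz => ⟨?_, fun h => ?_⟩⟩
  · have := hc.comp (f := fun p : ℝ × ℝ => (δ * p.1, δ * p.2)) (by fun_prop)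
      fun p (hp : p ∈ Set.Icc (0 : ℝ) 1 ×ˢ Set.Icc (-1 : ℝ) 1) => ⟨hu' _ hp.1, hz' _ hp.2⟩
    exact (this.div_const δ).add continuousOn_const
  · rw [lt_div_iff₀ hδp]; linarith
  · rw [div_lt_one hδp]; linarith
  · rw [← sub_div, lt_div_iff₀ hδp]; linarith
  · rwa [← add_div, div_lt_one hδp]
  · have : 1 - δ < K (δ * u) (δ * z) := by
      rcases huz with rfl | hz1
      · rw [mul_one]
        exact hk.trans_le (hv δ ⟨hδp.le, hδ.le⟩ _ (hz' z hz)).1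
      · rcases eq_or_eq_neg_of_abs_eq hz1 with rfl | rfl
        · simpa using hpos _ (hu' u hu)
        · simpa [hii δ ⟨hδ₀.le, hδ.le⟩ _ (hu' u hu)] using hpos _ (hu' u hu)
    simp only [← add_div]
    exact div_pos (by linarith) hδp
  · simp only [mul_neg, hii _ (hd' d hd) _ (hu' u hu)]
  · have := hiii _ (hd' d hd) _ (hu' u hu) (δ * z)
      (by rw [abs_mul, abs_of_pos hδp]; gcongr)
    dsimp only
    gcongr
  · have := hiv _ (hu' u hu) (δ * z₁) (δ * z₂) (by nlinarith) (by gcongr)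
      ((le_div_iff₀' hδp).1 (by rwa [add_div]))
    dsimp only
    gcongr
  · have := (hv _ (hu' u hu) _ (hz' z hz)).1
    dsimp only
    gcongr
  · have : |δ * z - zD| ≤ ε := by
      have hrw : δ * z - zD = δ * (z - zD / δ) := by field_simp
      rw [hrw, abs_mul, abs_of_pos hδp]
      exact (le_div_iff₀' hδp).1 h
    simp only [(hv _ (hu' u hu) _ (hz' z hz)).2 this]

end IsSpecialHam

/-- Lemma 3.6 (lem:Scale): rescaling a special contact Hamiltonian by a factor
`δ < 1` sufficiently close to `1` yields again a special contact Hamiltonian, with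
witnesses `z̃_D = z_D/δ` and special function `k̃_δ(u) = k(δu)/δ + (δ−1)/δ`. -/
theorem rescaled_special_hamiltonian (K : ℝ → ℝ → ℝ) (zD δ₀ ε : ℝ) (k : ℝ → ℝ)
    (hK : IsSpecialHam K zD δ₀ ε k) :
    ∃ δ₁ ∈ Set.Ioo (0 : ℝ) 1, ∀ δ ∈ Set.Ioo δ₁ 1,
      ∃ δ₀' ε' : ℝ,
        IsSpecialHam (fun u z => K (δ * u) (δ * z) / δ + (δ - 1) / δ)
          (zD / δ) δ₀' ε' (fun u => k (δ * u) / δ + (δ - 1) / δ) := by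
  have hkc := hK.continuousOn_specialFn
  obtain ⟨hc, -, hδ₀, -, hlow, hupp, hsp, hi, -⟩ := id hK
  have hev := (eventually_one_sub_lt_self hkc hsp.1).and (eventually_one_sub_lt_of_pos hc
    fun u hu => hi u hu 1 (by norm_num) (Or.inr abs_one))
  obtain ⟨l, hl, hsub⟩ := mem_nhdsLT_iff_exists_Ioo_subset.1 hev
  refine ⟨max (max l δ₀) (max (zD + ε) (ε - zD)), ⟨?_, ?_⟩, fun δ hδ => ⟨δ₀ / δ, ε / δ, ?_⟩⟩
  · exact hδ₀.1.trans_le ((le_max_right _ _).trans (le_max_left _ _))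
  · exact max_lt (max_lt hl hδ₀.2) (max_lt hupp (by linarith))
  · obtain ⟨hmax, hδ1⟩ := hδ
    simp only [max_lt_iff] at hmax
    obtain ⟨⟨hlδ, hδ₀δ⟩, huppδ, hlowδ⟩ := hmax
    obtain ⟨hk, hpos⟩ := hsub ⟨hlδ, hδ1⟩
    exact hK.rescale hδ₀δ hδ1 (by linarith) huppδ hk hpos
end

section
/- Let K : [0,1] × [−1,1] → ℝ be a special contact Hamiltonian with witnesses z_D ∈ (−1,1), δ₀ ∈ (0,1), ε > 0 and special function k, and assume in addition that there are z_D′ ∈ (−1, z_D) and ε′ > 0 such that K(u,z) = k(u) for all u ∈ [0,1] and all z ∈ [z_D′ − ε′, z_D + ε′]. Set E(u) := K(u,1), fix ℓ > 0, and let (h_σ)_{σ∈[0,1]} be a family of C^∞ functions h_σ : ℝ → ℝ with h_σ′ > 0 everywhere such that h_σ(z) = z + (1−2σ)(1+ℓ) for z ≤ z_D′, h_σ′(z) ≥ 1 for z ∈ [z_D′, z_D], and h_σ(z) = z + 1 + ℓ for z ≥ z_D. Define h̃_σ(u,z) := h_σ′(h_σ^{−1}(z)) − (h_σ′(h_σ^{−1}(z))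 − 1)·u and the push-forward F_σ(u,z) := h̃_σ(u,z) · K(u / h̃_σ(u,z), h_σ^{−1}(z)), for u ∈ [0,1] and z ∈ [h_σ(−1), h_σ(1)]. Define on [0,1] × [−2−ℓ, 2+ℓ] the connected-sum Hamiltonians (E # K)(u,z) = E(u) for z ∈ [−2−ℓ, ℓ] and (E # K)(u,z) = K(u, z−1−ℓ) for z ∈ [ℓ, 2+ℓ]; and (K # K)(u,z) = K(u, z+1+ℓ) for z ∈ [−2−ℓ, −ℓ], (K # K)(u,z) = E(u) for z ∈ [−ℓ, ℓ], and (K # K)(u,z) = K(u, z−1−ℓ) for z ∈ [ℓ, 2+ℓ]. Then: (i) for every σ ∈ [0,1], F_σ(u,z) ≤ (E # K)(u,z) for all u ∈ [0,1] and z ∈ [h_σ(−1), h_σ(1)]; and (ii) F_1(u,z) ≤ (K # K)(u,z) for all u ∈ [0,1] and z ∈ [−2−ℓ, 2+ℓ]. -/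
open Set Filter Topology in
/-- A function agreeing with a translation on an open set has derivative `1` there. -/
theorem deriv_eq_one_of_eq_add_on {f : ℝ → ℝ} {s : Set ℝ} {c x : ℝ} (hs : IsOpen s)
    (hx : x ∈ s) (hf : ∀ y ∈ s, f y = y + c) : deriv f x = 1 := by
  have heq : f =ᶠ[𝓝 x] fun y => y + c := by
    filter_upwards [hs.mem_nhds hx] with y hy using hf y hy
  rw [heq.deriv_eq]
  simp

/-- The scaling inequality of a special function, including the trivial case `a = 1`. -/
theorem IsSpecialFn.mul_div_le {k : ℝ → ℝ} (hk : IsSpecialFn k) {a u : ℝ} (ha : 1 ≤ a)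
    (hu : 0 ≤ u) : a * k (u / a) ≤ k u := by
  rcases ha.eq_or_lt with rfl | ha
  · simp
  · exact (hk.2 a ha u hu).le

/-- Lemma 4.17 (p:ContEmb1), the 'Main lemma': for a special contact Hamiltonian `K`
which equals its special function `k` for `z` near `[z_D′, z_D]`, the push-forward
`F_σ(u,z) = h̃_σ(u,z)·K(u/h̃_σ(u,z), h_σ^{−1}(z))` of `K` under the family of
contactomorphisms `Γ_σ` determined by the diffeomorphisms `h_σ` is dominated by the
connected-sum Hamiltonians: `F_σ ≤ E # K` for every `σ ∈ [0,1]`, and `F_1 ≤ K # K`;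
here `E(u) = K(u,1)`, `(E # K)(u,z)` equals `E(u)` for `z ∈ [−2−ℓ, ℓ]` and
`K(u, z−1−ℓ)` for `z ∈ [ℓ, 2+ℓ]`, and `(K # K)(u,z)` equals `K(u, z+1+ℓ)` for
`z ∈ [−2−ℓ, −ℓ]`, `E(u)` for `z ∈ [−ℓ, ℓ]`, and `K(u, z−1−ℓ)` for `z ∈ [ℓ, 2+ℓ]`. -/
theorem main_lemma_push_forward_dominated
    (K : ℝ → ℝ → ℝ) (zD δ₀ ε : ℝ) (k : ℝ → ℝ)
    (hK : IsSpecialHam K zD δ₀ ε k)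
    (zD' ε' : ℝ) (hzD' : zD' ∈ Set.Ioo (-1 : ℝ) zD) (hε' : 0 < ε')
    (hflat : ∀ u ∈ Set.Icc (0 : ℝ) 1, ∀ z ∈ Set.Icc (zD' - ε') (zD + ε'), K u z = k u)
    (ℓ : ℝ) (hℓ : 0 < ℓ)
    (h : ℝ → ℝ → ℝ)
    (hsmooth : ∀ σ ∈ Set.Icc (0 : ℝ) 1, ContDiff ℝ (⊤ : ℕ∞) (h σ))
    (hpos : ∀ σ ∈ Set.Icc (0 : ℝ) 1, ∀ z : ℝ, 0 < deriv (h σ) z)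
    (hleft : ∀ σ ∈ Set.Icc (0 : ℝ) 1, ∀ z : ℝ, z ≤ zD' →
      h σ z = z + (1 - 2 * σ) * (1 + ℓ))
    (hmid : ∀ σ ∈ Set.Icc (0 : ℝ) 1, ∀ z ∈ Set.Icc zD' zD, 1 ≤ deriv (h σ) z)
    (hright : ∀ σ ∈ Set.Icc (0 : ℝ) 1, ∀ z : ℝ, zD ≤ z → h σ z = z + 1 + ℓ)
    (htl : ℝ → ℝ → ℝ → ℝ)
    (hhtl : ∀ σ u z : ℝ, htl σ u z =
      deriv (h σ) (Function.invFun (h σ) z)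
        - (deriv (h σ) (Function.invFun (h σ) z) - 1) * u)
    (F : ℝ → ℝ → ℝ → ℝ)
    (hF : ∀ σ u z : ℝ, F σ u z =
      htl σ u z * K (u / htl σ u z) (Function.invFun (h σ) z)) :
    (∀ σ ∈ Set.Icc (0 : ℝ) 1, ∀ u ∈ Set.Icc (0 : ℝ) 1, ∀ z : ℝ,
        h σ (-1) ≤ z → z ≤ h σ 1 →
        (-2 - ℓ ≤ z → z ≤ ℓ → F σ u z ≤ K u 1) ∧
        (ℓ ≤ z → z ≤ 2 + ℓ → F σ u z ≤ K u (z - 1 - ℓ))) ∧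
    (∀ u ∈ Set.Icc (0 : ℝ) 1, ∀ z : ℝ, -2 - ℓ ≤ z → z ≤ 2 + ℓ →
        (z ≤ -ℓ → F 1 u z ≤ K u (z + 1 + ℓ)) ∧
        (-ℓ ≤ z → z ≤ ℓ → F 1 u z ≤ K u 1) ∧
        (ℓ ≤ z → F 1 u z ≤ K u (z - 1 - ℓ))) := by
  obtain ⟨-, hzD, ⟨-, hδ₁⟩, hε, -, -, hk, -, -, hmax, hanti, hbelow⟩ := hK
  have key : ∀ σ ∈ Set.Icc (0 : ℝ) 1, ∀ u ∈ Set.Icc (0 : ℝ) 1, ∀ z : ℝ,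
      h σ (-1) ≤ z → z ≤ h σ 1 → ∃ w ∈ Set.Icc (-1 : ℝ) 1, h σ w = z ∧
        F σ u z ≤ K u w ∧ (w ∈ Set.Icc zD' zD → F σ u z ≤ k u) := by
    intro σ hσ u hu z hz₁ hz₂
    have hcont : Continuous (h σ) := (hsmooth σ hσ).continuous
    have hinj : Function.Injective (h σ) := (strictMono_of_deriv_pos (hpos σ hσ)).injective
    obtain ⟨w, hw, rfl⟩ := intermediate_value_Icc (by norm_num : (-1 : ℝ) ≤ 1)
      hcont.continuousOn ⟨hz₁, hz₂⟩
    have hinv : Function.invFun (h σ) (h σ w) = w := Function.leftInverse_invFun hinj w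
    have htranslate : deriv (h σ) w = 1 → F σ u (h σ w) = K u w := by
      intro hd
      simp [hF, hhtl, hinv, hd]
    refine ⟨w, hw, rfl, ?_⟩
    by_cases hmem : w ∈ Set.Icc zD' zD
    · have hFk : F σ u (h σ w) ≤ k u := by
        have hd := hmid σ hσ w hmem
        have hc : 1 ≤ htl σ u (h σ w) := by
          rw [hhtl, hinv]
          nlinarith [mul_nonneg (sub_nonneg.2 hd) (sub_nonneg.2 hu.2)]
        have hdiv : u / htl σ u (h σ w) ∈ Set.Icc (0 : ℝ) 1 :=
          ⟨div_nonneg hu.1 (by linarith), div_le_one_of_le₀ (hu.2.trans hc) (by linarith)⟩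
        rw [hF, hinv, hflat _ hdiv w ⟨by linarith [hmem.1], by linarith [hmem.2]⟩]
        exact hk.mul_div_le hc hu.1
      exact ⟨hFk.trans (hbelow u hu w hw).1, fun _ => hFk⟩
    · refine ⟨(htranslate ?_).le, fun hm => absurd hm hmem⟩
      rcases lt_or_ge w zD' with hlt | hge
      · exact deriv_eq_one_of_eq_add_on isOpen_Iio hlt fun y hy =>
          hleft σ hσ y (Set.mem_Iio.1 hy).le
      · have hgt : zD < w := lt_of_not_ge fun hle => hmem ⟨hge, hle⟩
        refine deriv_eq_one_of_eq_add_on (c := 1 + ℓ) isOpen_Ioi hgt fun y hy => ?_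
        rw [hright σ hσ y (Set.mem_Ioi.1 hy).le, add_assoc]
  have main : ∀ σ ∈ Set.Icc (0 : ℝ) 1, ∀ u ∈ Set.Icc (0 : ℝ) 1, ∀ z : ℝ,
      h σ (-1) ≤ z → z ≤ h σ 1 →
      (z ≤ ℓ → F σ u z ≤ K u 1) ∧
      (ℓ ≤ z → z ≤ 2 + ℓ → F σ u z ≤ K u (z - 1 - ℓ)) := by
    intro σ hσ u hu z hz₁ hz₂
    obtain ⟨w, hw, hwz, hFK, hFk⟩ := key σ hσ u hu z hz₁ hz₂
    refine ⟨fun _ => hFK.trans (hmax 1 ⟨hδ₁.le, le_rfl⟩ u hu w (abs_le.2 hw)), fun hz hz' => ?_⟩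
    rcases le_total w zD' with hle | hge
    · have heq := hleft σ hσ w hle
      have hshift : 0 ≤ σ * (1 + ℓ) := mul_nonneg hσ.1 (by linarith)
      exact hFK.trans (hanti u hu _ _ (by linarith) (by linarith) (by linarith [hzD'.2]))
    · rcases le_total w zD with hle | hge'
      · exact (hFk ⟨hge, hle⟩).trans (hbelow u hu _ ⟨by linarith, by linarith⟩).1
      · have heq := hright σ hσ w hge'
        rwa [show z - 1 - ℓ = w by linarith]
  refine ⟨fun σ hσ u hu z hz₁ hz₂ =>
    ⟨fun _ => (main σ hσ u hu z hz₁ hz₂).1, (main σ hσ u hu z hz₁ hz₂).2⟩, ?_⟩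
  intro u hu z hz₁ hz₂
  have hone : (1 : ℝ) ∈ Set.Icc (0 : ℝ) 1 := ⟨zero_le_one, le_rfl⟩
  have hlow : h 1 (-1) ≤ z := by
    rw [hleft 1 hone (-1) hzD'.1.le]
    linarith
  have hhigh : z ≤ h 1 1 := by
    rw [hright 1 hone 1 hzD.2.le]
    linarith
  have hmain := main 1 hone u hu z hlow hhigh
  refine ⟨fun hz => ?_, fun _ => hmain.1, fun hz => hmain.2 hz hz₂⟩
  obtain ⟨w, hw, hwz, hFK, hFk⟩ := key 1 hone u hu z hlow hhigh
  rcases le_total w zD' with hle | hge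
  · have heq := hleft 1 hone w hle
    rwa [show z + 1 + ℓ = w by linarith]
  · rcases le_total w zD with hle | hge'
    · exact (hFk ⟨hge, hle⟩).trans (hbelow u hu _ ⟨by linarith, by linarith⟩).1
    · have heq := hright 1 hone w hge'
      linarith [hw.1]
end

section
/- Let ℓ > 0, η ∈ (0, ℓ), and let β : [−ℓ, ℓ] → ℝ be continuous with β ≥ 0 and β(z) = 0 whenever |z| ≥ ℓ − η. Let C ∈ (0,1) and let ℓ′ > ℓ satisfy 2Cℓ′ > ∫_{−ℓ}^{ℓ} e^{β(z)} dz. Then there exist a C^∞ function h : [−ℓ′, ℓ′] → [−ℓ, ℓ] with h′ > 0 everywhere which is a bijection from [−ℓ′, ℓ′] onto [−ℓ, ℓ], and η′ ∈ (0, ℓ′), such that h(w) = w + (ℓ′ − ℓ) for all w ∈ [−ℓ′, −ℓ′ + η′], h(w) = w − (ℓ′ − ℓ) for all w ∈ [ℓ′ − η′, ℓ′], and h′(w) ≤ C · e^{−β(h(w))} for every w ∈ [−ℓ′, ℓ′] with |h(w)| ≤ ℓ − η. -/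
/-- A continuous function on a compact interval whose integral is less than `M` is dominated by a
polynomial whose integral is still less than `M`. -/
theorem exists_polynomial_ge_integral_lt {a b M : ℝ} (hab : a < b) {f : ℝ → ℝ}
    (hf : ContinuousOn f (Set.Icc a b)) (hM : ∫ x in a..b, f x < M) :
    ∃ p : Polynomial ℝ, (∀ x ∈ Set.Icc a b, f x ≤ p.eval x) ∧ ∫ x in a..b, p.eval x < M := by
  have hba : 0 < b - a := sub_pos.2 hab
  set ε : ℝ := (M - ∫ x in a..b, f x) / (3 * (b - a))
  have hεpos : 0 < ε := div_pos (sub_pos.2 hM) (by positivity)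
  have hεmul : ε * (3 * (b - a)) = M - ∫ x in a..b, f x := div_mul_cancel₀ _ (by positivity)
  obtain ⟨p, hp⟩ := exists_polynomial_near_of_continuousOn a b f hf ε hεpos
  have hfi : IntervalIntegrable f MeasureTheory.volume a b :=
    ContinuousOn.intervalIntegrable (by rwa [Set.uIcc_of_le hab.le])
  refine ⟨p + Polynomial.C ε, fun x hx => ?_, ?_⟩
  · have := abs_lt.1 (hp x hx)
    simp only [Polynomial.eval_add, Polynomial.eval_C]
    linarith
  · calc ∫ x in a..b, (p + Polynomial.C ε).eval x
        ≤ ∫ x in a..b, (f x + 2 * ε) := by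
          refine intervalIntegral.integral_mono_on hab.le
            ((Polynomial.continuous _).intervalIntegrable _ _)
            (hfi.add intervalIntegrable_const) fun x hx => ?_
          have := abs_lt.1 (hp x hx)
          simp only [Polynomial.eval_add, Polynomial.eval_C]
          linarith
      _ = (∫ x in a..b, f x) + (b - a) * (2 * ε) := by
          rw [intervalIntegral.integral_add hfi intervalIntegrable_const,
            intervalIntegral.integral_const, smul_eq_mul]
      _ < M := by nlinarith

/-- A continuous function `f ≥ 1` on `[-ℓ, ℓ]` with integral less than `M` is dominated on
`[-r, r]` by a smooth function that equals `1` outside `(-R, R)` and has integral exactly `M`. -/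
theorem exists_contDiff_ge_integral_eq {ℓ r R M : ℝ} (hr : 0 < r) (hrR : r < R) (hRℓ : R ≤ ℓ)
    {f : ℝ → ℝ} (hf : ContinuousOn f (Set.Icc (-ℓ) ℓ)) (hf1 : ∀ x ∈ Set.Icc (-ℓ) ℓ, 1 ≤ f x)
    (hM : ∫ x in (-ℓ)..ℓ, f x < M) :
    ∃ φ : ℝ → ℝ, ContDiff ℝ (⊤ : ℕ∞) φ ∧ (∀ x, 1 ≤ φ x) ∧ (∀ x, R ≤ |x| → φ x = 1) ∧
      (∀ x, |x| ≤ r → f x ≤ φ x) ∧ ∫ x in (-ℓ)..ℓ, φ x = M := by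
  have hℓ : 0 < ℓ := by linarith
  obtain ⟨p, hfp, hpM⟩ := exists_polynomial_ge_integral_lt (by linarith) hf hM
  let χ : ContDiffBump (0 : ℝ) := ⟨r, R, hr, hrR⟩
  have hχc : Continuous χ := χ.continuous
  have hχ0 : ∀ x, R ≤ |x| → χ x = 0 := fun x hx => χ.zero_of_le_dist (by simpa using hx)
  have hχ1 : ∀ x, |x| ≤ r → χ x = 1 := fun x hx => χ.one_of_mem_closedBall (by simpa using hx)
  have hχpos : 0 < ∫ x in (-ℓ)..ℓ, χ x :=
    intervalIntegral.integral_pos (by linarith) hχc.continuousOn (fun x _ => χ.nonneg)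
      ⟨0, ⟨by linarith, hℓ.le⟩, by rw [hχ1 0 (by simpa using hr.le)]; exact one_pos⟩
  let φ₀ : ℝ → ℝ := fun x => 1 + χ x * (p.eval x - 1)
  have hφ₀c : Continuous φ₀ := by fun_prop
  have hφ₀M : ∫ x in (-ℓ)..ℓ, φ₀ x < M := by
    refine (intervalIntegral.integral_mono_on (by linarith) (hφ₀c.intervalIntegrable _ _)
      (p.continuous.intervalIntegrable _ _) fun x hx => ?_).trans_lt hpM
    have h1 : 0 ≤ p.eval x - 1 := by linarith [hf1 x hx, hfp x hx]
    have := mul_le_mul_of_nonneg_right (χ.le_one (x := x)) h1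
    simp only [φ₀]
    linarith
  set c : ℝ := (M - ∫ x in (-ℓ)..ℓ, φ₀ x) / ∫ x in (-ℓ)..ℓ, χ x with hc
  have hcpos : 0 < c := div_pos (sub_pos.2 hφ₀M) hχpos
  refine ⟨fun x => φ₀ x + c * χ x, ?_, fun x => ?_, fun x hx => ?_, fun x hx => ?_, ?_⟩
  · have hχs : ContDiff ℝ (⊤ : ℕ∞) χ := χ.contDiff
    have hps : ContDiff ℝ (⊤ : ℕ∞) fun x => p.eval x := by
      simpa using p.contDiff_aeval (𝕜 := ℝ) (⊤ : ℕ∞)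
    fun_prop
  · rcases le_total R |x| with hx | hx
    · simp [φ₀, hχ0 x hx]
    · have hx' : x ∈ Set.Icc (-ℓ) ℓ := abs_le.1 (hx.trans hRℓ)
      have h1 : 0 ≤ p.eval x - 1 := by linarith [hf1 x hx', hfp x hx']
      have := mul_nonneg (χ.nonneg (x := x)) h1
      have := mul_nonneg hcpos.le (χ.nonneg (x := x))
      simp only [φ₀]
      linarith
  · simp [φ₀, hχ0 x hx]
  · have := hfp x (abs_le.1 (by linarith))
    simp only [φ₀, hχ1 x hx]
    linarith
  · rw [intervalIntegral.integral_add (hφ₀c.intervalIntegrable _ _)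
      ((hχc.const_mul c).intervalIntegrable _ _), intervalIntegral.integral_const_mul, hc,
      div_mul_cancel₀ _ hχpos.ne']
    ring

/-- A smooth function `φ ≥ 1` on the line that equals `1` outside `(-R, R)`, with integral `2 * ℓ'`
over `[-ℓ, ℓ]`, is the derivative of the inverse of a smooth diffeomorphism `h` of the line that
takes `[-ℓ', ℓ']` to `[-ℓ, ℓ]` and is a translation where `h ≤ -R` and where `R ≤ h`. -/
theorem exists_orderIso_deriv_eq_inv {ℓ ℓ' R : ℝ} (hRℓ : R ≤ ℓ) {φ : ℝ → ℝ}
    (hφ : ContDiff ℝ (⊤ : ℕ∞) φ) (hφ1 : ∀ x, 1 ≤ φ x) (hφR : ∀ x, R ≤ |x| → φ x = 1)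
    (hint : ∫ x in (-ℓ)..ℓ, φ x = 2 * ℓ') :
    ∃ h : ℝ ≃o ℝ, ContDiff ℝ (⊤ : ℕ∞) h ∧ (∀ w, deriv h w = (φ (h w))⁻¹) ∧
      (∀ w ≤ -R - (ℓ' - ℓ), h w = w + (ℓ' - ℓ)) ∧
      (∀ w ≥ R + (ℓ' - ℓ), h w = w - (ℓ' - ℓ)) := by
  have hii : ∀ a b, IntervalIntegrable φ MeasureTheory.volume a b :=
    hφ.continuous.intervalIntegrable
  let g : ℝ → ℝ := fun z => -ℓ' + ∫ x in (-ℓ)..z, φ x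
  have hg : ∀ z, HasDerivAt g (φ z) z := fun z =>
    (intervalIntegral.integral_hasDerivAt_right (hii _ _)
      (hφ.continuous.stronglyMeasurableAtFilter _ _) hφ.continuous.continuousAt).const_add _
  have hgd : deriv g = φ := funext fun z => (hg z).deriv
  have hφpos : ∀ x, 0 < φ x := fun x => one_pos.trans_le (hφ1 x)
  have hgs : ContDiff ℝ (⊤ : ℕ∞) g :=
    contDiff_infty_iff_deriv.2 ⟨fun z => (hg z).differentiableAt, hgd ▸ hφ⟩
  have hgm : StrictMono g := strictMono_of_deriv_pos fun z => hgd ▸ hφpos z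
  have hgl : ∀ z ≤ -R, g z = z - (ℓ' - ℓ) := fun z hz => by
    have : ∫ x in (-ℓ)..z, φ x = ∫ x in (-ℓ)..z, (1 : ℝ) :=
      intervalIntegral.integral_congr fun x hx => hφR x <| le_abs.2 <| Or.inr <| by
        have := hx.2.trans (max_le (neg_le_neg hRℓ) hz)
        linarith
    simp only [g, this, intervalIntegral.integral_const, smul_eq_mul]
    ring
  have hgr : ∀ z ≥ R, g z = z + (ℓ' - ℓ) := fun z hz => by
    have : ∫ x in ℓ..z, φ x = ∫ x in ℓ..z, (1 : ℝ) :=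
      intervalIntegral.integral_congr fun x hx =>
        hφR x <| le_abs.2 <| Or.inl <| (le_min hRℓ hz).trans hx.1
    simp only [g, ← intervalIntegral.integral_add_adjacent_intervals (hii (-ℓ) ℓ) (hii ℓ z), hint,
      this, intervalIntegral.integral_const, smul_eq_mul]
    ring
  have hgsurj : Function.Surjective g := by
    refine hgs.continuous.surjective ?_ ?_
    · refine (Filter.tendsto_atTop_add_const_right _ (ℓ' - ℓ) Filter.tendsto_id).congr' ?_
      filter_upwards [Filter.eventually_ge_atTop R] with z hz using (hgr z hz).symm
    · refine (Filter.tendsto_atBot_add_const_right _ (-(ℓ' - ℓ)) Filter.tendsto_id).congr' ?_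
      filter_upwards [Filter.eventually_le_atBot (-R)] with z hz using (hgl z hz).symm
  let G : ℝ ≃o ℝ := hgm.orderIsoOfSurjective g hgsurj
  have hGsymm : ∀ {z w}, g z = w → G.symm w = z := fun {z w} hzw =>
    G.symm_apply_eq.2 hzw.symm
  refine ⟨G.symm, ?_, fun w => ?_, fun w hw => ?_, fun w hw => ?_⟩
  · exact G.toHomeomorph.contDiff_symm_deriv (fun x => (hφpos x).ne') hg hgs
  · exact (HasDerivAt.of_local_left_inverse (f := g) G.symm.continuous.continuousAt (hg _)
      (hφpos _).ne' (Filter.Eventually.of_forall G.apply_symm_apply)).deriv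
  · exact hGsymm (by rw [hgl _ (by linarith)]; ring)
  · exact hGsymm (by rw [hgr _ (by linarith)]; ring)


/-- The analytic core of Lemma 4.18 (l:ChangeNeck): given a bump function
`β ≥ 0` on `[−ℓ,ℓ]` vanishing for `|z| ≥ ℓ−η`, a constant `C ∈ (0,1)` and a length
`ℓ′ > ℓ` with `2Cℓ′ > ∫_{−ℓ}^{ℓ} e^{β}`, there is a smooth increasing
reparametrization `h : [−ℓ′,ℓ′] → [−ℓ,ℓ]` which is a translation near both ends and
whose derivative satisfies `h′(w) ≤ C·e^{−β(h(w))}` wherever `|h(w)| ≤ ℓ−η`. -/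
theorem neck_reparametrization (ℓ η : ℝ) (hℓ : 0 < ℓ) (hη : η ∈ Set.Ioo (0 : ℝ) ℓ)
    (β : ℝ → ℝ) (hβc : ContinuousOn β (Set.Icc (-ℓ) ℓ))
    (hβ0 : ∀ z ∈ Set.Icc (-ℓ) ℓ, 0 ≤ β z)
    (hβv : ∀ z ∈ Set.Icc (-ℓ) ℓ, ℓ - η ≤ |z| → β z = 0)
    (C : ℝ) (hC : C ∈ Set.Ioo (0 : ℝ) 1)
    (ℓ' : ℝ) (hℓ' : ℓ < ℓ')
    (hlen : ∫ z in (-ℓ)..ℓ, Real.exp (β z) < 2 * C * ℓ') :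
    ∃ h : ℝ → ℝ, ContDiff ℝ (⊤ : ℕ∞) h ∧
      (∀ w ∈ Set.Icc (-ℓ') ℓ', 0 < deriv h w) ∧
      Set.BijOn h (Set.Icc (-ℓ') ℓ') (Set.Icc (-ℓ) ℓ) ∧
      ∃ η' ∈ Set.Ioo (0 : ℝ) ℓ',
        (∀ w ∈ Set.Icc (-ℓ') (-ℓ' + η'), h w = w + (ℓ' - ℓ)) ∧
        (∀ w ∈ Set.Icc (ℓ' - η') ℓ', h w = w - (ℓ' - ℓ)) ∧
        (∀ w ∈ Set.Icc (-ℓ') ℓ', |h w| ≤ ℓ - η →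
          deriv h w ≤ C * Real.exp (-β (h w))) := by
  obtain ⟨hη0, hηℓ⟩ := hη
  obtain ⟨hC0, hC1⟩ := hC
  have hexp : ContinuousOn (fun z => Real.exp (β z) / C) (Set.Icc (-ℓ) ℓ) :=
    (Real.continuous_exp.comp_continuousOn hβc).div_const C
  obtain ⟨φ, hφs, hφ1, hφR, hφβ, hφint⟩ :=
    exists_contDiff_ge_integral_eq (r := ℓ - η) (R := ℓ - η / 2) (M := 2 * ℓ') (by linarith)
      (by linarith) (by linarith) hexp
      (fun z hz => by
        rw [one_le_div hC0]
        exact hC1.le.trans (Real.one_le_exp (hβ0 z hz)))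
      (by
        rw [intervalIntegral.integral_div, div_lt_iff₀ hC0]
        linarith)
  obtain ⟨h, hs, hd, hl, hr⟩ := exists_orderIso_deriv_eq_inv (by linarith) hφs hφ1 hφR hφint
  have hφpos : ∀ x, 0 < φ x := fun x => one_pos.trans_le (hφ1 x)
  refine ⟨h, hs, fun w _ => by rw [hd]; exact inv_pos.2 (hφpos _), ?_, η / 2,
    ⟨by linarith, by linarith⟩, fun w hw => hl w (by linarith [hw.2]),
    fun w hw => hr w (by linarith [hw.1]), fun w _ hw => ?_⟩
  · have himage : h '' Set.Icc (-ℓ') ℓ' = Set.Icc (-ℓ) ℓ := by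
      rw [h.image_Icc, hl _ (by linarith), hr _ (by linarith)]
      congr 1 <;> ring
    exact himage ▸ h.injective.injOn.bijOn_image
  · rw [hd, Real.exp_neg, ← div_eq_mul_inv, ← inv_div]
    exact inv_anti₀ (by positivity) (hφβ _ hw)
end

section
/- Let a, b, λ be real numbers with a > 0, 0 < b < 1 and λ > a/(1−b). Define k : [0,∞) → ℝ by k(u) = λ(u−b) − a for u ≥ b and k(u) = −a for 0 ≤ u ≤ b. Then k(1) > 0 and s·k(u/s) < k(u) for every real s > 1 and every u ≥ 0; that is, k is a special function. -/
/-- The explicit piecewise linear function `k(u) = λ(u−b) − a` for `u ≥ b`, `k(u) = −a`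
for `0 ≤ u ≤ b` (with `a > 0`, `0 < b < 1`, `λ > a/(1−b)`) is special:
`k 1 > 0` and `s·k(u/s) < k(u)` for every `s > 1` and `u ≥ 0`. -/
theorem example_special_function (a b lam : ℝ)
    (ha : 0 < a) (hb0 : 0 < b) (hb1 : b < 1) (hlam : a / (1 - b) < lam)
    (k : ℝ → ℝ)
    (hk : ∀ u : ℝ, k u = if u ≤ b then -a else lam * (u - b) - a) :
    0 < k 1 ∧ ∀ s : ℝ, 1 < s → ∀ u : ℝ, 0 ≤ u → s * k (u / s) < k u := by
  have h1b : 0 < 1 - b := sub_pos.2 hb1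
  have hlam0 : 0 < lam := (div_pos ha h1b).trans hlam
  rw [div_lt_iff₀ h1b] at hlam
  refine ⟨?_, fun s hs u _ => ?_⟩
  · rw [hk, if_neg hb1.not_ge]
    linarith
  have hs0 : 0 < s := one_pos.trans hs
  have hsa : a < s * a := lt_mul_of_one_lt_left ha hs
  rw [hk (u / s), hk u]
  by_cases hus : u / s ≤ b
  · rw [if_pos hus]
    split_ifs with hub
    · linarith
    · have : 0 < lam * (u - b) := mul_pos hlam0 (by linarith)
      linarith
  · have hsb : b < s * b := lt_mul_of_one_lt_left hb0 hs
    have hub : b * s < u := (lt_div_iff₀ hs0).1 (not_le.1 hus)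
    rw [if_neg hus, if_neg (by linarith)]
    have hscale : s * (lam * (u / s - b) - a) = lam * (u - s * b) - s * a := by
      field_simp
    have hmono : lam * (u - s * b) < lam * (u - b) :=
      mul_lt_mul_of_pos_left (by linarith) hlam0
    linarith
end

section
/- Let n ≥ 1 and let h : ℝ → ℝ be C^∞ with h′(z) > 0 for every z. Define Φ_h : ℝ × ℝ^{n−1} × ℝ^{n−1} → ℝ × ℝ^{n−1} × ℝ^{n−1} by Φ_h(z,x,y) = (h(z), √(h′(z))·x, √(h′(z))·y). Then: (a) Φ_h is a C^∞ diffeomorphism onto the open set h(ℝ) × ℝ^{2n−2}; (b) Φ_h is a contactomorphism of λ_st with conformal factor c(z,x,y) = h′(z), i.e. λ_st(Φ_h(p))(DΦ_h(p)v) = h′(z)·λ_st(p)(v) for every p = (z,x,y) and every tangent vector v; (c) for all real numbers a < b and every continuous f : [a,b] → (0,∞), Φ_h maps the set {(z,x,y) : z ∈ [a,b], |x|² + |y|² ≤ f(z)} bijectively onto {(z,x,y) : z ∈ [h(a), h(b)], |x|² + |y|² ≤ h′(h^{−1}(z))·f(h^{−1}(z))}. -/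
/-- A smooth real function with positive derivative is an open embedding. -/
theorem isOpenEmbedding_of_contDiff_of_deriv_pos {h : ℝ → ℝ}
    (hsm : ContDiff ℝ (⊤ : ℕ∞) h) (hpos : ∀ z : ℝ, 0 < deriv h z) :
    Topology.IsOpenEmbedding h :=
  .of_continuous_injective_isOpenMap hsm.continuous (strictMono_of_deriv_pos hpos).injective <|
    isOpenMap_of_hasStrictDerivAt
      (fun _ => hsm.contDiffAt.hasStrictDerivAt (by simp)) fun z => (hpos z).ne'

/-- The inverse of a smooth real function with positive derivative is smooth on its range. -/
theorem contDiffOn_invFun_of_deriv_pos {h : ℝ → ℝ}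
    (hsm : ContDiff ℝ (⊤ : ℕ∞) h) (hpos : ∀ z : ℝ, 0 < deriv h z) :
    ContDiffOn ℝ (⊤ : ℕ∞) (Function.invFun h) (Set.range h) := by
  have he := isOpenEmbedding_of_contDiff_of_deriv_pos hsm hpos
  set e := he.toOpenPartialHomeomorph h with hedef
  have hsymm : ContDiffOn ℝ (⊤ : ℕ∞) e.symm (Set.range h) := by
    intro w hw
    refine (e.contDiffAt_symm_deriv (f₀' := deriv h (e.symm w)) (hpos _).ne' ?_ ?_
      ?_).contDiffWithinAt
    · simpa [hedef] using hw
    · exact (hsm.differentiable (by simp) _).hasDerivAt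
    · exact hsm.contDiffAt
  refine hsymm.congr ?_
  rintro _ ⟨z, rfl⟩
  rw [Function.leftInverse_invFun he.injective z]
  exact (e.left_inv (x := z) (by simp [hedef])).symm

/-- A map that rescales both transverse factors by `k z` over `z ↦ h z` multiplies the standard
contact form by `k z ^ 2`, provided this number is the derivative of `h`. -/
theorem lamSt_fderiv_transverse_scaling {m : ℕ} {h k : ℝ → ℝ} {p : ContactSpace m}
    (hh : DifferentiableAt ℝ h p.1) (hk : DifferentiableAt ℝ k p.1)
    (hsq : k p.1 ^ 2 = deriv h p.1) (v : ContactSpace m) :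
    lamSt m (h p.1, k p.1 • p.2.1, k p.1 • p.2.2)
      (fderiv ℝ (fun q : ContactSpace m => (h q.1, k q.1 • q.2.1, k q.1 • q.2.2)) p v) =
      deriv h p.1 * lamSt m p v := by
  have hfst : HasFDerivAt (fun q : ContactSpace m => q.1) (ContinuousLinearMap.fst ℝ _ _) p :=
    hasFDerivAt_fst
  have hsnd : HasFDerivAt (fun q : ContactSpace m => q.2) (ContinuousLinearMap.snd ℝ _ _) p :=
    hasFDerivAt_snd
  have hk' := hk.hasDerivAt.comp_hasFDerivAt p hfst
  have hD := (hh.hasDerivAt.comp_hasFDerivAt p hfst).prodMk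
    ((hk'.smul hsnd.fst).prodMk (hk'.smul hsnd.snd))
  rw [show fderiv ℝ (fun q : ContactSpace m => (h q.1, k q.1 • q.2.1, k q.1 • q.2.2)) p = _
    from hD.fderiv]
  simp only [lamSt, ← hsq, mul_add, Finset.mul_sum]
  simp
  rw [← Finset.sum_sub_distrib]
  exact Finset.sum_congr rfl fun i _ => by ring

/-- The transverse scaling contactomorphism of Section 4.3 of the paper:
for a smooth `h : ℝ → ℝ` with `h′ > 0` everywhere, the map
`Φ_h(z,x,y) = (h(z), √(h′(z))·x, √(h′(z))·y)` is a `C^∞` diffeomorphism onto the open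
set `h(ℝ) × ℝ^{2n−2}`, is a contactomorphism of `λ_st` with conformal factor `h′(z)`,
and maps each region `{z ∈ [a,b], |x|² + |y|² ≤ f(z)}` bijectively onto
`{z ∈ [h(a),h(b)], |x|² + |y|² ≤ h′(h^{−1}(z))·f(h^{−1}(z))}`. -/
theorem transverse_scaling_contactomorphism (n : ℕ) (hn : 1 ≤ n)
    (h : ℝ → ℝ) (hsm : ContDiff ℝ (⊤ : ℕ∞) h) (hpos : ∀ z : ℝ, 0 < deriv h z)
    (Φ : ContactSpace (n - 1) → ContactSpace (n - 1))
    (hΦ : ∀ p, Φ p = (h p.1, fun i => Real.sqrt (deriv h p.1) * p.2.1 i,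
      fun i => Real.sqrt (deriv h p.1) * p.2.2 i)) :
    (ContDiff ℝ (⊤ : ℕ∞) Φ ∧
      IsOpen {p : ContactSpace (n - 1) | p.1 ∈ Set.range h} ∧
      Set.BijOn Φ Set.univ {p : ContactSpace (n - 1) | p.1 ∈ Set.range h} ∧
      ∃ Ψ : ContactSpace (n - 1) → ContactSpace (n - 1),
        ContDiffOn ℝ (⊤ : ℕ∞) Ψ {p : ContactSpace (n - 1) | p.1 ∈ Set.range h} ∧
        (∀ p, Ψ (Φ p) = p) ∧
        (∀ q ∈ {p : ContactSpace (n - 1) | p.1 ∈ Set.range h}, Φ (Ψ q) = q)) ∧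
    (∀ p v, lamSt (n - 1) (Φ p) (fderiv ℝ Φ p v) = deriv h p.1 * lamSt (n - 1) p v) ∧
    (∀ a b : ℝ, a < b → ∀ f : ℝ → ℝ, ContinuousOn f (Set.Icc a b) →
      (∀ z ∈ Set.Icc a b, 0 < f z) →
      Set.BijOn Φ
        {p : ContactSpace (n - 1) | p.1 ∈ Set.Icc a b ∧
          (∑ i, (p.2.1 i) ^ 2) + ∑ i, (p.2.2 i) ^ 2 ≤ f p.1}
        {p : ContactSpace (n - 1) | p.1 ∈ Set.Icc (h a) (h b) ∧
          (∑ i, (p.2.1 i) ^ 2) + ∑ i, (p.2.2 i) ^ 2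
            ≤ deriv h (Function.invFun h p.1) * f (Function.invFun h p.1)}) := by
  set k : ℝ → ℝ := fun z => Real.sqrt (deriv h z)
  set g := Function.invFun h
  have hmono : StrictMono h := strictMono_of_deriv_pos hpos
  have hkpos : ∀ z, 0 < k z := fun z => Real.sqrt_pos.2 (hpos z)
  have hksq : ∀ z, k z ^ 2 = deriv h z := fun z => Real.sq_sqrt (hpos z).le
  have hksm : ContDiff ℝ (⊤ : ℕ∞) k :=
    (contDiff_infty_iff_deriv.1 hsm).2.sqrt fun z => (hpos z).ne'
  have hgh : ∀ z, g (h z) = z := Function.leftInverse_invFun hmono.injective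
  have hgsm : ContDiffOn ℝ (⊤ : ℕ∞) g (Set.range h) := contDiffOn_invFun_of_deriv_pos hsm hpos
  have hΦ' : Φ = fun p => (h p.1, k p.1 • p.2.1, k p.1 • p.2.2) := funext hΦ
  have hΦsm : ContDiff ℝ (⊤ : ℕ∞) Φ := by
    rw [hΦ']
    fun_prop
  set Ψ : ContactSpace (n - 1) → ContactSpace (n - 1) :=
    fun q => (g q.1, (k (g q.1))⁻¹ • q.2.1, (k (g q.1))⁻¹ • q.2.2) with hΨdef
  have hΨΦ : ∀ p, Ψ (Φ p) = p := by
    intro p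
    simp [hΨdef, hΦ', hgh, smul_smul, inv_mul_cancel₀ (hkpos _).ne']
  have hΦΨ : ∀ q ∈ {p : ContactSpace (n - 1) | p.1 ∈ Set.range h}, Φ (Ψ q) = q := by
    rintro ⟨_, x, y⟩ ⟨z, rfl⟩
    simp [hΨdef, hΦ', hgh, smul_smul, mul_inv_cancel₀ (hkpos _).ne']
  have hΨsm : ContDiffOn ℝ (⊤ : ℕ∞) Ψ {p : ContactSpace (n - 1) | p.1 ∈ Set.range h} := by
    have hg : ContDiffOn ℝ (⊤ : ℕ∞) (fun q : ContactSpace (n - 1) => g q.1)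
        {p : ContactSpace (n - 1) | p.1 ∈ Set.range h} :=
      hgsm.comp contDiff_fst.contDiffOn fun _ hq => hq
    have hkg := (hksm.comp_contDiffOn hg).inv fun q _ => (hkpos (g q.1)).ne'
    exact hg.prodMk ((hkg.smul (contDiff_fst.comp contDiff_snd).contDiffOn).prodMk
      (hkg.smul (contDiff_snd.comp contDiff_snd).contDiffOn))
  have hnorm : ∀ p : ContactSpace (n - 1),
      (∑ i, ((Φ p).2.1 i) ^ 2) + ∑ i, ((Φ p).2.2 i) ^ 2 =
        deriv h p.1 * ((∑ i, (p.2.1 i) ^ 2) + ∑ i, (p.2.2 i) ^ 2) := by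
    intro p
    simp [hΦ', mul_pow, hksq, mul_add, Finset.mul_sum]
  have hfst : ∀ p, (Φ p).1 = h p.1 := fun p => by rw [hΦ']
  have hinj : Function.Injective Φ := Function.LeftInverse.injective hΨΦ
  refine ⟨⟨hΦsm, ?_, ⟨?_, hinj.injOn, ?_⟩, Ψ, hΨsm, hΨΦ, hΦΨ⟩, ?_, ?_⟩
  · exact (isOpenEmbedding_of_contDiff_of_deriv_pos hsm hpos).isOpen_range.preimage continuous_fst
  · exact fun p _ => ⟨p.1, (hfst p).symm⟩
  · exact fun q hq => ⟨Ψ q, Set.mem_univ _, hΦΨ q hq⟩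
  · intro p v
    rw [hΦ']
    exact lamSt_fderiv_transverse_scaling (hsm.differentiable (by simp) _)
      (hksm.differentiable (by simp) _) (hksq _) v
  · intro a b hab f _ _
    have hmem : ∀ p, Φ p ∈ {p : ContactSpace (n - 1) | p.1 ∈ Set.Icc (h a) (h b) ∧
          (∑ i, (p.2.1 i) ^ 2) + ∑ i, (p.2.2 i) ^ 2 ≤ deriv h (g p.1) * f (g p.1)} ↔
        p ∈ {p : ContactSpace (n - 1) | p.1 ∈ Set.Icc a b ∧
          (∑ i, (p.2.1 i) ^ 2) + ∑ i, (p.2.2 i) ^ 2 ≤ f p.1} := by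
      intro p
      simp only [Set.mem_ofPred_eq, hnorm, hfst, hgh, Set.mem_Icc, hmono.le_iff_le,
        mul_le_mul_iff_right₀ (hpos p.1)]
    refine ⟨fun p hp => (hmem p).2 hp, hinj.injOn, fun q hq => ?_⟩
    have hq' : q.1 ∈ Set.range h :=
      Set.image_subset_range _ _ (intermediate_value_Icc hab.le hsm.continuous.continuousOn hq.1)
    exact ⟨Ψ q, (hmem _).1 ((hΦΨ q hq').symm ▸ hq), hΦΨ q hq'⟩
end

section
/- Let n ≥ 1, let g : ℝ → ℝ be C^∞, let z₀ ∈ ℝ, and set θ(z) = ∫_{z₀}^{z} g(s) ds. Regard points of ℝ × ℂ^{n−1} as (z,w) with |w|² = Σ_{i=1}^{n−1} |w_i|², and define on U_+ := {(z,w) : 1 + g(z)|w|² > 0} the map Ψ(z,w) = (z, e^{−iθ(z)}·(1 + g(z)|w|²)^{−1/2}·w). Then: (a) Ψ is a C^∞ diffeomorphism from U_+ onto U_− := {(z,w) : 1 − g(z)|w|² > 0}, and the map defined by the same formula with g replaced by −g (same z₀) is its inverse; (b) Ψ is a contactomorphism of λ_st with conformal factor c(z,w) = (1 + g(z)|w|²)^{−1},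 i.e. λ_st(Ψ(p))(DΨ(p)v) = (1 + g(z)|w|²)^{−1}·λ_st(p)(v) for every p = (z,w) ∈ U_+ and every tangent vector v; (c) if f₁, f₂ : ℝ → (0,∞) are continuous and g(z) = 1/f₁(z) − 1/f₂(z) for all z, then Ψ maps {(z,w) : |w|² ≤ f₂(z)} bijectively onto {(z,w) : |w|² ≤ f₁(z)}. -/
/-- Points of `ℝ × ℂ^{n−1}`, written `p = (z, w)`. -/
abbrev CxContactSpace (m : ℕ) : Type := ℝ × (Fin m → ℂ)

/-- The standard contact form `dz + Σ (x_i dy_i − y_i dx_i)` on `ℝ × ℂ^{n−1}`,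
evaluated at `p = (z,w)` on the tangent vector `v = (ζ,ω)`:
`ζ + Σ Im(conj(w_i)·ω_i) = ζ + Σ (Re w_i · Im ω_i − Im w_i · Re ω_i)`. -/
noncomputable def lamStC (m : ℕ) (p v : CxContactSpace m) : ℝ :=
  v.1 + ∑ i, ((p.2 i).re * (v.2 i).im - (p.2 i).im * (v.2 i).re)

/-- The squared norm `|w|² = Σ |w_i|²`. -/
noncomputable def normSqC (m : ℕ) (w : Fin m → ℂ) : ℝ := ∑ i, Complex.normSq (w i)

/-- The map `(z, w) ↦ (z, e^{−iθ(z)} (1 + g(z)|w|²)^{−1/2} w)`. -/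
noncomputable def twistMap (m : ℕ) (g θ : ℝ → ℝ) (p : CxContactSpace m) : CxContactSpace m :=
  (p.1, fun i => Complex.exp (-(θ p.1 : ℂ) * Complex.I)
    * (((1 + g p.1 * normSqC m p.2) ^ (-(1 / 2 : ℝ)) : ℝ) : ℂ) * p.2 i)

lemma normSqC_nonneg (m : ℕ) (w : Fin m → ℂ) : 0 ≤ normSqC m w :=
  Finset.sum_nonneg fun i _ => Complex.normSq_nonneg (w i)

lemma normSqC_mul (m : ℕ) (a : ℂ) (w : Fin m → ℂ) :
    normSqC m (fun i => a * w i) = Complex.normSq a * normSqC m w := by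
  simp [normSqC, Finset.mul_sum]

lemma rpow_neg_half_mul_self {x : ℝ} (hx : 0 < x) :
    x ^ (-(1 / 2 : ℝ)) * x ^ (-(1 / 2 : ℝ)) = x⁻¹ := by
  rw [← Real.rpow_add hx, ← Real.rpow_neg_one]
  norm_num

lemma normSq_exp_neg_ofReal_mul_I (t : ℝ) :
    Complex.normSq (Complex.exp (-(t : ℂ) * Complex.I)) = 1 := by
  rw [Complex.normSq_eq_norm_sq, ← Complex.ofReal_neg, Complex.norm_exp_ofReal_mul_I, one_pow]

lemma normSqC_twistMap {m : ℕ} {g θ : ℝ → ℝ} {p : CxContactSpace m}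
    (hp : 0 < 1 + g p.1 * normSqC m p.2) :
    normSqC m (twistMap m g θ p).2 = normSqC m p.2 / (1 + g p.1 * normSqC m p.2) := by
  simp only [twistMap]
  rw [normSqC_mul, Complex.normSq_mul, normSq_exp_neg_ofReal_mul_I, Complex.normSq_ofReal,
    rpow_neg_half_mul_self hp]
  ring

lemma one_sub_mul_normSqC_twistMap {m : ℕ} {g θ : ℝ → ℝ} {p : CxContactSpace m}
    (hp : 0 < 1 + g p.1 * normSqC m p.2) :
    1 - g p.1 * normSqC m (twistMap m g θ p).2 = (1 + g p.1 * normSqC m p.2)⁻¹ := by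
  rw [normSqC_twistMap hp]
  field_simp
  ring

lemma twistMap_neg_twistMap {m : ℕ} {g θ : ℝ → ℝ} {p : CxContactSpace m}
    (hp : 0 < 1 + g p.1 * normSqC m p.2) : twistMap m (-g) (-θ) (twistMap m g θ p) = p := by
  have h := one_sub_mul_normSqC_twistMap (θ := θ) hp
  refine Prod.ext rfl (funext fun i => ?_)
  change Complex.exp (-((-θ p.1 : ℝ) : ℂ) * Complex.I)
    * (((1 + -g p.1 * normSqC m (twistMap m g θ p).2) ^ (-(1 / 2 : ℝ)) : ℝ) : ℂ)
    * (Complex.exp (-(θ p.1 : ℂ) * Complex.I)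
    * (((1 + g p.1 * normSqC m p.2) ^ (-(1 / 2 : ℝ)) : ℝ) : ℂ) * p.2 i) = p.2 i
  rw [neg_mul (g p.1), ← sub_eq_add_neg, h]
  have he : Complex.exp (-((-θ p.1 : ℝ) : ℂ) * Complex.I)
      * Complex.exp (-(θ p.1 : ℂ) * Complex.I) = 1 := by
    rw [← Complex.exp_add]
    simp
  have hr : (((1 + g p.1 * normSqC m p.2)⁻¹ ^ (-(1 / 2 : ℝ)) : ℝ) : ℂ)
      * (((1 + g p.1 * normSqC m p.2) ^ (-(1 / 2 : ℝ)) : ℝ) : ℂ) = 1 := by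
    rw [← Complex.ofReal_mul, ← Real.mul_rpow (inv_nonneg.2 hp.le) hp.le,
      inv_mul_cancel₀ hp.ne', Real.one_rpow, Complex.ofReal_one]
  linear_combination p.2 i * he * (((1 + g p.1 * normSqC m p.2)⁻¹ ^ (-(1 / 2 : ℝ)) : ℝ) : ℂ)
      * (((1 + g p.1 * normSqC m p.2) ^ (-(1 / 2 : ℝ)) : ℝ) : ℂ) + p.2 i * hr

lemma twistMap_twistMap_neg {m : ℕ} {g θ : ℝ → ℝ} {p : CxContactSpace m}
    (hp : 0 < 1 - g p.1 * normSqC m p.2) : twistMap m g θ (twistMap m (-g) (-θ) p) = p := by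
  simpa using twistMap_neg_twistMap (g := -g) (θ := -θ) (p := p)
    (by simpa [sub_eq_add_neg] using hp)

lemma mapsTo_twistMap (m : ℕ) (g θ : ℝ → ℝ) :
    Set.MapsTo (twistMap m g θ) {p | 0 < 1 + g p.1 * normSqC m p.2}
      {p | 0 < 1 - g p.1 * normSqC m p.2} := by
  intro p hp
  change 0 < 1 - g p.1 * normSqC m (twistMap m g θ p).2
  rw [one_sub_mul_normSqC_twistMap hp]
  exact inv_pos.2 hp

lemma contDiff_normSqC (m : ℕ) : ContDiff ℝ (⊤ : ℕ∞) (normSqC m) := by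
  unfold normSqC
  simp only [Complex.normSq_apply]
  have hre (i : Fin m) : ContDiff ℝ (⊤ : ℕ∞) fun w : Fin m → ℂ => (w i).re :=
    Complex.reCLM.contDiff.comp (contDiff_apply ℝ ℂ i)
  have him (i : Fin m) : ContDiff ℝ (⊤ : ℕ∞) fun w : Fin m → ℂ => (w i).im :=
    Complex.imCLM.contDiff.comp (contDiff_apply ℝ ℂ i)
  exact ContDiff.sum fun i _ => ((hre i).mul (hre i)).add ((him i).mul (him i))

lemma contDiffAt_rpow_one_add {m : ℕ} {g : ℝ → ℝ} (hg : ContDiff ℝ (⊤ : ℕ∞) g)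
    {p : CxContactSpace m} (hp : 0 < 1 + g p.1 * normSqC m p.2) :
    ContDiffAt ℝ (⊤ : ℕ∞)
      (fun q : CxContactSpace m => (1 + g q.1 * normSqC m q.2) ^ (-(1 / 2 : ℝ))) p :=
  (contDiff_const.add ((hg.comp contDiff_fst).mul
    ((contDiff_normSqC m).comp contDiff_snd))).contDiffAt.rpow_const_of_ne hp.ne'

lemma contDiffAt_twistMap {m : ℕ} {g θ : ℝ → ℝ} (hg : ContDiff ℝ (⊤ : ℕ∞) g)
    (hθ : ContDiff ℝ (⊤ : ℕ∞) θ) {p : CxContactSpace m}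
    (hp : 0 < 1 + g p.1 * normSqC m p.2) :
    ContDiffAt ℝ (⊤ : ℕ∞) (twistMap m g θ) p := by
  have he : ContDiff ℝ (⊤ : ℕ∞) fun q : CxContactSpace m =>
      Complex.exp (-(θ q.1 : ℂ) * Complex.I) :=
    (((Complex.ofRealCLM.contDiff.comp (hθ.comp contDiff_fst)).neg).mul contDiff_const).cexp
  have hr := Complex.ofRealCLM.contDiff.contDiffAt.comp p (contDiffAt_rpow_one_add hg hp)
  refine contDiffAt_fst.prodMk (contDiffAt_pi.2 fun i => ?_)
  exact (he.contDiffAt.mul hr).mul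
    ((contDiff_apply ℝ ℂ i).comp contDiff_snd).contDiffAt

lemma lamStC_mul (m : ℕ) (a b : ℂ) (z ζ : ℝ) (w ω : Fin m → ℂ) :
    lamStC m (z, fun i => a * w i) (ζ, fun i => a * ω i + b * w i)
      = ζ + Complex.normSq a * (lamStC m (z, w) (ζ, ω) - ζ)
        + (a.re * b.im - a.im * b.re) * normSqC m w := by
  simp only [lamStC, normSqC, Complex.normSq_apply, Complex.add_re, Complex.add_im,
    Complex.mul_re, Complex.mul_im, add_sub_cancel_left, Finset.mul_sum, add_assoc]
  rw [← Finset.sum_add_distrib]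
  congr 1
  exact Finset.sum_congr rfl fun i _ => by ring

lemma lamStC_fderiv_twistMap {m : ℕ} {g θ : ℝ → ℝ} (hg : ContDiff ℝ (⊤ : ℕ∞) g)
    (hθ : ∀ z, HasDerivAt θ (g z) z) {p : CxContactSpace m}
    (hp : 0 < 1 + g p.1 * normSqC m p.2) (v : CxContactSpace m) :
    lamStC m (twistMap m g θ p) (fderiv ℝ (twistMap m g θ) p v)
      = (1 + g p.1 * normSqC m p.2)⁻¹ * lamStC m p v := by
  obtain ⟨ρ', hρ⟩ := (contDiffAt_rpow_one_add hg hp).differentiableAt (by simp)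
  have hθ' : HasFDerivAt (fun q : CxContactSpace m => -(θ q.1 : ℂ) * Complex.I) _ p :=
    (((Complex.ofRealCLM.hasFDerivAt).comp p
      ((hθ p.1).hasFDerivAt.comp p hasFDerivAt_fst)).neg).mul_const Complex.I
  have hA := hθ'.cexp.mul (Complex.ofRealCLM.hasFDerivAt.comp p hρ)
  have hw (i : Fin m) : HasFDerivAt (fun q : CxContactSpace m => q.2 i)
      ((ContinuousLinearMap.proj i).comp (ContinuousLinearMap.snd ℝ ℝ (Fin m → ℂ))) p :=
    ((ContinuousLinearMap.proj (φ := fun _ => ℂ) i).comp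
      (ContinuousLinearMap.snd ℝ ℝ (Fin m → ℂ))).hasFDerivAt
  have hT : HasFDerivAt (twistMap m g θ) _ p :=
    hasFDerivAt_fst.prodMk (hasFDerivAt_pi.2 fun i => hA.mul (hw i))
  set r : ℝ := (1 + g p.1 * normSqC m p.2) ^ (-(1 / 2 : ℝ)) with hr
  set e : ℂ := Complex.exp (-(θ p.1 : ℂ) * Complex.I) with he
  have hv : fderiv ℝ (twistMap m g θ) p v = (v.1, fun i =>
      e * r * v.2 i + (e * ρ' v + e * r * (-(v.1 * g p.1 : ℝ) * Complex.I)) * p.2 i) := by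
    rw [hT.fderiv]
    refine Prod.ext rfl (funext fun i => ?_)
    simp [he, hr]
    ring
  have hp' : twistMap m g θ p = (p.1, fun i => e * r * p.2 i) := rfl
  have hn : e.re * e.re + e.im * e.im = 1 := by
    rw [← Complex.normSq_apply, normSq_exp_neg_ofReal_mul_I]
  have hrr : r * r = (1 + g p.1 * normSqC m p.2)⁻¹ := rpow_neg_half_mul_self hp
  rw [hv, hp', lamStC_mul, Complex.normSq_mul, Complex.normSq_ofReal, hrr,
    normSq_exp_neg_ofReal_mul_I]
  have him : ((e * r).re * (e * ρ' v + e * r * (-(v.1 * g p.1 : ℝ) * Complex.I)).im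
      - (e * r).im * (e * ρ' v + e * r * (-(v.1 * g p.1 : ℝ) * Complex.I)).re)
      = -(v.1 * g p.1) * (1 + g p.1 * normSqC m p.2)⁻¹ := by
    rw [← hrr]
    simp only [Complex.add_re, Complex.add_im, Complex.mul_re, Complex.mul_im, Complex.ofReal_re,
      Complex.ofReal_im, Complex.neg_re, Complex.neg_im, Complex.I_re, Complex.I_im]
    linear_combination -(v.1 * g p.1) * (r * r) * hn
  rw [him]
  field_simp
  ring

lemma one_add_mul_pos {a b u : ℝ} (ha : 0 < a) (hb : 0 < b) (hu : 0 ≤ u) (hub : u ≤ b) :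
    0 < 1 + (1 / a - 1 / b) * u := by
  rcases hu.eq_or_lt with rfl | hu
  · simp
  · have h1 : 0 < u / a := div_pos hu ha
    have h2 : u / b ≤ 1 := (div_le_one hb).2 hub
    have h3 : 1 + (1 / a - 1 / b) * u = u / a + (1 - u / b) := by ring
    linarith

lemma div_one_add_mul_le {a b u : ℝ} (ha : 0 < a) (hb : 0 < b) (hu : 0 ≤ u) (hub : u ≤ b) :
    u / (1 + (1 / a - 1 / b) * u) ≤ a := by
  rw [div_le_iff₀ (one_add_mul_pos ha hb hu hub)]
  have h2 : u / b ≤ 1 := (div_le_one hb).2 hub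
  have h3 : a * (1 + (1 / a - 1 / b) * u) = u + a * (1 - u / b) := by
    field_simp
    ring
  nlinarith

lemma mapsTo_twistMap_le {m : ℕ} {g : ℝ → ℝ} (θ : ℝ → ℝ) {f₁ f₂ : ℝ → ℝ}
    (h₁ : ∀ z, 0 < f₁ z) (h₂ : ∀ z, 0 < f₂ z) (hgf : ∀ z, g z = 1 / f₁ z - 1 / f₂ z) :
    Set.MapsTo (twistMap m g θ) {p | normSqC m p.2 ≤ f₂ p.1} {p | normSqC m p.2 ≤ f₁ p.1} := by
  intro p hp
  change normSqC m (twistMap m g θ p).2 ≤ f₁ p.1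
  have hpos := one_add_mul_pos (h₁ p.1) (h₂ p.1) (normSqC_nonneg m p.2) hp
  rw [← hgf] at hpos
  rw [normSqC_twistMap hpos, hgf]
  exact div_one_add_mul_le (h₁ p.1) (h₂ p.1) (normSqC_nonneg m p.2) hp

lemma bijOn_twistMap_of_mapsTo {m : ℕ} {g θ : ℝ → ℝ} {s t : Set (CxContactSpace m)}
    (hs : ∀ p ∈ s, 0 < 1 + g p.1 * normSqC m p.2) (ht : ∀ p ∈ t, 0 < 1 - g p.1 * normSqC m p.2)
    (hst : Set.MapsTo (twistMap m g θ) s t) (hts : Set.MapsTo (twistMap m (-g) (-θ)) t s) :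
    Set.BijOn (twistMap m g θ) s t :=
  Set.InvOn.bijOn ⟨fun p hp => twistMap_neg_twistMap (hs p hp),
    fun p hp => twistMap_twistMap_neg (ht p hp)⟩ hst hts

/-- The twist contactomorphism of Section 4.3 of the paper: with
`θ(z) = ∫_{z₀}^{z} g`, the map `Ψ(z,w) = (z, e^{−iθ(z)}(1+g(z)|w|²)^{−1/2} w)` is a
`C^∞` diffeomorphism from `U₊ = {1+g(z)|w|² > 0}` onto `U₋ = {1−g(z)|w|² > 0}` with
inverse given by the same formula for `−g`; it is a contactomorphism of `λ_st` with
conformal factor `(1+g(z)|w|²)^{−1}`; and if `g = 1/f₁ − 1/f₂` then it maps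
`{|w|² ≤ f₂(z)}` bijectively onto `{|w|² ≤ f₁(z)}`. -/
theorem twist_contactomorphism (n : ℕ) (hn : 1 ≤ n)
    (g : ℝ → ℝ) (hg : ContDiff ℝ (⊤ : ℕ∞) g) (z₀ : ℝ)
    (θ : ℝ → ℝ) (hθ : ∀ z : ℝ, θ z = ∫ s in z₀..z, g s)
    (Ψ Ψ' : CxContactSpace (n - 1) → CxContactSpace (n - 1))
    (hΨ : ∀ p, Ψ p = (p.1, fun i =>
      Complex.exp (-(θ p.1 : ℂ) * Complex.I)
        * (((1 + g p.1 * normSqC (n - 1) p.2) ^ (-(1 / 2 : ℝ)) : ℝ) : ℂ) * p.2 i))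
    (hΨ' : ∀ p, Ψ' p = (p.1, fun i =>
      Complex.exp ((θ p.1 : ℂ) * Complex.I)
        * (((1 - g p.1 * normSqC (n - 1) p.2) ^ (-(1 / 2 : ℝ)) : ℝ) : ℂ) * p.2 i)) :
    (ContDiffOn ℝ (⊤ : ℕ∞) Ψ {p : CxContactSpace (n - 1) | 0 < 1 + g p.1 * normSqC (n - 1) p.2} ∧
      Set.BijOn Ψ {p : CxContactSpace (n - 1) | 0 < 1 + g p.1 * normSqC (n - 1) p.2}
        {p : CxContactSpace (n - 1) | 0 < 1 - g p.1 * normSqC (n - 1) p.2} ∧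
      (∀ p ∈ {p : CxContactSpace (n - 1) | 0 < 1 + g p.1 * normSqC (n - 1) p.2},
        Ψ' (Ψ p) = p) ∧
      (∀ p ∈ {p : CxContactSpace (n - 1) | 0 < 1 - g p.1 * normSqC (n - 1) p.2},
        Ψ (Ψ' p) = p)) ∧
    (∀ p ∈ {p : CxContactSpace (n - 1) | 0 < 1 + g p.1 * normSqC (n - 1) p.2}, ∀ v,
      lamStC (n - 1) (Ψ p) (fderiv ℝ Ψ p v)
        = (1 + g p.1 * normSqC (n - 1) p.2)⁻¹ * lamStC (n - 1) p v) ∧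
    (∀ f₁ f₂ : ℝ → ℝ, Continuous f₁ → Continuous f₂ →
      (∀ z : ℝ, 0 < f₁ z) → (∀ z : ℝ, 0 < f₂ z) →
      (∀ z : ℝ, g z = 1 / f₁ z - 1 / f₂ z) →
      Set.BijOn Ψ {p : CxContactSpace (n - 1) | normSqC (n - 1) p.2 ≤ f₂ p.1}
        {p : CxContactSpace (n - 1) | normSqC (n - 1) p.2 ≤ f₁ p.1}) := by
  have hΨ_eq : Ψ = twistMap (n - 1) g θ := funext hΨ
  have hΨ'_eq : Ψ' = twistMap (n - 1) (-g) (-θ) := by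
    funext p
    rw [hΨ' p]
    simp [twistMap, sub_eq_add_neg]
  have hθ_deriv (z : ℝ) : HasDerivAt θ (g z) z := by
    rw [funext hθ]
    exact intervalIntegral.integral_hasDerivAt_right (hg.continuous.intervalIntegrable _ _)
      (hg.continuous.stronglyMeasurableAtFilter _ _) hg.continuous.continuousAt
  have hθ_smooth : ContDiff ℝ (⊤ : ℕ∞) θ := by
    rw [contDiff_infty_iff_deriv, funext fun z => (hθ_deriv z).deriv]
    exact ⟨fun z => (hθ_deriv z).differentiableAt, hg⟩
  subst hΨ_eq hΨ'_eq
  refine ⟨⟨fun p hp => (contDiffAt_twistMap hg hθ_smooth hp).contDiffWithinAt, ?_,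
    fun p hp => twistMap_neg_twistMap hp, fun p hp => twistMap_twistMap_neg hp⟩,
    fun p hp v => lamStC_fderiv_twistMap hg hθ_deriv hp v, ?_⟩
  · refine bijOn_twistMap_of_mapsTo (fun p hp => hp) (fun p hp => hp)
      (mapsTo_twistMap _ g θ) ?_
    simpa [sub_eq_add_neg] using mapsTo_twistMap (n - 1) (-g) (-θ)
  · intro f₁ f₂ _ _ h₁ h₂ hgf
    have hgf' (z : ℝ) : (-g) z = 1 / f₂ z - 1 / f₁ z := by simp [hgf]
    refine bijOn_twistMap_of_mapsTo (fun p hp => ?_) (fun p hp => ?_)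
      (mapsTo_twistMap_le θ h₁ h₂ hgf) (mapsTo_twistMap_le (-θ) h₂ h₁ hgf')
    · rw [hgf]
      exact one_add_mul_pos (h₁ _) (h₂ _) (normSqC_nonneg _ _) hp
    · have := one_add_mul_pos (h₂ p.1) (h₁ p.1) (normSqC_nonneg _ _) hp
      rwa [← hgf', Pi.neg_apply, neg_mul, ← sub_eq_add_neg] at this
end

section
/- Let n ≥ 1, let Θ be the subgroup of bijections of ℝ^{2n+1} generated by the maps T_z, T_{x_n}, S_{y_j}, S_{x_j} (1 ≤ j ≤ n−1), and let Π = {p ∈ ℝ^{2n+1} : y_n(p) = 0}. Then every element of Θ maps Π bijectively onto itself, and for every compact subset Q ⊆ Π the set S(Q) := {g ∈ Θ : g(Q) ∩ Q ≠ ∅} is finite; that is, Θ acts properly discontinuously on Π. -/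
/-- Points of `ℝ^{2n+1}` with `n = m+1`, written `(x, y, z)` where
`x, y : Fin (m+1) → ℝ` list the coordinates `x₁,…,x_n` and `y₁,…,y_n`. -/
abbrev LatticePt (m : ℕ) : Type := (Fin (m + 1) → ℝ) × (Fin (m + 1) → ℝ) × ℝ

/-- The translation `T_z : z ↦ z + 1`. -/
noncomputable def transZ (m : ℕ) : Equiv.Perm (LatticePt m) where
  toFun p := (p.1, p.2.1, p.2.2 + 1)
  invFun p := (p.1, p.2.1, p.2.2 - 1)
  left_inv p := by simp
  right_inv p := by simp

/-- The translation `T_{x_n} : x_n ↦ x_n + 1/2` (at the index `j`). -/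
noncomputable def transX (m : ℕ) (j : Fin (m + 1)) : Equiv.Perm (LatticePt m) where
  toFun p := (Function.update p.1 j (p.1 j + 1 / 2), p.2.1, p.2.2)
  invFun p := (Function.update p.1 j (p.1 j - 1 / 2), p.2.1, p.2.2)
  left_inv p := by simp
  right_inv p := by simp

/-- The shear `S_{y_j} : y_j ↦ y_j + 1, z ↦ z + x_j`. -/
noncomputable def shearY (m : ℕ) (j : Fin (m + 1)) : Equiv.Perm (LatticePt m) where
  toFun p := (p.1, Function.update p.2.1 j (p.2.1 j + 1), p.2.2 + p.1 j)
  invFun p := (p.1, Function.update p.2.1 j (p.2.1 j - 1), p.2.2 - p.1 j)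
  left_inv p := by simp
  right_inv p := by simp

/-- The shear `S_{x_j} : x_j ↦ x_j + 1, z ↦ z − y_j`. -/
noncomputable def shearX (m : ℕ) (j : Fin (m + 1)) : Equiv.Perm (LatticePt m) where
  toFun p := (Function.update p.1 j (p.1 j + 1), p.2.1, p.2.2 - p.2.1 j)
  invFun p := (Function.update p.1 j (p.1 j - 1), p.2.1, p.2.2 + p.2.1 j)
  left_inv p := by simp
  right_inv p := by simp

/-- The generating set of the lattice `Θ`: `T_z`, `T_{x_n}` and the shears
`S_{y_j}`, `S_{x_j}` for `1 ≤ j ≤ n−1`. -/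
def latticeGens (m : ℕ) : Set (Equiv.Perm (LatticePt m)) :=
  {g | g = transZ m ∨ g = transX m (Fin.last m) ∨
    ∃ j : Fin m, g = shearY m j.castSucc ∨ g = shearX m j.castSucc}

/-- The parameters `(a, b, k, c)` are the integer coordinates of `g`: it acts by
`x_j ↦ x_j + a_j`, `y_j ↦ y_j + b_j` for `j < n`, `x_n ↦ x_n + k / 2`, `y_n ↦ y_n` and
`z ↦ z + ∑ (b_j x_j - a_j y_j) + c`. -/
def HasLatticeCoords {m : ℕ} (g : Equiv.Perm (LatticePt m))
    (q : (Fin m → ℤ) × (Fin m → ℤ) × ℤ × ℤ) : Prop :=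
  ∀ p : LatticePt m,
    (∀ j : Fin m, (g p).1 j.castSucc = p.1 j.castSucc + q.1 j) ∧
    (g p).1 (Fin.last m) = p.1 (Fin.last m) + q.2.2.1 / 2 ∧
    (∀ j : Fin m, (g p).2.1 j.castSucc = p.2.1 j.castSucc + q.2.1 j) ∧
    (g p).2.1 (Fin.last m) = p.2.1 (Fin.last m) ∧
    (g p).2.2 = p.2.2 +
      ∑ j : Fin m, (q.2.1 j * p.1 j.castSucc - q.1 j * p.2.1 j.castSucc) + q.2.2.2

namespace HasLatticeCoords

variable {m : ℕ} {g h : Equiv.Perm (LatticePt m)} {q r : (Fin m → ℤ) × (Fin m → ℤ) × ℤ × ℤ}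

theorem unique (hg : HasLatticeCoords g q) (hh : HasLatticeCoords h q) : g = h := by
  ext1 p
  obtain ⟨g1, g2, g3, g4, g5⟩ := hg p
  obtain ⟨h1, h2, h3, h4, h5⟩ := hh p
  refine Prod.ext (funext fun i => ?_) (Prod.ext (funext fun i => ?_) (g5.trans h5.symm))
  · induction i using Fin.lastCases with
    | last => exact g2.trans h2.symm
    | cast j => exact (g1 j).trans (h1 j).symm
  · induction i using Fin.lastCases with
    | last => exact g4.trans h4.symm
    | cast j => exact (g3 j).trans (h3 j).symm

theorem one : HasLatticeCoords (1 : Equiv.Perm (LatticePt m)) 0 := by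
  intro p
  simp

theorem mul (hg : HasLatticeCoords g q) (hh : HasLatticeCoords h r) :
    HasLatticeCoords (g * h) (q.1 + r.1, q.2.1 + r.2.1, q.2.2.1 + r.2.2.1,
      q.2.2.2 + r.2.2.2 + ∑ j, (q.2.1 j * r.1 j - q.1 j * r.2.1 j)) := by
  intro p
  obtain ⟨h1, h2, h3, h4, h5⟩ := hh p
  obtain ⟨g1, g2, g3, g4, g5⟩ := hg (h p)
  rw [Equiv.Perm.mul_apply]
  refine ⟨fun j => ?_, ?_, fun j => ?_, g4.trans h4, ?_⟩
  · rw [g1, h1]; push_cast [Pi.add_apply]; ring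
  · rw [g2, h2]; push_cast; ring
  · rw [g3, h3]; push_cast [Pi.add_apply]; ring
  · rw [g5, h5]
    simp only [h1, h3, Pi.add_apply, Int.cast_add, Int.cast_sum, Int.cast_sub, Int.cast_mul,
      mul_add, add_mul, Finset.sum_sub_distrib, Finset.sum_add_distrib]
    ring

theorem inv (hg : HasLatticeCoords g q) : HasLatticeCoords g⁻¹ (-q) := by
  intro p
  obtain ⟨g1, g2, g3, g4, g5⟩ := hg (g⁻¹ p)
  rw [show g (g⁻¹ p) = p from g.apply_symm_apply p] at g1 g2 g3 g4 g5
  refine ⟨fun j => ?_, ?_, fun j => ?_, g4.symm, ?_⟩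
  · simp [g1]
  · simp [g2]; ring
  · simp [g3]
  · simp only [g1, g3, g5, Prod.fst_neg, Prod.snd_neg, Pi.neg_apply, Int.cast_neg, neg_mul, mul_add,
      Finset.sum_sub_distrib, Finset.sum_add_distrib, Finset.sum_neg_distrib,
      mul_comm (q.2.1 _ : ℝ) (q.1 _ : ℝ)]
    ring

theorem transZ : HasLatticeCoords (transZ m) (0, 0, 0, 1) := by
  intro p
  simp [_root_.transZ]

theorem transX : HasLatticeCoords (transX m (Fin.last m)) (0, 0, 1, 0) := by
  intro p
  simp [_root_.transX, Fin.castSucc_ne_last]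

theorem shearY (i : Fin m) :
    HasLatticeCoords (shearY m i.castSucc) (0, Pi.single i 1, 0, 0) := by
  intro p
  refine ⟨by simp [_root_.shearY], by simp [_root_.shearY], fun j => ?_,
    by simp [_root_.shearY, (Fin.castSucc_ne_last i).symm], ?_⟩
  · rcases eq_or_ne j i with rfl | hj
    · simp [_root_.shearY]
    · simp [_root_.shearY, hj]
  · simp [_root_.shearY, Pi.single_apply]

theorem shearX (i : Fin m) :
    HasLatticeCoords (shearX m i.castSucc) (Pi.single i 1, 0, 0, 0) := by
  intro p
  refine ⟨fun j => ?_, by simp [_root_.shearX, (Fin.castSucc_ne_last i).symm],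
    by simp [_root_.shearX], by simp [_root_.shearX], ?_⟩
  · rcases eq_or_ne j i with rfl | hj
    · simp [_root_.shearX]
    · simp [_root_.shearX, hj]
  · simp [_root_.shearX, Pi.single_apply, sub_eq_add_neg]

theorem exists_of_mem_closure (hg : g ∈ Subgroup.closure (latticeGens m)) :
    ∃ q, HasLatticeCoords g q := by
  induction hg using Subgroup.closure_induction with
  | mem g hg =>
    rcases hg with rfl | rfl | ⟨j, rfl | rfl⟩
    exacts [⟨_, transZ⟩, ⟨_, transX⟩, ⟨_, shearY j⟩, ⟨_, shearX j⟩]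
  | one => exact ⟨_, one⟩
  | mul g h _ _ hg hh => exact ⟨_, hg.choose_spec.mul hh.choose_spec⟩
  | inv g _ hg => exact ⟨_, hg.choose_spec.inv⟩

/-- If `g` moves a point of the ball of radius `R` to a point of that ball, then its coordinates
are bounded in terms of `R`. -/
theorem abs_coords_le (hg : HasLatticeCoords g q) {R : ℝ} {p : LatticePt m}
    (hp : ‖p‖ ≤ R) (hgp : ‖g p‖ ≤ R) :
    (∀ j, |(q.1 j : ℝ)| ≤ 2 * R) ∧ (∀ j, |(q.2.1 j : ℝ)| ≤ 2 * R) ∧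
      |(q.2.2.1 : ℝ)| ≤ 4 * R ∧ |(q.2.2.2 : ℝ)| ≤ 2 * R + m * (4 * R ^ 2) := by
  have coord_le {p : LatticePt m} (hp : ‖p‖ ≤ R) :
      (∀ i, |p.1 i| ≤ R) ∧ (∀ i, |p.2.1 i| ≤ R) ∧ |p.2.2| ≤ R :=
    ⟨fun i => (norm_le_pi_norm p.1 i).trans ((norm_fst_le p).trans hp),
      fun i => (norm_le_pi_norm p.2.1 i).trans
        ((norm_fst_le p.2).trans ((norm_snd_le p).trans hp)),
      (norm_snd_le p.2).trans ((norm_snd_le p).trans hp)⟩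
  have hR : 0 ≤ R := (norm_nonneg p).trans hp
  obtain ⟨px, py, pz⟩ := coord_le hp
  obtain ⟨gx, gy, gz⟩ := coord_le hgp
  obtain ⟨g1, g2, g3, -, g5⟩ := hg p
  have ha (j) : |(q.1 j : ℝ)| ≤ 2 * R := by
    have h1 := abs_le.1 (px j.castSucc)
    have h2 := abs_le.1 (gx j.castSucc)
    have h3 := g1 j
    exact abs_le.2 ⟨by linarith, by linarith⟩
  have hb (j) : |(q.2.1 j : ℝ)| ≤ 2 * R := by
    have h1 := abs_le.1 (py j.castSucc)
    have h2 := abs_le.1 (gy j.castSucc)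
    have h3 := g3 j
    exact abs_le.2 ⟨by linarith, by linarith⟩
  refine ⟨ha, hb, ?_, ?_⟩
  · have h1 := abs_le.1 (px (Fin.last m))
    have h2 := abs_le.1 (gx (Fin.last m))
    exact abs_le.2 ⟨by linarith, by linarith⟩
  · have hsum : |∑ j : Fin m, (q.2.1 j * p.1 j.castSucc - q.1 j * p.2.1 j.castSucc)|
        ≤ m * (4 * R ^ 2) := by
      refine (Finset.abs_sum_le_sum_abs _ _).trans ?_
      refine (Finset.sum_le_card_nsmul _ _ (4 * R ^ 2) fun j _ => ?_).trans_eq (by simp)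
      calc |q.2.1 j * p.1 j.castSucc - q.1 j * p.2.1 j.castSucc|
          ≤ |(q.2.1 j : ℝ)| * |p.1 j.castSucc| + |(q.1 j : ℝ)| * |p.2.1 j.castSucc| := by
            simpa only [abs_mul] using
              abs_sub (q.2.1 j * p.1 j.castSucc) (q.1 j * p.2.1 j.castSucc)
        _ ≤ 2 * R * R + 2 * R * R := by
            gcongr
            exacts [hb j, px _, ha j, py _]
        _ = 4 * R ^ 2 := by ring
    have h1 := abs_le.1 pz
    have h2 := abs_le.1 gz
    have h3 := abs_le.1 hsum
    exact abs_le.2 ⟨by linarith, by linarith⟩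

end HasLatticeCoords

/-- Section 7.1 of the paper: the lattice `Θ` preserves the hyperplane
`Π = {y_n = 0}` and acts properly discontinuously on it: for every compact
`Q ⊆ Π` the set `S(Q) = {g ∈ Θ : g(Q) ∩ Q ≠ ∅}` is finite. -/
theorem lattice_properly_discontinuous (m : ℕ) :
    (∀ g ∈ Subgroup.closure (latticeGens m),
      Set.BijOn (⇑g) {p : LatticePt m | p.2.1 (Fin.last m) = 0}
        {p : LatticePt m | p.2.1 (Fin.last m) = 0}) ∧
    (∀ Q : Set (LatticePt m), IsCompact Q →
      Q ⊆ {p : LatticePt m | p.2.1 (Fin.last m) = 0} →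
      {g : Equiv.Perm (LatticePt m) |
        g ∈ Subgroup.closure (latticeGens m) ∧ ((⇑g '' Q) ∩ Q).Nonempty}.Finite) := by
  refine ⟨fun g hg => ?_, fun Q hQ _ => ?_⟩
  · obtain ⟨q, hq⟩ := HasLatticeCoords.exists_of_mem_closure hg
    refine g.bijOn fun p => ?_
    simp only [Set.mem_ofPred_eq, (hq p).2.2.2.1]
  · classical
    obtain ⟨R, hR⟩ := hQ.isBounded.exists_norm_le
    obtain ⟨N, hN⟩ := exists_nat_ge (max (4 * R) (2 * R + m * (4 * R ^ 2)))
    obtain ⟨hN₁, hN₂⟩ := max_le_iff.1 hN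
    let B : (Fin m → ℤ) × (Fin m → ℤ) × ℤ × ℤ := (fun _ => N, fun _ => N, N, N)
    have hfin : (⋃ q ∈ Set.Icc (-B) B,
        {g : Equiv.Perm (LatticePt m) | HasLatticeCoords g q}).Finite :=
      (Set.finite_Icc _ _).biUnion fun q _ =>
        Set.Subsingleton.finite fun g hg h hh => HasLatticeCoords.unique hg hh
    refine hfin.subset ?_
    rintro g ⟨hg, _, ⟨p, hp, rfl⟩, hgp⟩
    obtain ⟨q, hq⟩ := HasLatticeCoords.exists_of_mem_closure hg
    have hR₀ : 0 ≤ R := (norm_nonneg p).trans (hR p hp)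
    obtain ⟨ha, hb, hk, hc⟩ := hq.abs_coords_le (hR p hp) (hR _ hgp)
    have abs_le_nat {k : ℤ} (h : |(k : ℝ)| ≤ N) : -(N : ℤ) ≤ k ∧ k ≤ N :=
      abs_le.1 (by exact_mod_cast h)
    have ha' (j) := abs_le_nat (k := q.1 j) ((ha j).trans (by linarith))
    have hb' (j) := abs_le_nat (k := q.2.1 j) ((hb j).trans (by linarith))
    have hk' := abs_le_nat (hk.trans hN₁)
    have hc' := abs_le_nat (hc.trans hN₂)
    exact Set.mem_biUnion
      ⟨⟨fun j => (ha' j).1, fun j => (hb' j).1, hk'.1, hc'.1⟩,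
        ⟨fun j => (ha' j).2, fun j => (hb' j).2, hk'.2, hc'.2⟩⟩ hq
end

section
/- Let n ≥ 1 and let Θ be the subgroup of bijections of ℝ^{2n+1} generated by T_z, T_{x_n}, S_{y_j}, S_{x_j} (1 ≤ j ≤ n−1). Define the 1-form α on ℝ^{2n+1} by α(p)(v) = v_z + Σ_{i=1}^{n−1} (x_i(p)·v_{y_i} − y_i(p)·v_{x_i}) − y_n(p)·v_{x_n}, for a point p and a tangent vector v with components (v_{x_1},…,v_{x_n}, v_{y_1},…,v_{y_n}, v_z). Then every g ∈ Θ is a smooth (indeed affine) bijection of ℝ^{2n+1} and preserves α: for every p and every tangent vector v, α(g(p))(Dg(p)v) = α(p)(v), where Dg(p) is the Fréchet derivative of g at p. -/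
/-- The standard contact form `α = dz + Σ_{i=1}^{n−1}(x_i dy_i − y_i dx_i) − y_n dx_n`
of Section 7.1, evaluated at the point `p` on the tangent vector `v`. -/
noncomputable def alphaSt (m : ℕ) (p v : LatticePt m) : ℝ :=
  v.2.2 + (∑ i : Fin m, p.1 i.castSucc * v.2.1 i.castSucc) - ∑ i, p.2.1 i * v.1 i

/-- A permutation is a strict contactomorphism for `alphaSt` if it is smooth with smooth inverse
and its derivative pulls the form back to itself. -/
def IsStrictContacto (m : ℕ) (g : Equiv.Perm (LatticePt m)) : Prop :=
  ContDiff ℝ (⊤ : ℕ∞) (⇑g : LatticePt m → LatticePt m) ∧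
  ContDiff ℝ (⊤ : ℕ∞) (⇑g⁻¹ : LatticePt m → LatticePt m) ∧
  ∀ p v : LatticePt m, alphaSt m (g p) (fderiv ℝ (⇑g : LatticePt m → LatticePt m) p v)
    = alphaSt m p v

namespace IsStrictContacto

variable {m : ℕ} {g h : Equiv.Perm (LatticePt m)}

theorem one : IsStrictContacto m 1 := by
  refine ⟨contDiff_id, contDiff_id, fun p v => ?_⟩
  rw [Equiv.Perm.coe_one, fderiv_id]
  rfl

theorem mul (hg : IsStrictContacto m g) (hh : IsStrictContacto m h) :
    IsStrictContacto m (g * h) := by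
  refine ⟨hg.1.comp hh.1, ?_, fun p v => ?_⟩
  · rw [mul_inv_rev]
    exact hh.2.1.comp hg.2.1
  · rw [Equiv.Perm.coe_mul, fderiv_comp p (hg.1.differentiable (by simp) _)
      (hh.1.differentiable (by simp) _)]
    exact (hg.2.2 _ _).trans (hh.2.2 _ _)

theorem inv (hg : IsStrictContacto m g) : IsStrictContacto m g⁻¹ := by
  refine ⟨hg.2.1, by simpa only [inv_inv] using hg.1, fun p v => ?_⟩
  have hcomp : (⇑g : LatticePt m → LatticePt m) ∘ ⇑g⁻¹ = id := by
    rw [← Equiv.Perm.coe_mul, mul_inv_cancel, Equiv.Perm.coe_one]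
  have hderiv : fderiv ℝ ⇑g (g⁻¹ p) (fderiv ℝ ⇑g⁻¹ p v) = v := by
    rw [← ContinuousLinearMap.comp_apply, ← fderiv_comp p (hg.1.differentiable (by simp) _)
      (hg.2.1.differentiable (by simp) _), hcomp, fderiv_id]
    rfl
  have key := hg.2.2 (g⁻¹ p) (fderiv ℝ ⇑g⁻¹ p v)
  rw [hderiv, show g (g⁻¹ p) = p from g.apply_symm_apply p] at key
  exact key.symm

theorem of_affine (A B : LatticePt m →L[ℝ] LatticePt m) (c d : LatticePt m)
    (hA : ∀ p, g p = A p + c) (hB : ∀ p, g.symm p = B p + d)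
    (h : ∀ p v, alphaSt m (A p + c) (A v) = alphaSt m p v) : IsStrictContacto m g := by
  have hA' : (⇑g : LatticePt m → LatticePt m) = fun p => A p + c := funext hA
  have hB' : (⇑g⁻¹ : LatticePt m → LatticePt m) = fun p => B p + d := funext hB
  refine ⟨?_, ?_, fun p v => ?_⟩
  · rw [hA']
    exact A.contDiff.add contDiff_const
  · rw [hB']
    exact B.contDiff.add contDiff_const
  · rw [hA', fderiv_add_const, A.fderiv]
    exact h p v

end IsStrictContacto

theorem Function.update_add_eq_add_single {ι : Type*} [DecidableEq ι] (f : ι → ℝ) (j : ι) (c : ℝ) :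
    Function.update f j (f j + c) = f + Pi.single j c := by
  ext i
  by_cases hi : i = j
  · subst hi; simp
  · simp [hi]

theorem Function.update_sub_eq_add_single {ι : Type*} [DecidableEq ι] (f : ι → ℝ) (j : ι) (c : ℝ) :
    Function.update f j (f j - c) = f + Pi.single j (-c) := by
  rw [sub_eq_add_neg, Function.update_add_eq_add_single]

/-- The linear shear `z ↦ z + φ(x, y, z)`. -/
noncomputable def zShear (m : ℕ) (φ : LatticePt m →L[ℝ] ℝ) : LatticePt m →L[ℝ] LatticePt m :=
  (ContinuousLinearMap.fst ℝ _ _).prod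
    (((ContinuousLinearMap.fst ℝ _ _).comp (ContinuousLinearMap.snd ℝ _ _)).prod
      ((ContinuousLinearMap.snd ℝ _ _).comp (ContinuousLinearMap.snd ℝ _ _) + φ))

theorem zShear_apply (m : ℕ) (φ : LatticePt m →L[ℝ] ℝ) (p : LatticePt m) :
    zShear m φ p = (p.1, p.2.1, p.2.2 + φ p) := rfl

/-- The coordinate function `x_j`. -/
noncomputable def coordX (m : ℕ) (j : Fin (m + 1)) : LatticePt m →L[ℝ] ℝ :=
  (ContinuousLinearMap.proj j).comp (ContinuousLinearMap.fst ℝ _ _)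

/-- The coordinate function `y_j`. -/
noncomputable def coordY (m : ℕ) (j : Fin (m + 1)) : LatticePt m →L[ℝ] ℝ :=
  (ContinuousLinearMap.proj j).comp
    ((ContinuousLinearMap.fst ℝ _ _).comp (ContinuousLinearMap.snd ℝ _ _))

theorem coordX_apply (m : ℕ) (j : Fin (m + 1)) (p : LatticePt m) : coordX m j p = p.1 j := rfl

theorem coordY_apply (m : ℕ) (j : Fin (m + 1)) (p : LatticePt m) : coordY m j p = p.2.1 j := rfl

theorem isStrictContacto_transZ (m : ℕ) : IsStrictContacto m (transZ m) := by
  refine .of_affine (.id ℝ _) (.id ℝ _) (0, 0, 1) (0, 0, -1) (fun p => ?_) (fun p => ?_)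
    fun p v => ?_
  · simp [transZ, Prod.ext_iff]
  · simp [transZ, Prod.ext_iff, sub_eq_add_neg]
  · simp [alphaSt]

theorem isStrictContacto_transX_last (m : ℕ) : IsStrictContacto m (transX m (Fin.last m)) := by
  refine .of_affine (.id ℝ _) (.id ℝ _) (Pi.single (Fin.last m) (1 / 2), 0, 0)
    (Pi.single (Fin.last m) (-(1 / 2)), 0, 0) (fun p => ?_) (fun p => ?_) fun p v => ?_
  · simp [transX, Prod.ext_iff, Function.update_add_eq_add_single]
  · simp [transX, Prod.ext_iff, Function.update_sub_eq_add_single]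
  · simp [alphaSt, Fin.castSucc_ne_last]

theorem isStrictContacto_shearY (m : ℕ) (j : Fin (m + 1)) : IsStrictContacto m (shearY m j) := by
  refine .of_affine (zShear m (coordX m j)) (zShear m (-coordX m j)) (0, Pi.single j 1, 0)
    (0, Pi.single j (-1), 0) (fun p => ?_) (fun p => ?_) fun p v => ?_
  · simp [shearY, zShear_apply, coordX_apply, Function.update_add_eq_add_single]
  · simp [shearY, zShear_apply, coordX_apply, Function.update_sub_eq_add_single,
      sub_eq_add_neg p.2.2]
  · simp [alphaSt, zShear_apply, coordX_apply, add_mul, Finset.sum_add_distrib, Pi.single_apply]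
    ring

theorem isStrictContacto_shearX_castSucc (m : ℕ) (j : Fin m) :
    IsStrictContacto m (shearX m j.castSucc) := by
  refine .of_affine (zShear m (-coordY m j.castSucc)) (zShear m (coordY m j.castSucc))
    (Pi.single j.castSucc 1, 0, 0) (Pi.single j.castSucc (-1), 0, 0)
    (fun p => ?_) (fun p => ?_) fun p v => ?_
  · simp [shearX, zShear_apply, coordY_apply, Function.update_add_eq_add_single, sub_eq_add_neg]
  · simp [shearX, zShear_apply, coordY_apply, Function.update_sub_eq_add_single]
  · simp [alphaSt, zShear_apply, coordY_apply, add_mul, Finset.sum_add_distrib, Pi.single_apply]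
    ring

/-- Section 7.1 of the paper: every element of the lattice `Θ` is a smooth
transformation of `ℝ^{2n+1}` preserving the contact form
`α = dz + Σ(x_i dy_i − y_i dx_i) − y_n dx_n`; that is, `Θ` is a lattice in the group
of contactomorphisms of `(ℝ^{2n+1}, {α = 0})` preserving `α` strictly. -/
theorem lattice_preserves_contact_form (m : ℕ) :
    ∀ g ∈ Subgroup.closure (latticeGens m),
      ContDiff ℝ (⊤ : ℕ∞) (⇑g : LatticePt m → LatticePt m) ∧
      ∀ p v : LatticePt m,
        alphaSt m (g p) (fderiv ℝ (⇑g : LatticePt m → LatticePt m) p v)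
          = alphaSt m p v := by
  intro g hg
  suffices h : IsStrictContacto m g from ⟨h.1, h.2.2⟩
  induction hg using Subgroup.closure_induction with
  | mem g hg =>
    rcases hg with rfl | rfl | ⟨j, rfl | rfl⟩
    · exact isStrictContacto_transZ m
    · exact isStrictContacto_transX_last m
    · exact isStrictContacto_shearY m _
    · exact isStrictContacto_shearX_castSucc m j
  | one => exact .one
  | mul g h _ _ hg hh => exact hg.mul hh
  | inv g _ hg => exact hg.inv
end
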